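/- Let G and H be one-ended centerless right-angled Artin groups, and assume that every maximal join parabolic subgroup of G has nontrivial center. Let G ↷ (X,μ) and H ↷ (Y,ν) be free irreducible measure-preserving actions on standard probability spaces, and suppose they are stably orbit equivalent through a stable orbit equivalence f : U → V (U ⊆ X, V ⊆ Y of positive measure). Then κ(f) = 1, every SOE cocycle associated to f is cohomologous to the cocycle (g,x) ↦ α(g) for some group isomorphism α : G → H, and the actions are conjugate through a group isomorphism α : G → H. -/

import Mathlib

open MeasureTheory
open scoped ENNReal Pointwise symmDiff

namespace OEPaper

/- ## Right-angled Artin groups and graph combinatorics -/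

/-- The commutation relations defining the right-angled Artin group of a graph. -/
def raagRels {V : Type} (Γ : SimpleGraph V) : Set (FreeGroup V) :=
  {r | ∃ u v : V, Γ.Adj u v ∧
    r = FreeGroup.of u * FreeGroup.of v * (FreeGroup.of u)⁻¹ * (FreeGroup.of v)⁻¹}

/-- The right-angled Artin group of a simple graph `Γ`. -/
abbrev RAAG {V : Type} (Γ : SimpleGraph V) : Type := PresentedGroup (raagRels Γ)

/-- The standard generator of `RAAG Γ` associated to a vertex. -/
def gen {V : Type} (Γ : SimpleGraph V) (v : V) : RAAG Γ := PresentedGroup.of v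

/-- The standard subgroup associated to (the full subgraph spanned by) a set of vertices. -/
def standardSub {V : Type} (Γ : SimpleGraph V) (S : Set V) : Subgroup (RAAG Γ) :=
  Subgroup.closure (gen Γ '' S)

/-- Conjugate of a subgroup. -/
def conjSub {G : Type} [Group G] (g : G) (P : Subgroup G) : Subgroup G :=
  Subgroup.map (MulAut.conj g).toMonoidHom P

/-- Parabolic subgroups: conjugates of standard subgroups. -/
def IsParabolic {V : Type} (Γ : SimpleGraph V) (P : Subgroup (RAAG Γ)) : Prop :=
  ∃ (g : RAAG Γ) (S : Set V), P = conjSub g (standardSub Γ S)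

/-- The "orthogonal" of a set of vertices: vertices outside `S` adjacent to every vertex of `S`. -/
def perp {V : Type} (Γ : SimpleGraph V) (S : Set V) : Set V :=
  {v : V | v ∉ S ∧ ∀ u ∈ S, Γ.Adj v u}

/-- `S` spans a join subgraph of `Γ`. -/
def IsJoin {V : Type} (Γ : SimpleGraph V) (S : Set V) : Prop :=
  ∃ S₁ S₂ : Set V, S₁.Nonempty ∧ S₂.Nonempty ∧ S₁ ∪ S₂ = S ∧ ∀ u ∈ S₁, ∀ v ∈ S₂, Γ.Adj u v

/-- `S` spans a maximal join subgraph of `Γ`. -/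
def IsMaxJoin {V : Type} (Γ : SimpleGraph V) (S : Set V) : Prop :=
  IsJoin Γ S ∧ ∀ T : Set V, IsJoin Γ T → S ⊆ T → S = T

/-- Join parabolic subgroups. -/
def IsJoinParabolic {V : Type} (Γ : SimpleGraph V) (P : Subgroup (RAAG Γ)) : Prop :=
  ∃ (g : RAAG Γ) (S : Set V), IsJoin Γ S ∧ P = conjSub g (standardSub Γ S)

/-- Maximal join parabolic subgroups. -/
def IsMaxJoinParabolic {V : Type} (Γ : SimpleGraph V) (P : Subgroup (RAAG Γ)) : Prop :=
  ∃ (g : RAAG Γ) (S : Set V), IsMaxJoin Γ S ∧ P = conjSub g (standardSub Γ S)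

/-- The center of a subgroup `P`, as a subset of the ambient group. -/
def subCenter {G : Type} [Group G] (P : Subgroup G) : Set G :=
  {x : G | x ∈ P ∧ ∀ y ∈ P, x * y = y * x}

/-- The commutation graph of a subset `S` of a group. -/
def chainCommGraph {G : Type} [Group G] (S : Set G) : SimpleGraph S :=
  SimpleGraph.fromRel fun a b => Commute (a : G) (b : G)

/-- A generating set is chain-commuting if its commutation graph is connected. -/
def IsChainCommuting {G : Type} [Group G] (S : Set G) : Prop :=
  (chainCommGraph S).Connected

/-- Amenability: existence of a finitely additive left-invariant probability
measure defined on all subsets. -/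
def IsAmenable (G : Type) [Group G] : Prop :=
  ∃ m : Set G → ℝ, m Set.univ = 1 ∧ (∀ A : Set G, 0 ≤ m A) ∧
    (∀ A B : Set G, Disjoint A B → m (A ∪ B) = m A + m B) ∧
    ∀ (g : G) (A : Set G), m ((g * ·) '' A) = m A

/-- ICC groups: every nontrivial element has an infinite conjugacy class. -/
def IsICC (G : Type) [Group G] : Prop :=
  ∀ g : G, g ≠ 1 → {h : G | ∃ c : G, c * g * c⁻¹ = h}.Infinite

/-- The root-conjugation property. -/
def RootConjugationProperty (H : Type) [Group H] : Prop :=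
  ∀ (h₁ h₂ : H) (k : ℕ), 0 < k → Commute h₁ (h₂ ^ k) → Commute h₁ h₂

/- ## Measured dynamics -/

/-- Measure-preserving action by measurable automorphisms. -/
def PmpAction (G : Type) [Group G] (X : Type) [MeasurableSpace X] [MulAction G X]
    (μ : Measure X) : Prop :=
  ∀ g : G, MeasurePreserving (fun x : X => g • x) μ μ

/-- Essentially free action. -/
def FreeAction (G : Type) [Group G] (X : Type) [MeasurableSpace X] [MulAction G X]
    (μ : Measure X) : Prop :=
  ∀ g : G, g ≠ 1 → μ {x : X | g • x = x} = 0

/-- Ergodic action of a group. -/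
def ErgodicAction (G : Type) [Group G] (X : Type) [MeasurableSpace X] [MulAction G X]
    (μ : Measure X) : Prop :=
  ∀ A : Set X, MeasurableSet A → (∀ g : G, (fun x : X => g • x) ⁻¹' A = A) →
    μ A = 0 ∨ μ A = 1

/-- Ergodicity of the action of a subgroup. -/
def ErgodicSubgroup (G : Type) [Group G] (A : Subgroup G) (X : Type) [MeasurableSpace X]
    [MulAction G X] (μ : Measure X) : Prop :=
  ∀ s : Set X, MeasurableSet s → (∀ a ∈ A, (fun x : X => a • x) ⁻¹' s = s) →
    μ s = 0 ∨ μ s = 1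

/-- Irreducible action of a right-angled Artin group: for some identification of the group
with a `RAAG Δ`, every standard generator acts ergodically. -/
def IrreducibleAction (G : Type) [Group G] (X : Type) [MeasurableSpace X] [MulAction G X]
    (μ : Measure X) : Prop :=
  ∃ (n : ℕ) (Δ : SimpleGraph (Fin n)) (e : RAAG Δ ≃* G),
    ∀ v : Fin n, Ergodic (fun x : X => e (gen Δ v) • x) μ

/-- A measure space isomorphism (mod null sets): a measurable measure-preserving map
admitting an a.e. two-sided measurable inverse. -/
def MeasIso {A : Type} {B : Type} [MeasurableSpace A] [MeasurableSpace B]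
    (μ : Measure A) (ν : Measure B) (F : A → B) : Prop :=
  Measurable F ∧ MeasurePreserving F μ ν ∧
    ∃ F' : B → A, Measurable F' ∧ (∀ᵐ a ∂μ, F' (F a) = a) ∧ ∀ᵐ b ∂ν, F (F' b) = b

/-- Conjugacy of two actions through a given group isomorphism. -/
def ConjugateVia (G : Type) [Group G] (X : Type) [MeasurableSpace X] [MulAction G X]
    (H : Type) [Group H] (Y : Type) [MeasurableSpace Y] [MulAction H Y]
    (μ : Measure X) (ν : Measure Y) (α : G ≃* H) : Prop :=
  ∃ F : X → Y, MeasIso μ ν F ∧ ∀ g : G, ∀ᵐ x ∂μ, F (g • x) = α g • F x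

/-- Conjugacy of two actions. -/
def ConjugateActions (G : Type) [Group G] (X : Type) [MeasurableSpace X] [MulAction G X]
    (H : Type) [Group H] (Y : Type) [MeasurableSpace Y] [MulAction H Y]
    (μ : Measure X) (ν : Measure Y) : Prop :=
  ∃ α : G ≃* H, ConjugateVia G X H Y μ ν α

/-- Orbit equivalence of two actions. -/
def OrbitEquivalent (G : Type) [Group G] (X : Type) [MeasurableSpace X] [MulAction G X]
    (H : Type) [Group H] (Y : Type) [MeasurableSpace Y] [MulAction H Y]
    (μ : Measure X) (ν : Measure Y) : Prop :=
  ∃ F : X → Y, MeasIso μ ν F ∧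
    ∀ᵐ x ∂μ, F '' MulAction.orbit G x = MulAction.orbit H (F x)

/-- Measurable cocycle for an action, with values in a (discrete) group `H`. -/
def IsCocycle (G : Type) [Group G] (X : Type) [MeasurableSpace X] [MulAction G X]
    (H : Type) [Group H] (μ : Measure X) (c : G → X → H) : Prop :=
  (∀ (g : G) (h : H), MeasurableSet {x : X | c g x = h}) ∧
    ∀ g g' : G, ∀ᵐ x ∂μ, c (g * g') x = c g (g' • x) * c g' x

/-- Cohomology of cocycles. -/
def Cohomologous (G : Type) [Group G] (X : Type) [MeasurableSpace X] [MulAction G X]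
    (H : Type) [Group H] (μ : Measure X) (c c' : G → X → H) : Prop :=
  ∃ φ : X → H, (∀ h : H, MeasurableSet {x : X | φ x = h}) ∧
    ∀ g : G, ∀ᵐ x ∂μ, c' g x = φ (g • x) * c g x * (φ x)⁻¹

/-- A stable orbit equivalence between two actions: a measure-scaling Borel isomorphism
between positive measure subsets, matching orbits. -/
structure StableOE (G : Type) [Group G] (X : Type) [MeasurableSpace X] [MulAction G X]
    (H : Type) [Group H] (Y : Type) [MeasurableSpace Y] [MulAction H Y]
    (μ : Measure X) (ν : Measure Y) where
  U : Set X
  V : Set Y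
  measU : MeasurableSet U
  measV : MeasurableSet V
  posU : 0 < μ U
  posV : 0 < ν V
  toFun : X → Y
  invFun : Y → X
  meas_toFun : Measurable toFun
  meas_invFun : Measurable invFun
  maps : Set.MapsTo toFun U V
  maps_inv : Set.MapsTo invFun V U
  left_inv : ∀ x ∈ U, invFun (toFun x) = x
  right_inv : ∀ y ∈ V, toFun (invFun y) = y
  pushforward : ∀ B : Set Y, B ⊆ V → MeasurableSet B →
    (μ U)⁻¹ * μ (U ∩ toFun ⁻¹' B) = (ν V)⁻¹ * ν B
  orbit_eq : ∀ᵐ x ∂μ, x ∈ U →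
    toFun '' (MulAction.orbit G x ∩ U) = MulAction.orbit H (toFun x) ∩ V

namespace StableOE

variable {G : Type} [Group G] {X : Type} [MeasurableSpace X] [MulAction G X]
  {H : Type} [Group H] {Y : Type} [MeasurableSpace Y] [MulAction H Y]
  {μ : Measure X} {ν : Measure Y}

/-- The compression constant of a stable orbit equivalence. -/
noncomputable def kappa (f : StableOE G X H Y μ ν) : ℝ≥0∞ := ν f.V / μ f.U

/-- `c` is an SOE cocycle associated to the stable orbit equivalence `f`. -/
def IsSOECocycle (f : StableOE G X H Y μ ν) (c : G → X → H) : Prop :=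
  IsCocycle G X H μ c ∧
    ∃ p : X → X, Measurable p ∧
      (∀ᵐ x ∂μ, p x ∈ f.U ∧ p x ∈ MulAction.orbit G x) ∧
      ∀ g : G, ∀ᵐ x ∂μ, f.toFun (p (g • x)) = c g x • f.toFun (p x)

end StableOE

/-- Mildly mixing action. -/
def MildlyMixing (H : Type) [Group H] (Y : Type) [MeasurableSpace Y] [MulAction H Y]
    (ν : Measure Y) : Prop :=
  ∀ A : Set Y, MeasurableSet A → ν A ≠ 0 → ν A ≠ ν Set.univ →
    ∀ u : ℕ → H, Function.Injective u →
      0 < Filter.atTop.liminf fun n => ν (((u n • ·) '' A) ∆ A)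

/- ## Virtual conjugacy -/

/-- `(Z, qact, ρ)` together with `π : X → Z` is a model for the quotient of the action
`G ↷ (X, μ)` by the normal subgroup `F`, with the induced `G ⧸ F`-action. -/
def IsQuotientModel {G : Type} [Group G] (F : Subgroup G) [F.Normal]
    {X : Type} [MeasurableSpace X] [MulAction G X] (μ : Measure X)
    {Z : Type} [MeasurableSpace Z] (qact : G ⧸ F →* Equiv.Perm Z) (ρ : Measure Z)
    (π : X → Z) : Prop :=
  Measurable π ∧ Measure.map π μ = ρ ∧
    (∀ (g : G) (x : X), π (g • x) = qact (QuotientGroup.mk g) (π x)) ∧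
    ∀ x y : X, π x = π y ↔ ∃ f ∈ F, f • x = y

/-- The action `act : Q →* Perm Z` on `(Z, ρ)` is (isomorphic to) the action induced from the
action `act' : K →* Perm X'` of the finite-index subgroup `K` on `(X', μ')`. -/
def InducedFrom {Q : Type} [Group Q] (K : Subgroup Q)
    {Z : Type} [MeasurableSpace Z] (act : Q →* Equiv.Perm Z) (ρ : Measure Z)
    {X' : Type} [MeasurableSpace X'] (act' : ↥K →* Equiv.Perm X') (μ' : Measure X') : Prop :=
  letI : MeasurableSpace (Q ⧸ K) := ⊤
  ∃ σ : Q ⧸ K → Q, (∀ k : Q ⧸ K, (QuotientGroup.mk (σ k) : Q ⧸ K) = k) ∧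
    ∃ Φ : X' × (Q ⧸ K) → Z,
      MeasIso (Measure.sum fun k : Q ⧸ K =>
        (K.index : ℝ≥0∞)⁻¹ • Measure.map (fun x' : X' => (x', k)) μ') ρ Φ ∧
      ∀ (g : Q) (k : Q ⧸ K) (h : ↥K), (h : Q) = (σ (g • k))⁻¹ * g * σ k →
        ∀ᵐ x' ∂μ', Φ (act' h x', g • k) = act g (Φ (x', k))

/-- Data witnessing that two probability measure-preserving actions are virtually
conjugate. -/
structure VirtualConjugacyData
    (G₁ : Type) [Group G₁] (X₁ : Type) [MeasurableSpace X₁] [MulAction G₁ X₁] (μ₁ : Measure X₁)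
    (G₂ : Type) [Group G₂] (X₂ : Type) [MeasurableSpace X₂] [MulAction G₂ X₂] (μ₂ : Measure X₂) :
    Type 1 where
  F₁ : Subgroup G₁
  F₂ : Subgroup G₂
  normal₁ : F₁.Normal
  normal₂ : F₂.Normal
  finite₁ : Finite F₁
  finite₂ : Finite F₂
  K₁ : Subgroup (G₁ ⧸ F₁)
  K₂ : Subgroup (G₂ ⧸ F₂)
  finiteIndex₁ : K₁.FiniteIndex
  finiteIndex₂ : K₂.FiniteIndex
  X'₁ : Type
  X'₂ : Type
  mX'₁ : MeasurableSpace X'₁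
  mX'₂ : MeasurableSpace X'₂
  μ'₁ : Measure X'₁
  μ'₂ : Measure X'₂
  prob₁ : IsProbabilityMeasure μ'₁
  prob₂ : IsProbabilityMeasure μ'₂
  act₁ : ↥K₁ →* Equiv.Perm X'₁
  act₂ : ↥K₂ →* Equiv.Perm X'₂
  pmp₁ : ∀ k : ↥K₁, MeasurePreserving (act₁ k) μ'₁ μ'₁
  pmp₂ : ∀ k : ↥K₂, MeasurePreserving (act₂ k) μ'₂ μ'₂
  θ : ↥K₁ ≃* ↥K₂
  conjF : X'₁ → X'₂
  conjF_iso : MeasIso μ'₁ μ'₂ conjF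
  conjF_equivariant : ∀ k : ↥K₁, ∀ᵐ x ∂μ'₁, conjF (act₁ k x) = act₂ (θ k) (conjF x)
  Z₁ : Type
  Z₂ : Type
  mZ₁ : MeasurableSpace Z₁
  mZ₂ : MeasurableSpace Z₂
  ρ₁ : Measure Z₁
  ρ₂ : Measure Z₂
  qact₁ : G₁ ⧸ F₁ →* Equiv.Perm Z₁
  qact₂ : G₂ ⧸ F₂ →* Equiv.Perm Z₂
  qpmp₁ : ∀ g, MeasurePreserving (qact₁ g) ρ₁ ρ₁
  qpmp₂ : ∀ g, MeasurePreserving (qact₂ g) ρ₂ ρ₂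
  π₁ : X₁ → Z₁
  π₂ : X₂ → Z₂
  quot₁ : IsQuotientModel F₁ μ₁ qact₁ ρ₁ π₁
  quot₂ : IsQuotientModel F₂ μ₂ qact₂ ρ₂ π₂
  ind₁ : InducedFrom K₁ qact₁ ρ₁ act₁ μ'₁
  ind₂ : InducedFrom K₂ qact₂ ρ₂ act₂ μ'₂

/- ## Bernoulli actions -/

/-- The Bernoulli shift action of `G` on `G → A`. -/
instance bernoulliAction (G A : Type) [Group G] : MulAction G (G → A) where
  smul g x := fun h => x (g⁻¹ * h)
  one_smul x := funext fun h => by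
    show x (1⁻¹ * h) = x h
    rw [inv_one, one_mul]
  mul_smul g g' x := funext fun h => by
    show x ((g * g')⁻¹ * h) = x (g'⁻¹ * (g⁻¹ * h))
    rw [mul_inv_rev, mul_assoc]

/-- `μ` is the product (Bernoulli) measure on `G → A` with base `μ₀`:
it gives the product value to every cylinder set. -/
def IsBernoulliMeasure (G : Type) [Group G] {A : Type} [MeasurableSpace A]
    (μ₀ : Measure A) (μ : Measure (G → A)) : Prop :=
  ∀ (s : Finset G) (B : G → Set A), (∀ g : G, MeasurableSet (B g)) →
    μ {x : G → A | ∀ g ∈ s, x g ∈ B g} = ∏ g ∈ s, μ₀ (B g)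


/-- `𝓕`-ergodicity: every subgroup in the collection `𝓕` acts ergodically. -/
def FErgodic (G : Type) [Group G] (𝓕 : Set (Subgroup G)) (X : Type) [MeasurableSpace X]
    [MulAction G X] (μ : Measure X) : Prop :=
  ∀ A ∈ 𝓕, ErgodicSubgroup G A X μ

/-- Strong cocycle-rigidity of the pair `(G, 𝓕)`. -/
def StronglyCocycleRigid (G : Type) [Group G] (𝓕 : Set (Subgroup G)) : Prop :=
  ∀ (X : Type) [MeasurableSpace X] [StandardBorelSpace X] (μ : Measure X)
    (Y : Type) [MeasurableSpace Y] [StandardBorelSpace Y] (ν : Measure Y)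
    [IsProbabilityMeasure μ] [IsProbabilityMeasure ν]
    [MulAction G X] [MulAction G Y],
    PmpAction G X μ → FreeAction G X μ → ErgodicAction G X μ → FErgodic G 𝓕 X μ →
    PmpAction G Y ν → FreeAction G Y ν → ErgodicAction G Y ν → FErgodic G 𝓕 Y ν →
    ∀ f : StableOE G X G Y μ ν, ∀ c : G → X → G, f.IsSOECocycle c →
      ∃ α : G ≃* G, Cohomologous G X G μ c fun g _ => α g

section Geometry

variable {V : Type} {Γ : SimpleGraph V}

theorem gen_comm {u v : V} (h : Γ.Adj u v) : gen Γ u * gen Γ v = gen Γ v * gen Γ u := by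
  have := PresentedGroup.one_of_mem (rels := raagRels Γ) ⟨u, v, h, rfl⟩
  simp only [map_mul, map_inv] at this
  have h2 : gen Γ u * gen Γ v * (gen Γ u)⁻¹ * (gen Γ v)⁻¹ = 1 := this
  rw [mul_inv_eq_one, mul_inv_eq_iff_eq_mul] at h2
  exact h2

/-- Homomorphisms out of a right-angled Artin group. -/
def raagLift {K : Type} [Group K] (f : V → K)
    (hf : ∀ u v, Γ.Adj u v → f u * f v = f v * f u) : RAAG Γ →* K :=
  PresentedGroup.toGroup (f := f) (by
    rintro r ⟨u, v, h, rfl⟩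
    simp [hf u v h])

@[simp] theorem raagLift_gen {K : Type} [Group K] (f : V → K)
    (hf : ∀ u v, Γ.Adj u v → f u * f v = f v * f u) (v : V) :
    raagLift f hf (gen Γ v) = f v := PresentedGroup.toGroup.of _

theorem raag_closure : Subgroup.closure (Set.range (gen Γ)) = ⊤ :=
  PresentedGroup.closure_range_of _

theorem gen_mem {S : Set V} {v : V} (h : v ∈ S) : gen Γ v ∈ standardSub Γ S :=
  Subgroup.subset_closure ⟨v, h, rfl⟩

theorem standardSub_mono {S T : Set V} (h : S ⊆ T) : standardSub Γ S ≤ standardSub Γ T :=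
  Subgroup.closure_mono (Set.image_mono h)

theorem standardSub_univ : standardSub Γ Set.univ = ⊤ := by
  rw [standardSub, Set.image_univ, raag_closure]

/-- A crossed homomorphism with values in functions on a `RAAG Γ`-set is determined by a
compatible choice of values on generators. -/
theorem exists_crossed {Ω A : Type} [AddCommGroup A] [MulAction (RAAG Γ) Ω] (d : V → Ω → A)
    (hd : ∀ u v, Γ.Adj u v → ∀ e, d u e + d v ((gen Γ u)⁻¹ • e) = d v e + d u ((gen Γ v)⁻¹ • e)) :
    ∃ c : RAAG Γ → Ω → A, (∀ v, c (gen Γ v) = d v) ∧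
      ∀ g h e, c (g * h) e = c g e + c h (g⁻¹ • e) := by
  let f : V → Equiv.Perm (Ω → A) := fun v =>
    { toFun := fun ξ e => d v e + ξ ((gen Γ v)⁻¹ • e)
      invFun := fun ξ e => ξ (gen Γ v • e) - d v (gen Γ v • e)
      left_inv := fun ξ => by ext e; simp
      right_inv := fun ξ => by ext e; simp }
  have fap : ∀ v ξ e, f v ξ e = d v e + ξ ((gen Γ v)⁻¹ • e) := fun _ _ _ => rfl
  have hf : ∀ u v, Γ.Adj u v → f u * f v = f v * f u := by
    intro u v h
    ext ξ e
    simp only [Equiv.Perm.mul_apply, fap]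
    rw [← add_assoc, ← add_assoc, hd u v h e, smul_smul, smul_smul, ← mul_inv_rev, ← mul_inv_rev,
      gen_comm h]
  let T := raagLift f hf
  have hT : ∀ g ξ e, T g ξ e = T g 0 e + ξ (g⁻¹ • e) := by
    intro g
    have hg : g ∈ Subgroup.closure (Set.range (gen Γ)) := by rw [raag_closure]; trivial
    induction hg using Subgroup.closure_induction with
    | mem x hx =>
      obtain ⟨v, rfl⟩ := hx
      intro ξ e
      simp [T, fap]
    | one => intro ξ e; simp
    | mul x y _ _ hx hy =>
      intro ξ e
      rw [map_mul, Equiv.Perm.mul_apply, Equiv.Perm.mul_apply, hx, hy, hx (T y 0)]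
      rw [mul_inv_rev, mul_smul, add_assoc]
    | inv x _ hx =>
      intro ξ e
      have h1 : T x (T x⁻¹ ξ) = ξ := by rw [← Equiv.Perm.mul_apply, ← map_mul]; simp
      have h2 : T x (T x⁻¹ 0) = 0 := by rw [← Equiv.Perm.mul_apply, ← map_mul]; simp
      have h1' := congrFun h1 (x • e)
      have h2' := congrFun h2 (x • e)
      rw [hx] at h1' h2'
      simp only [inv_smul_smul, inv_inv, Pi.zero_apply] at h1' h2' ⊢
      rw [← sub_eq_zero] at h1'
      rw [← sub_eq_zero]
      calc _ = (T x 0 (x • e) + T x⁻¹ ξ e - ξ (x • e)) - (T x 0 (x • e) + T x⁻¹ 0 e) := by abel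
        _ = 0 := by rw [h1', h2']; simp
  refine ⟨fun g => T g 0, fun v => ?_, fun g h e => ?_⟩
  · ext e; simp [T, fap]
  · show T (g * h) 0 e = _
    rw [map_mul, Equiv.Perm.mul_apply, hT]

variable (Γ) in
/-- Walls of the right-angled Artin group: cosets of link subgroups, labelled by a vertex. -/
abbrev Wall : Type := Σ v : V, RAAG Γ ⧸ standardSub Γ (Γ.neighborSet v)

variable (Γ) in
/-- The wall dual to the edge from `1` to the generator `v`. -/
def wall (v : V) : Wall Γ := ⟨v, (1 : RAAG Γ)⟩

theorem smul_fst (g : RAAG Γ) (e : Wall Γ) : (g • e).1 = e.1 := rfl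

@[simp] theorem wall_fst (v : V) : (wall Γ v).1 = v := rfl

theorem exists_smul_wall (e : Wall Γ) : ∃ g : RAAG Γ, e = g • wall Γ e.1 := by
  obtain ⟨v, q⟩ := e
  obtain ⟨g, rfl⟩ := QuotientGroup.mk_surjective q
  refine ⟨g, ?_⟩
  rw [wall, Sigma.smul_mk]
  simp [MulAction.Quotient.smul_mk]

theorem smul_wall_eq_iff {g h : RAAG Γ} {v : V} :
    g • wall Γ v = h • wall Γ v ↔ g⁻¹ * h ∈ standardSub Γ (Γ.neighborSet v) := by
  rw [wall, Sigma.smul_mk, Sigma.smul_mk, ← QuotientGroup.eq]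
  simp [MulAction.Quotient.smul_mk]

theorem smul_wall_eq {g : RAAG Γ} {v : V} :
    g • wall Γ v = wall Γ v ↔ g ∈ standardSub Γ (Γ.neighborSet v) := by
  have := smul_wall_eq_iff (g := g) (h := 1) (v := v)
  simpa using this

open Classical in
theorem exists_pot (Γ : SimpleGraph V) : ∃ c : RAAG Γ → Wall Γ → ℤ,
    (∀ v, c (gen Γ v) = fun e => if e = wall Γ v then 1 else 0) ∧
      ∀ g h e, c (g * h) e = c g e + c h (g⁻¹ • e) := by
  apply exists_crossed
  have key : ∀ u v, Γ.Adj u v → ∀ e : Wall Γ, ((gen Γ u)⁻¹ • e = wall Γ v) = (e = wall Γ v) := by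
    intro u v h e
    rw [inv_smul_eq_iff, smul_wall_eq.2 (gen_mem h.symm)]
  intro u v h e
  simp only [key u v h, key v u h.symm]
  abel

/-- The signed number of crossings of a wall by a path from `1` to the given element. -/
noncomputable def pot (g : RAAG Γ) (e : Wall Γ) : ℤ := (exists_pot Γ).choose g e

open Classical in
theorem pot_gen (v : V) (e : Wall Γ) : pot (gen Γ v) e = if e = wall Γ v then 1 else 0 :=
  congrFun ((exists_pot Γ).choose_spec.1 v) e

theorem pot_mul (g h : RAAG Γ) (e : Wall Γ) : pot (g * h) e = pot g e + pot h (g⁻¹ • e) :=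
  (exists_pot Γ).choose_spec.2 g h e

@[simp] theorem pot_one (e : Wall Γ) : pot 1 e = 0 := by
  have := pot_mul 1 1 e
  simp at this
  exact this

theorem pot_inv (g : RAAG Γ) (e : Wall Γ) : pot g⁻¹ e = - pot g (g • e) := by
  have := pot_mul g⁻¹ g e
  simp at this
  omega

theorem pot_smul (g x : RAAG Γ) (e : Wall Γ) : pot x (g • e) = pot (g⁻¹ * x) e - pot g⁻¹ e := by
  rw [pot_mul]; simp

/-- The elements whose wall types all lie in `S`. -/
theorem pot_eq_zero_of_mem {S : Set V} {h : RAAG Γ} (hh : h ∈ standardSub Γ S) :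
    ∀ e : Wall Γ, e.1 ∉ S → pot h e = 0 := by
  classical
  induction hh using Subgroup.closure_induction with
  | mem x hx =>
    obtain ⟨v, hv, rfl⟩ := hx
    intro e he
    rw [pot_gen, if_neg]
    rintro rfl
    exact he hv
  | one => simp
  | mul x y _ _ hx hy =>
    intro e he
    rw [pot_mul, hx e he, hy (x⁻¹ • e) he, add_zero]
  | inv x _ hx =>
    intro e he
    rw [pot_inv, hx (x • e) he, neg_zero]

theorem pot_link {v : V} {h : RAAG Γ} (hh : h ∈ standardSub Γ (Γ.neighborSet v)) {e : Wall Γ}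
    (he : e.1 = v) : pot h e = 0 :=
  pot_eq_zero_of_mem hh e (by rw [he]; exact Γ.irrefl)

theorem raag_induction {p : RAAG Γ → Prop} (one : p 1) (mul : ∀ x v, p x → p (x * gen Γ v))
    (mul_inv : ∀ x v, p x → p (x * (gen Γ v)⁻¹)) (x : RAAG Γ) : p x := by
  have hx : x ∈ Subgroup.closure (Set.range (gen Γ)) := by rw [raag_closure]; trivial
  refine Subgroup.closure_induction_right (p := fun x _ => p x) one ?_ ?_ hx
  · rintro x _ _ ⟨v, rfl⟩ h; exact mul x v h
  · rintro x _ _ ⟨v, rfl⟩ h; exact mul_inv x v h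

theorem pot_wall (v : V) (x : RAAG Γ) : pot x (wall Γ v) = 0 ∨ pot x (wall Γ v) = 1 := by
  classical
  induction x using raag_induction with
  | one => simp
  | mul x u ih =>
    rw [pot_mul, pot_gen]
    split_ifs with h
    · have huv : v = u := congrArg Sigma.fst h
      subst huv
      rw [inv_smul_eq_iff, eq_comm, smul_wall_eq] at h
      rw [pot_link h rfl]; simp
    · simpa using ih
  | mul_inv x u ih =>
    rw [pot_mul, pot_inv, pot_gen]
    split_ifs with h
    · have huv : v = u := congrArg Sigma.fst h
      subst huv
      rw [← eq_inv_smul_iff, inv_smul_eq_iff, smul_smul, eq_comm, smul_wall_eq] at h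
      have h2 := pot_mul (x * (gen Γ v)⁻¹) (gen Γ v) (wall Γ v)
      rw [pot_link h rfl, inv_mul_cancel_right, pot_gen, if_pos] at h2
      · left; rw [h2]; simp
      · rw [inv_smul_eq_iff, eq_comm, smul_wall_eq]; exact h
    · simpa using ih

/-- Each wall separates the group into exactly two sides. -/
theorem pot_two (e : Wall Γ) : ∃ a : ℤ, ∀ x, pot x e = a ∨ pot x e = a + 1 := by
  obtain ⟨g, hg⟩ := exists_smul_wall e
  refine ⟨- pot g⁻¹ (wall Γ e.1), fun x => ?_⟩
  rw [hg, pot_smul, smul_fst, wall_fst]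
  rcases pot_wall e.1 (g⁻¹ * x) with h | h <;> rw [h] <;> omega

/-- Letters: generators and their inverses. -/
def ltr (s : V × Bool) : RAAG Γ := if s.2 then gen Γ s.1 else (gen Γ s.1)⁻¹

/-- The formal inverse of a letter. -/
def linv (s : V × Bool) : V × Bool := (s.1, !s.2)

/-- The wall crossed by the edge from `1` to a letter. -/
def ew (s : V × Bool) : Wall Γ := if s.2 then wall Γ s.1 else (gen Γ s.1)⁻¹ • wall Γ s.1

@[simp] theorem ew_fst (s : V × Bool) : (ew s : Wall Γ).1 = s.1 := by
  unfold ew; split_ifs <;> rfl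

@[simp] theorem linv_fst (s : V × Bool) : (linv s).1 = s.1 := rfl

@[simp] theorem linv_linv (s : V × Bool) : linv (linv s) = s := by simp [linv]

theorem ltr_linv (s : V × Bool) : (ltr (linv s) : RAAG Γ) = (ltr s)⁻¹ := by
  obtain ⟨v, b⟩ := s
  cases b <;> simp [ltr, linv]

theorem ew_linv (s : V × Bool) : (ew (linv s) : Wall Γ) = (ltr s : RAAG Γ)⁻¹ • (ew s : Wall Γ) := by
  obtain ⟨v, b⟩ := s
  cases b <;> simp [ltr, linv, ew]

open Classical in
theorem pot_ltr (s : V × Bool) (e : Wall Γ) :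
    pot (ltr s) e = if e = ew s then (if s.2 then 1 else -1) else 0 := by
  obtain ⟨v, b⟩ := s
  cases b
  · simp only [ltr, ew, pot_inv, pot_gen, Bool.false_eq_true, if_false, eq_inv_smul_iff]
    split_ifs <;> rfl
  · simp [ltr, ew, pot_gen]

theorem pot_ltr_ne {s : V × Bool} {e : Wall Γ} : pot (ltr s) e ≠ 0 ↔ e = ew s := by
  rw [pot_ltr]; split_ifs <;> simp_all

/-- The walls separating `1` from `g`. -/
def W (g : RAAG Γ) : Set (Wall Γ) := {e | pot g e ≠ 0}

theorem mem_W {g : RAAG Γ} {e : Wall Γ} : e ∈ W g ↔ pot g e ≠ 0 := Iff.rfl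

@[simp] theorem W_one : W (1 : RAAG Γ) = ∅ := by ext e; simp [W]

theorem W_ltr (s : V × Bool) : W (ltr s : RAAG Γ) = {ew s} := by
  ext e; exact pot_ltr_ne

theorem mem_W_mul {g h : RAAG Γ} {e : Wall Γ} :
    e ∈ W (g * h) ↔ (e ∈ W g ∧ g⁻¹ • e ∉ W h ∨ e ∉ W g ∧ g⁻¹ • e ∈ W h) := by
  simp only [mem_W, pot_mul]
  obtain ⟨a, ha⟩ := pot_two e
  have h1 := ha 1
  have h2 := ha g
  have h3 := ha (g * h)
  rw [pot_mul] at h3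
  rw [pot_one] at h1
  omega

theorem mem_W_inv {g : RAAG Γ} {e : Wall Γ} : e ∈ W g⁻¹ ↔ g • e ∈ W g := by
  simp [mem_W, pot_inv]

theorem W_mul (g h : RAAG Γ) : W (g * h) = W g ∆ (g • W h) := by
  ext e
  rw [mem_W_mul, Set.mem_symmDiff, Set.mem_smul_set_iff_inv_smul_mem]
  tauto

theorem W_inv (g : RAAG Γ) : W g⁻¹ = g⁻¹ • W g := by
  ext e
  rw [mem_W_inv, Set.mem_smul_set_iff_inv_smul_mem, inv_inv]

theorem gen_notMem_link (v : V) : gen Γ v ∉ standardSub Γ (Γ.neighborSet v) := by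
  intro h
  have := pot_link h (e := wall Γ v) rfl
  rw [pot_gen, if_pos rfl] at this
  simp at this

theorem ew_ne_linv (s : V × Bool) : (ew s : Wall Γ) ≠ ew (linv s) := by
  obtain ⟨v, b⟩ := s
  cases b
  · simp only [ew, linv, Bool.not_false, if_true, Bool.false_eq_true, if_false, ne_eq]
    rw [smul_wall_eq, inv_mem_iff]
    exact gen_notMem_link v
  · simp only [ew, linv, Bool.not_true, if_true, Bool.false_eq_true, if_false, ne_eq]
    rw [eq_comm, smul_wall_eq, inv_mem_iff]
    exact gen_notMem_link v

theorem ew_injective : Function.Injective (ew : V × Bool → Wall Γ) := by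
  intro s t h
  have h1 : s.1 = t.1 := by rw [← ew_fst (Γ := Γ) s, ← ew_fst (Γ := Γ) t, h]
  by_contra hne
  have : t = linv s := by
    obtain ⟨v, b⟩ := s; obtain ⟨w, c⟩ := t
    simp only at h1; subst h1
    cases b <;> cases c <;> simp_all [linv]
  subst this
  exact ew_ne_linv s h

/-- The product of a word in letters. -/
def wd (l : List (V × Bool)) : RAAG Γ := (l.map ltr).prod

@[simp] theorem wd_nil : (wd [] : RAAG Γ) = 1 := rfl
@[simp] theorem wd_cons (s : V × Bool) (l : List (V × Bool)) :
    (wd (s :: l) : RAAG Γ) = ltr s * wd l := by simp [wd]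
@[simp] theorem wd_append (l l' : List (V × Bool)) :
    (wd (l ++ l') : RAAG Γ) = wd l * wd l' := by simp [wd]

theorem exists_wd (h : RAAG Γ) : ∃ l, h = wd l := by
  induction h using raag_induction with
  | one => exact ⟨[], rfl⟩
  | mul x v ih =>
    obtain ⟨l, rfl⟩ := ih
    exact ⟨l ++ [(v, true)], by simp [ltr]⟩
  | mul_inv x v ih =>
    obtain ⟨l, rfl⟩ := ih
    exact ⟨l ++ [(v, false)], by simp [ltr]⟩

theorem finite_W (h : RAAG Γ) : (W h).Finite := by
  obtain ⟨l, rfl⟩ := exists_wd h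
  induction l with
  | nil => simp
  | cons s l ih =>
    rw [wd_cons, W_mul, W_ltr]
    exact (Set.toFinite _).symmDiff (ih.smul_set)

theorem comm_link {v : V} {h : RAAG Γ} (hh : h ∈ standardSub Γ (Γ.neighborSet v)) :
    h * gen Γ v = gen Γ v * h := by
  induction hh using Subgroup.closure_induction with
  | mem x hx => obtain ⟨u, hu, rfl⟩ := hx; exact gen_comm hu.symm
  | one => simp
  | mul x y _ _ hx hy => rw [mul_assoc, hy, ← mul_assoc, hx, mul_assoc]
  | inv x _ hx => exact (Commute.inv_left (show Commute x _ from hx)).eq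

theorem comm_link_ltr {s : V × Bool} {h : RAAG Γ}
    (hh : h ∈ standardSub Γ (Γ.neighborSet s.1)) : Commute h (ltr s) := by
  unfold ltr
  split_ifs
  · exact comm_link hh
  · exact Commute.inv_right (comm_link hh)

/-- If an edge from `x` is dual to the wall of the letter `s` based at `1`, and `x` is on the same
side as `1`, then `x` lies in the carrier and the edge is labelled by `s`. -/
theorem carrier {s t : V × Bool} {x : RAAG Γ} (h : x • ew t = (ew s : Wall Γ))
    (hx : ew s ∉ W x) : t = s ∧ x ∈ standardSub Γ (Γ.neighborSet s.1) := by
  have h1 : t.1 = s.1 := by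
    rw [← ew_fst (Γ := Γ) s, ← h, smul_fst, ew_fst]
  have hval : pot (x * ltr t) (ew s) = if t.2 then 1 else -1 := by
    rw [pot_mul, not_ne_iff.1 hx, zero_add, pot_ltr, if_pos]
    rw [← h, inv_smul_smul]
  obtain ⟨a, ha⟩ := pot_two (ew s : Wall Γ)
  have ha1 := ha 1
  have ha2 := ha (ltr s)
  have ha3 := ha (x * ltr t)
  rw [hval] at ha3
  rw [pot_ltr, if_pos rfl] at ha2
  rw [pot_one] at ha1
  have hts : t = s := by
    obtain ⟨v, b⟩ := s; obtain ⟨w, c⟩ := t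
    simp only at h1; subst h1
    cases b <;> cases c <;> simp at ha2 ha3 ⊢ <;> omega
  subst hts
  refine ⟨rfl, ?_⟩
  obtain ⟨v, b⟩ := t
  cases b
  · simp only [ew, Bool.false_eq_true, if_false] at h
    rw [eq_inv_smul_iff, smul_smul, smul_smul, smul_wall_eq] at h
    have h2 := comm_link h
    rw [inv_mul_cancel_right] at h2
    have h3 := mul_left_cancel h2
    rw [← h3] at h
    exact h
  · simp only [ew, if_true] at h
    rwa [smul_wall_eq] at h

end Geometry

section Geometry2
variable {V : Type} {Γ : SimpleGraph V}

theorem smul_ew_eq {g : RAAG Γ} {s : V × Bool} (h : g ∈ standardSub Γ (Γ.neighborSet s.1)) :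
    g • (ew s : Wall Γ) = ew s := by
  obtain ⟨v, b⟩ := s
  cases b
  · have h2 : g * (gen Γ v)⁻¹ = (gen Γ v)⁻¹ * g := Commute.inv_right (comm_link h)
    simp only [ew, Bool.false_eq_true, if_false]
    rw [smul_smul, h2, mul_smul, smul_wall_eq.2 h]
  · simpa [ew] using smul_wall_eq.2 h

/-- The deletion condition. -/
theorem exists_deletion (s : V × Bool) (l : List (V × Bool)) (h : ew s ∈ W (wd l : RAAG Γ)) :
    ∃ l', l'.length + 1 = l.length ∧ (ltr s : RAAG Γ)⁻¹ * wd l = wd l' := by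
  induction l using List.reverseRecOn with
  | nil => simp at h
  | append_singleton l t ih =>
    by_cases h1 : ew s ∈ W (wd l : RAAG Γ)
    · obtain ⟨l', hl, hw⟩ := ih h1
      refine ⟨l' ++ [t], by simp [hl], ?_⟩
      rw [wd_append, ← mul_assoc, hw, wd_append]
    · have hm := h
      rw [wd_append, mem_W_mul] at hm
      rcases hm with hm | hm
      · exact absurd hm.1 h1
      · have h2 := hm.2
        rw [wd_cons, wd_nil, mul_one, W_ltr, Set.mem_singleton_iff, inv_smul_eq_iff] at h2
        obtain ⟨rfl, hx⟩ := carrier h2.symm h1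
        refine ⟨l, by simp, ?_⟩
        rw [wd_append, wd_cons, wd_nil, mul_one, (comm_link_ltr hx).eq, inv_mul_cancel_left]

theorem exists_letter {h : RAAG Γ} (h1 : h ≠ 1) : ∃ s, ew s ∈ W h := by
  classical
  have hex : ∃ n, ∃ l : List (V × Bool), l.length = n ∧ h = wd l := by
    obtain ⟨l, hl⟩ := exists_wd h
    exact ⟨_, l, rfl, hl⟩
  obtain ⟨l, hl, hw⟩ := Nat.find_spec hex
  have hmin : ∀ l', h = wd l' → l.length ≤ l'.length := fun l' h' => by
    rw [hl]; exact Nat.find_min' hex ⟨l', rfl, h'⟩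
  cases l with
  | nil => exact absurd hw h1
  | cons s l =>
    refine ⟨s, ?_⟩
    rw [hw, wd_cons, mem_W_mul, W_ltr]
    by_contra hcon
    simp only [Set.mem_singleton_iff, true_and, not_true, false_and, or_false, not_not] at hcon
    rw [← ew_linv] at hcon
    obtain ⟨l', hl', hw'⟩ := exists_deletion _ _ hcon
    rw [ltr_linv, inv_inv] at hw'
    have := hmin l' (by rw [hw, wd_cons, hw'])
    simp at this
    omega

theorem W_eq_empty {h : RAAG Γ} : W h = ∅ ↔ h = 1 := by
  refine ⟨fun he => ?_, fun he => by simp [he]⟩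
  by_contra h1
  obtain ⟨s, hs⟩ := exists_letter h1
  rw [he] at hs
  exact hs

/-- Word length, as the number of walls crossed. -/
noncomputable def len (h : RAAG Γ) : ℕ := (W h).ncard

theorem W_ltr_mul {s : V × Bool} {h : RAAG Γ} (hs : ew (linv s) ∉ W h) :
    W (ltr s * h) = insert (ew s) ((ltr s : RAAG Γ) • W h) ∧ ew s ∉ (ltr s : RAAG Γ) • W h := by
  have h1 : ew s ∉ (ltr s : RAAG Γ) • W h := by
    rwa [Set.mem_smul_set_iff_inv_smul_mem, ← ew_linv]
  refine ⟨?_, h1⟩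
  ext e
  rw [W_mul, W_ltr, Set.mem_symmDiff, Set.mem_insert_iff, Set.mem_singleton_iff]
  constructor
  · tauto
  · rintro (rfl | h2)
    · exact Or.inl ⟨rfl, h1⟩
    · exact Or.inr ⟨h2, fun h3 => h1 (h3 ▸ h2)⟩

theorem len_ltr_mul {s : V × Bool} {h : RAAG Γ} (hs : ew (linv s) ∉ W h) :
    len (ltr s * h) = len h + 1 := by
  obtain ⟨h1, h2⟩ := W_ltr_mul hs
  rw [len, h1, Set.ncard_insert_of_notMem h2 ((finite_W h).smul_set), len,
    Set.ncard_smul_set]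

theorem linv_notMem {s : V × Bool} {h : RAAG Γ} (hs : ew s ∈ W h) :
    ew (linv s) ∉ W ((ltr s)⁻¹ * h) := by
  rw [ew_linv, mem_W_mul, W_inv, W_ltr]
  simp only [Set.smul_set_singleton, Set.mem_singleton_iff, inv_inv, smul_inv_smul, true_and,
    not_true, false_and, or_false]
  simpa using hs

theorem len_del {s : V × Bool} {h : RAAG Γ} (hs : ew s ∈ W h) :
    len ((ltr s)⁻¹ * h) + 1 = len h := by
  rw [← len_ltr_mul (linv_notMem hs), mul_inv_cancel_left]

theorem len_inv (h : RAAG Γ) : len h⁻¹ = len h := by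
  rw [len, W_inv, Set.ncard_smul_set, len]

@[simp] theorem len_one : len (1 : RAAG Γ) = 0 := by simp [len]

theorem len_eq_zero {h : RAAG Γ} : len h = 0 ↔ h = 1 := by
  rw [len, Set.ncard_eq_zero (finite_W h), W_eq_empty]

theorem len_mul_le (g h : RAAG Γ) : len (g * h) ≤ len g + len h := by
  rw [len, W_mul]
  calc _ ≤ (W g ∪ g • W h).ncard := by
        refine Set.ncard_le_ncard ?_ ((finite_W g).union (finite_W h).smul_set)
        intro e he; rw [Set.mem_symmDiff] at he; rw [Set.mem_union]; tauto
    _ ≤ _ := by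
        refine (Set.ncard_union_le _ _).trans ?_
        rw [Set.ncard_smul_set]; rfl

/-- Induction along reduced words. -/
theorem reduced_induction {p : RAAG Γ → Prop} (one : p 1)
    (step : ∀ s h, ew (linv s) ∉ W h → p h → p (ltr s * h)) (h : RAAG Γ) : p h := by
  induction hn : len h generalizing h with
  | zero => rw [len_eq_zero] at hn; rwa [hn]
  | succ n ih =>
    have h1 : h ≠ 1 := by rintro rfl; simp at hn
    obtain ⟨s, hs⟩ := exists_letter h1
    have h2 := len_del hs
    have h3 := step s ((ltr s)⁻¹ * h) (linv_notMem hs) (ih _ (by omega))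
    rwa [mul_inv_cancel_left] at h3

theorem ltr_mem {S : Set V} {s : V × Bool} (h : s.1 ∈ S) : ltr s ∈ standardSub Γ S := by
  unfold ltr
  split_ifs
  · exact gen_mem h
  · exact inv_mem (gen_mem h)

theorem mem_standardSub {S : Set V} {h : RAAG Γ} :
    h ∈ standardSub Γ S ↔ ∀ e ∈ W h, e.1 ∈ S := by
  refine ⟨fun hh e he => by_contra fun h1 => he (pot_eq_zero_of_mem hh e h1), ?_⟩
  induction h using reduced_induction with
  | one => intro _; exact one_mem _
  | step s h hs ih =>
    intro hh
    rw [(W_ltr_mul hs).1] at hh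
    refine mul_mem (ltr_mem ?_) (ih fun e he => ?_)
    · simpa using hh (ew s) (Set.mem_insert _ _)
    · exact hh (ltr s • e) (Set.mem_insert_of_mem _ (Set.smul_mem_smul_set he))

theorem sep_iff (x z : RAAG Γ) (e : Wall Γ) : pot x e ≠ pot (x * z) e ↔ x⁻¹ • e ∈ W z := by
  rw [pot_mul, mem_W]
  omega

theorem crossing_aux {v : V} {e' : Wall Γ} (hne : e' ≠ wall Γ v) (hadj : ¬ Γ.Adj v e'.1)
    (z x : RAAG Γ) (h1 : x⁻¹ • wall Γ v ∈ W z) (h2 : x⁻¹ • e' ∉ W z) : pot x e' = 0 := by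
  have hlk : ∀ h ∈ standardSub Γ (Γ.neighborSet v), pot h e' = 0 := fun h hh =>
    pot_eq_zero_of_mem hh e' hadj
  induction z using reduced_induction generalizing x with
  | one => simp at h1
  | step s z hs ih =>
    obtain ⟨hW, hn⟩ := W_ltr_mul hs
    rw [hW, Set.mem_insert_iff, Set.mem_smul_set_iff_inv_smul_mem, smul_smul, ← mul_inv_rev] at h1 h2
    push Not at h2
    have hpe : pot (x * ltr s) e' = pot x e' := by
      rw [pot_mul, add_eq_left]
      by_contra hcon
      exact h2.1 (pot_ltr_ne.1 hcon)
    rcases h1 with h1 | h1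
    · rw [inv_smul_eq_iff] at h1
      have hv : s.1 = v := by have := congrArg Sigma.fst h1; simpa [smul_fst] using this.symm
      obtain ⟨u, b⟩ := s
      simp only at hv
      subst hv
      cases b
      · rw [← hpe]
        apply hlk
        simp only [ew, Bool.false_eq_true, if_false, smul_smul] at h1
        rw [eq_comm, smul_wall_eq] at h1
        simpa [ltr] using h1
      · apply hlk
        simp only [ew, if_true] at h1
        rwa [eq_comm, smul_wall_eq] at h1
    · rw [← hpe]
      exact ih _ h1 h2.2

theorem pot_ne_smul (g x y : RAAG Γ) (e : Wall Γ) :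
    pot x (g • e) ≠ pot y (g • e) ↔ pot (g⁻¹ * x) e ≠ pot (g⁻¹ * y) e := by
  rw [pot_smul, pot_smul]; omega

/-- If all four intersections of sides of two distinct walls are nonempty then the types of the
walls are adjacent. -/
theorem crossing {e e' : Wall Γ} (hne : e ≠ e') {a b c d : RAAG Γ}
    (h1 : pot a e ≠ pot b e) (h2 : pot a e' = pot b e') (h3 : pot c e ≠ pot d e)
    (h4 : pot c e' = pot d e') (h5 : pot a e' ≠ pot c e') : Γ.Adj e.1 e'.1 := by
  by_contra hadj
  obtain ⟨g, hg⟩ := exists_smul_wall e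
  set v := e.1
  obtain ⟨e'', rfl⟩ : ∃ e'', e' = g • e'' := ⟨g⁻¹ • e', by simp⟩
  have hne' : e'' ≠ wall Γ v := by rintro rfl; exact hne hg
  rw [hg, pot_ne_smul] at h1 h3
  have h2' := (pot_ne_smul g a b e'').not.1 (not_not.2 h2)
  have h4' := (pot_ne_smul g c d e'').not.1 (not_not.2 h4)
  rw [pot_ne_smul] at h5
  have key : ∀ x y : RAAG Γ, pot x (wall Γ v) ≠ pot y (wall Γ v) → ¬ pot x e'' ≠ pot y e'' →
      pot x e'' = 0 := by
    intro x y hx hy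
    refine crossing_aux hne' hadj (x⁻¹ * y) x ?_ ?_
    · rw [← sep_iff, mul_inv_cancel_left]; exact hx
    · rw [← sep_iff, mul_inv_cancel_left]; exact hy
  exact h5 ((key _ _ h1 h2').trans (key _ _ h3 h4').symm)

theorem pot_ne_iff {x y : RAAG Γ} {e : Wall Γ} :
    pot x e ≠ pot y e ↔ (e ∈ W x ∧ e ∉ W y ∨ e ∉ W x ∧ e ∈ W y) := by
  obtain ⟨a, ha⟩ := pot_two e
  have h1 := ha 1
  have h2 := ha x
  have h3 := ha y
  rw [pot_one] at h1
  simp only [mem_W]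
  omega

theorem cross4 {p q z : RAAG Γ} {e e' : Wall Γ} (h1 : e ∈ W p) (h2 : e ∉ W q) (h3 : e' ∈ W q)
    (h4 : e' ∉ W p) (h5 : e ∈ W z) (h6 : e' ∈ W z) : Γ.Adj e.1 e'.1 := by
  have hone : ∀ e : Wall Γ, e ∉ W (1 : RAAG Γ) := by simp
  refine crossing (a := 1) (b := p) (c := q) (d := z) (fun h => h4 (h ▸ h1)) ?_ ?_ ?_ ?_ ?_
  · rw [pot_ne_iff]; exact Or.inr ⟨hone _, h1⟩
  · by_contra hcon; rw [← ne_eq, pot_ne_iff] at hcon; have := hone e'; tauto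
  · rw [pot_ne_iff]; exact Or.inr ⟨h2, h5⟩
  · by_contra hcon; rw [← ne_eq, pot_ne_iff] at hcon; tauto
  · rw [pot_ne_iff]; exact Or.inr ⟨hone _, h3⟩

end Geometry2

section Geometry3
variable {V : Type} {Γ : SimpleGraph V}

theorem gen_mem_iff {S : Set V} {v : V} : gen Γ v ∈ standardSub Γ S ↔ v ∈ S := by
  refine ⟨fun h => ?_, gen_mem⟩
  have h1 := mem_standardSub.1 h (wall Γ v) (by
    classical
    rw [mem_W, pot_gen, if_pos rfl]; simp)
  exact h1

theorem ltr_smul_ew {s t : V × Bool} (h : Γ.Adj s.1 t.1) :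
    (ltr s : RAAG Γ) • (ew t : Wall Γ) = ew t :=
  smul_ew_eq (ltr_mem h.symm)

/-- Two elements whose sets of crossed walls meet have a common initial letter. -/
theorem exists_common_letter (p q : RAAG Γ) (e : Wall Γ) (hp : e ∈ W p) (hq : e ∈ W q) :
    ∃ s, ew s ∈ W p ∧ ew s ∈ W q := by
  induction p using reduced_induction generalizing q e with
  | one => simp at hp
  | step s p hs ih =>
    obtain ⟨hW, hn⟩ := W_ltr_mul hs
    rw [hW] at hp
    rw [hW]
    by_cases h1 : ew s ∈ W q
    · exact ⟨s, Set.mem_insert _ _, h1⟩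
    have hpe : e ∈ (ltr s : RAAG Γ) • W p := by
      rcases hp with rfl | hp
      · exact absurd hq h1
      · exact hp
    have hq' : ∀ e, e ∈ W ((ltr s)⁻¹ * q) ↔ e = ew (linv s) ∨ (ltr s : RAAG Γ) • e ∈ W q := by
      intro e
      have h2 : ew (linv (linv s)) ∉ W q := by rwa [linv_linv]
      rw [← ltr_linv, (W_ltr_mul h2).1, Set.mem_insert_iff, Set.mem_smul_set_iff_inv_smul_mem,
        ltr_linv, inv_inv]
    rw [Set.mem_smul_set_iff_inv_smul_mem] at hpe
    obtain ⟨t, ht1, ht2⟩ := ih ((ltr s)⁻¹ * q) _ hpe ((hq' _).2 (Or.inr (by simpa using hq)))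
    rw [hq'] at ht2
    have ht3 : (ltr s : RAAG Γ) • ew t ∈ W q := by
      rcases ht2 with h | h
      · rw [h] at ht1; exact absurd ht1 hs
      · exact h
    have hne : (ltr s : RAAG Γ) • ew t ≠ (ew s : Wall Γ) := fun h => h1 (h ▸ ht3)
    have hz : (ltr s : RAAG Γ) • ew t ∈ W (ltr s * p) := by
      rw [hW]; exact Or.inr (Set.smul_mem_smul_set ht1)
    have hadj := cross4 (p := (ltr s : RAAG Γ)) (q := q) (z := ltr s * p) (e := ew s)
      (e' := (ltr s : RAAG Γ) • ew t) (by rw [W_ltr]; rfl) h1 ht3 (by rw [W_ltr]; exact hne)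
      (by rw [hW]; exact Or.inl rfl) hz
    rw [smul_fst, ew_fst, ew_fst] at hadj
    rw [ltr_smul_ew hadj] at ht3 hz
    rw [← hW]
    exact ⟨t, hz, ht3⟩

/-- The common link of a set of vertices. -/
def lk (Γ : SimpleGraph V) (S : Set V) : Set V := {v | ∀ u ∈ S, Γ.Adj v u}

theorem lk_disj {S : Set V} {v : V} (h : v ∈ lk Γ S) : v ∉ S := fun h1 => Γ.irrefl (h v h1)

theorem commute_of_adj {S T : Set V} (hST : ∀ s ∈ S, ∀ t ∈ T, Γ.Adj s t) {x y : RAAG Γ}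
    (hx : x ∈ standardSub Γ S) (hy : y ∈ standardSub Γ T) : Commute x y := by
  have h1 : ∀ s ∈ S, ∀ y ∈ standardSub Γ T, Commute y (gen Γ s) := fun s hs y hy =>
    comm_link (standardSub_mono (fun t ht => hST s hs t ht) hy)
  induction hx using Subgroup.closure_induction with
  | mem x hx => obtain ⟨s, hs, rfl⟩ := hx; exact (h1 s hs y hy).symm
  | one => exact Commute.one_left _
  | mul a b _ _ ha hb => exact ha.mul_left hb
  | inv a _ ha => exact ha.inv_left

theorem commute_lk {S : Set V} {x y : RAAG Γ} (hx : x ∈ standardSub Γ S)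
    (hy : y ∈ standardSub Γ (lk Γ S)) : Commute x y :=
  commute_of_adj (fun s hs _ ht => (ht s hs).symm) hx hy

/-- `g` is shortest in its double coset `H_S g H_T`. -/
structure DMin (S T : Set V) (g : RAAG Γ) : Prop where
  left : ∀ s : V × Bool, s.1 ∈ S → ew s ∉ W g
  right : ∀ s : V × Bool, s.1 ∈ T → ew s ∉ W g⁻¹

theorem exists_dmin (S T : Set V) (g : RAAG Γ) :
    ∃ a ∈ standardSub Γ S, ∃ b ∈ standardSub Γ T, ∃ g₀, g = a * g₀ * b ∧ DMin S T g₀ := by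
  induction hn : len g using Nat.strong_induction_on generalizing g with
  | _ n ih =>
    by_cases hL : ∃ s : V × Bool, s.1 ∈ S ∧ ew s ∈ W g
    · obtain ⟨s, hs, hw⟩ := hL
      have h1 := len_del hw
      obtain ⟨a, ha, b, hb, g₀, h2, h3⟩ := ih _ (by omega) ((ltr s)⁻¹ * g) rfl
      refine ⟨ltr s * a, mul_mem (ltr_mem hs) ha, b, hb, g₀, ?_, h3⟩
      rw [mul_assoc, mul_assoc, ← mul_assoc a, ← h2, mul_inv_cancel_left]
    by_cases hR : ∃ s : V × Bool, s.1 ∈ T ∧ ew s ∈ W g⁻¹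
    · obtain ⟨s, hs, hw⟩ := hR
      have h1 := len_del hw
      rw [len_inv g, ← len_inv, mul_inv_rev, inv_inv, inv_inv] at h1
      obtain ⟨a, ha, b, hb, g₀, h2, h3⟩ := ih _ (by omega) (g * ltr s) rfl
      refine ⟨a, ha, b * (ltr s)⁻¹, mul_mem hb (inv_mem (ltr_mem hs)), g₀, ?_, h3⟩
      rw [← mul_assoc, ← h2, mul_inv_cancel_right]
    · push Not at hL hR
      exact ⟨1, one_mem _, 1, one_mem _, g, by simp, ⟨hL, hR⟩⟩

theorem DMin.disj_left {S T : Set V} {g h : RAAG Γ} (hg : DMin S T g)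
    (hh : h ∈ standardSub Γ S) : ∀ e ∈ W h, e ∉ W g := by
  intro e he heg
  obtain ⟨s, h1, h2⟩ := exists_common_letter h g e he heg
  refine hg.left s ?_ h2
  simpa using mem_standardSub.1 hh _ h1

theorem DMin.disj_right {S T : Set V} {g h : RAAG Γ} (hg : DMin S T g)
    (hh : h ∈ standardSub Γ T) : ∀ e ∈ W h, e ∉ W g⁻¹ := by
  intro e he heg
  obtain ⟨s, h1, h2⟩ := exists_common_letter h g⁻¹ e he heg
  refine hg.right s ?_ h2
  simpa using mem_standardSub.1 hh _ h1

/-- The vertex set supporting `H_S ∩ g H_T g⁻¹` for `g` shortest in its double coset. -/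
def interSupp (S T : Set V) (g : RAAG Γ) : Set V := {v | v ∈ S ∧ v ∈ T ∧ ∀ e ∈ W g, Γ.Adj v e.1}

theorem DMin.inter {S T : Set V} {g p : RAAG Γ} (hg : DMin S T g) (hp : p ∈ standardSub Γ S)
    (hp' : g⁻¹ * p * g ∈ standardSub Γ T) : p ∈ standardSub Γ (interSupp S T g) := by
  rw [mem_standardSub]
  intro e he
  set t := g⁻¹ * p * g with ht
  have hpg : p * g = g * t := by rw [ht]; group
  have hne : e ∉ W g := hg.disj_left hp e he
  have hepg : e ∈ W (p * g) := by
    rw [mem_W_mul]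
    refine Or.inl ⟨he, fun h => ?_⟩
    refine hg.disj_left (inv_mem hp) (p⁻¹ • e) ?_ h
    rw [mem_W_inv, smul_inv_smul]; exact he
  refine ⟨mem_standardSub.1 hp e he, ?_, fun e' he' => ?_⟩
  · have h1 := hepg
    rw [hpg, mem_W_mul] at h1
    rcases h1 with h1 | h1
    · exact absurd h1.1 hne
    · exact mem_standardSub.1 hp' (g⁻¹ • e) h1.2
  · refine cross4 he hne he' (fun h => hg.disj_left hp e' h he') hepg ?_
    rw [hpg, mem_W_mul]
    refine Or.inl ⟨he', fun h => hg.disj_right hp' _ h ?_⟩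
    rw [mem_W_inv, smul_inv_smul]; exact he'

theorem interSupp_commute {S T : Set V} {g p : RAAG Γ}
    (hp : p ∈ standardSub Γ (interSupp S T g)) : Commute p g := by
  refine commute_of_adj (S := interSupp S T g) (T := {v | ∃ e ∈ W g, e.1 = v}) ?_ hp ?_
  · rintro s hs _ ⟨e, he, rfl⟩
    exact hs.2.2 e he
  · rw [mem_standardSub]
    exact fun e he => ⟨e, he, rfl⟩

/-- Intersections of parabolic subgroups are parabolic. -/
theorem parabolic_inter (S T : Set V) (g : RAAG Γ) :
    ∃ a ∈ standardSub Γ S, ∃ U, U ⊆ S ∧ U ⊆ T ∧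
      ∀ p, (p ∈ standardSub Γ S ∧ g⁻¹ * p * g ∈ standardSub Γ T) ↔
        a⁻¹ * p * a ∈ standardSub Γ U := by
  obtain ⟨a, ha, b, hb, g₀, rfl, hg₀⟩ := exists_dmin S T g
  have hS : interSupp S T g₀ ⊆ S := fun v h => h.1
  have hT : interSupp S T g₀ ⊆ T := fun v h => h.2.1
  refine ⟨a, ha, interSupp S T g₀, hS, hT, fun p => ⟨fun ⟨h1, h2⟩ => ?_, fun h => ⟨?_, ?_⟩⟩⟩
  · refine hg₀.inter (mul_mem (mul_mem (inv_mem ha) h1) ha) ?_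
    have := mul_mem (mul_mem hb h2) (inv_mem hb)
    convert this using 1
    group
  · have := mul_mem (mul_mem ha (standardSub_mono hS h)) (inv_mem ha)
    convert this using 1
    group
  · have h1 := interSupp_commute h
    have := mul_mem (mul_mem (inv_mem hb) (standardSub_mono hT h)) hb
    convert this using 1
    calc _ = b⁻¹ * (g₀⁻¹ * ((a⁻¹ * p * a) * g₀)) * b := by group
      _ = _ := by rw [h1.eq]; group

theorem parabolic_le {S T : Set V} {g : RAAG Γ}
    (h : ∀ p ∈ standardSub Γ S, g⁻¹ * p * g ∈ standardSub Γ T) :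
    S ⊆ T ∧ ∃ a ∈ standardSub Γ S, ∃ c ∈ standardSub Γ (lk Γ S), ∃ b ∈ standardSub Γ T,
      g = a * c * b := by
  obtain ⟨a, ha, b, hb, g₀, rfl, hg₀⟩ := exists_dmin S T g
  have key : S ⊆ interSupp S T g₀ := by
    intro s hs
    rw [← gen_mem_iff (Γ := Γ)]
    refine hg₀.inter (gen_mem hs) ?_
    have h1 := h (a * gen Γ s * a⁻¹) (mul_mem (mul_mem ha (gen_mem hs)) (inv_mem ha))
    have := mul_mem (mul_mem hb h1) (inv_mem hb)
    convert this using 1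
    group
  refine ⟨fun s hs => (key hs).2.1, a, ha, g₀, ?_, b, hb, rfl⟩
  rw [mem_standardSub]
  intro e he u hu
  exact ((key hu).2.2 e he).symm

/-- The star of a vertex. -/
def star (Γ : SimpleGraph V) (v : V) : Set V := insert v (Γ.neighborSet v)

theorem commute_of_mem_star {v : V} {g : RAAG Γ} (h : g ∈ standardSub Γ (star Γ v)) :
    Commute g (gen Γ v) := by
  induction h using Subgroup.closure_induction with
  | mem x hx =>
    obtain ⟨u, hu, rfl⟩ := hx
    rcases hu with rfl | hu
    · exact Commute.refl _
    · exact gen_comm hu.symm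
  | one => exact Commute.one_left _
  | mul a b _ _ ha hb => exact ha.mul_left hb
  | inv a _ ha => exact ha.inv_left

theorem conj_mem_of_closure {S : Set V} {K : Subgroup (RAAG Γ)} {g : RAAG Γ}
    (h : ∀ s ∈ S, g⁻¹ * gen Γ s * g ∈ K) {p : RAAG Γ} (hp : p ∈ standardSub Γ S) :
    g⁻¹ * p * g ∈ K := by
  induction hp using Subgroup.closure_induction with
  | mem x hx => obtain ⟨s, hs, rfl⟩ := hx; exact h s hs
  | one => simp [one_mem]
  | mul a b _ _ ha hb =>
    have := mul_mem ha hb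
    convert this using 1
    group
  | inv a _ ha =>
    have := inv_mem ha
    convert this using 1
    group

theorem centralizer_gen {v : V} {g : RAAG Γ} :
    Commute g (gen Γ v) ↔ g ∈ standardSub Γ (star Γ v) := by
  refine ⟨fun h => ?_, commute_of_mem_star⟩
  obtain ⟨-, a, ha, c, hc, b, hb, rfl⟩ := parabolic_le (S := {v}) (T := {v}) (g := g)
    (fun p hp => conj_mem_of_closure (fun s hs => by
      rw [Set.mem_singleton_iff] at hs
      subst hs
      rw [mul_assoc, ← h.eq, inv_mul_cancel_left]
      exact gen_mem rfl) hp)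
  have h1 : ({v} : Set V) ⊆ star Γ v := by rintro _ rfl; exact Set.mem_insert _ _
  refine mul_mem (mul_mem (standardSub_mono h1 ha) (standardSub_mono ?_ hc)) (standardSub_mono h1 hb)
  intro u hu
  exact Set.mem_insert_of_mem _ (hu v rfl).symm

end Geometry3

section Geometry4
variable {V : Type} {Γ : SimpleGraph V}

theorem W_injective : Function.Injective (W : RAAG Γ → Set (Wall Γ)) := by
  intro x y h
  have h1 : W (x⁻¹ * y) = ∅ := by
    ext e
    rw [mem_W_mul, mem_W_inv, inv_inv, h]
    simp
  rw [W_eq_empty, inv_mul_eq_one] at h1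
  exact h1

theorem disjoint_of_len {x y : RAAG Γ} (h : len x + len y ≤ len (x * y)) :
    Disjoint (W x⁻¹) (W y) := by
  rw [Set.disjoint_left]
  intro e hx hy
  obtain ⟨s, h1, h2⟩ := exists_common_letter _ _ e hx hy
  have h3 := len_del h1
  have h4 := len_del h2
  have h5 := len_mul_le (x * ltr s) ((ltr s)⁻¹ * y)
  rw [← len_inv, mul_inv_rev, inv_inv, inv_inv] at h3
  rw [len_inv] at h3
  have h6 : x * ltr s * ((ltr s)⁻¹ * y) = x * y := by group
  rw [h6] at h5
  omega

theorem W_mul_of_disjoint {x y : RAAG Γ} (h : Disjoint (W x⁻¹) (W y)) :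
    W (x * y) = W x ∪ x • W y ∧ Disjoint (W x) (x • W y) := by
  have h1 : Disjoint (W x) (x • W y) := by
    rw [Set.disjoint_left] at h ⊢
    intro e he he'
    rw [Set.mem_smul_set_iff_inv_smul_mem] at he'
    exact h (mem_W_inv.2 (by rwa [smul_inv_smul])) he'
  refine ⟨?_, h1⟩
  rw [W_mul]
  exact h1.symmDiff_eq_sup

/-- Cyclically reduced elements. -/
def CycRed (x : RAAG Γ) : Prop := Disjoint (W x) (W x⁻¹)

theorem CycRed.inv {x : RAAG Γ} (h : CycRed x) : CycRed x⁻¹ := by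
  unfold CycRed at *
  rw [inv_inv]
  exact h.symm

theorem notMem_of_smul_eq {x : RAAG Γ} {e : Wall Γ} (h : x • e = e) : e ∉ W x := by
  obtain ⟨a, ha⟩ := pot_two e
  have h1 := ha 1
  have h2 := ha x
  have h3 := ha (x * x)
  rw [pot_mul, inv_smul_eq_iff.2 h.symm] at h3
  rw [pot_one] at h1
  rw [mem_W]
  omega

theorem exists_cycRed (x : RAAG Γ) :
    ∃ h x₀, x = h * x₀ * h⁻¹ ∧ CycRed x₀ ∧ len x = 2 * len h + len x₀ := by
  induction hn : len x using Nat.strong_induction_on generalizing x with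
  | _ n ih =>
    by_cases hx : CycRed x
    · exact ⟨1, x, by simp, hx, by simp [hn]⟩
    · unfold CycRed at hx
      rw [Set.not_disjoint_iff] at hx
      obtain ⟨e, he, he'⟩ := hx
      obtain ⟨s, h1, h2⟩ := exists_common_letter _ _ e he he'
      have h3 := len_del h1
      have h4 : ew s ∈ W ((ltr s)⁻¹ * x)⁻¹ := by
        rw [mul_inv_rev, inv_inv, mem_W_mul, W_ltr]
        refine Or.inl ⟨h2, fun h => ?_⟩
        rw [Set.mem_singleton_iff, inv_inv] at h
        exact notMem_of_smul_eq h h1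
      have h5 := len_del h4
      rw [len_inv] at h5
      set x₁ := (ltr s)⁻¹ * x * ltr s with hx₁
      have h6 : len x₁ + 1 = len ((ltr s)⁻¹ * x) := by
        rw [← h5, ← len_inv x₁, hx₁]
        congr 2
        group
      obtain ⟨h, x₀, h7, h8, h9⟩ := ih _ (by omega) x₁ rfl
      refine ⟨ltr s * h, x₀, ?_, h8, ?_⟩
      · rw [mul_inv_rev]
        calc x = ltr s * x₁ * (ltr s)⁻¹ := by rw [hx₁]; group
          _ = _ := by rw [h7]; group
      · have h10 : len (ltr s * h) ≤ len h + 1 := by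
          refine (len_mul_le _ _).trans ?_
          rw [len, W_ltr, Set.ncard_singleton, add_comm]
        have h11 : len x ≤ 2 * len (ltr s * h) + len x₀ := by
          have : x = (ltr s * h) * x₀ * (ltr s * h)⁻¹ := by
            rw [mul_inv_rev]
            calc x = ltr s * x₁ * (ltr s)⁻¹ := by rw [hx₁]; group
              _ = _ := by rw [h7]; group
          calc len x = len ((ltr s * h) * x₀ * (ltr s * h)⁻¹) := by rw [← this]
            _ ≤ len ((ltr s * h) * x₀) + len (ltr s * h)⁻¹ := len_mul_le _ _
            _ ≤ len (ltr s * h) + len x₀ + len (ltr s * h) := by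
              rw [len_inv]; have := len_mul_le (ltr s * h) x₀; omega
            _ = _ := by ring
        omega

theorem adj_of_letter {s : V × Bool} {x z : RAAG Γ} (h1 : ew s ∉ W x) (h2 : ew s ∈ W z)
    (h3 : W x ⊆ W z) {e : Wall Γ} (he : e ∈ W x) : Γ.Adj s.1 e.1 := by
  have := cross4 (p := ltr s) (q := x) (z := z) (e := ew s) (e' := e) (by rw [W_ltr]; rfl) h1 he
    (by rw [W_ltr]; rintro rfl; exact h1 he) h2 (h3 he)
  rwa [ew_fst] at this

theorem CycRed.disjoint_pow {x y : RAAG Γ} (hx : CycRed x) (hy : Disjoint (W x⁻¹) (W y)) (n : ℕ) :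
    Disjoint (W x⁻¹) (W (x ^ n * y)) := by
  induction n with
  | zero => simpa using hy
  | succ n ih =>
    rw [Set.disjoint_left]
    intro e he he'
    obtain ⟨s, h1, h2⟩ := exists_common_letter _ _ e he he'
    have h3 : W x ⊆ W (x ^ (n + 1) * y) := by
      rw [pow_succ', mul_assoc, (W_mul_of_disjoint ih).1]
      exact Set.subset_union_left
    have h4 := adj_of_letter (Set.disjoint_right.1 hx h1) h2 h3 (mem_W_inv.1 h1)
    rw [smul_fst, ew_fst] at h4
    exact Γ.irrefl h4

theorem CycRed.W_pow_succ {x : RAAG Γ} (hx : CycRed x) (n : ℕ) :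
    W (x ^ (n + 1)) = W x ∪ x • W (x ^ n) ∧ Disjoint (W x) (x • W (x ^ n)) := by
  have h := hx.disjoint_pow (y := 1) (by simp) n
  rw [mul_one] at h
  rw [pow_succ']
  exact W_mul_of_disjoint h

/-- Number of walls of a given type crossed. -/
noncomputable def lenv (v : V) (h : RAAG Γ) : ℕ := (W h ∩ {e | e.1 = v}).ncard

theorem lenv_mul_of_disjoint {x y : RAAG Γ} (h : Disjoint (W x⁻¹) (W y)) (v : V) :
    lenv v (x * y) = lenv v x + lenv v y := by
  obtain ⟨h1, h2⟩ := W_mul_of_disjoint h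
  have h3 : (x • W y) ∩ {e | e.1 = v} = x • (W y ∩ {e | e.1 = v}) := by
    ext e
    simp only [Set.mem_inter_iff, Set.mem_smul_set_iff_inv_smul_mem, Set.mem_ofPred_eq, smul_fst]
  rw [lenv, h1, Set.union_inter_distrib_right, Set.ncard_union_eq
    (h2.mono Set.inter_subset_left Set.inter_subset_left) ((finite_W x).inter_of_left _)
    (((finite_W y).smul_set).inter_of_left _), h3, Set.ncard_smul_set]
  rfl

theorem CycRed.lenv_pow {x : RAAG Γ} (hx : CycRed x) (v : V) (n : ℕ) :
    lenv v (x ^ n) = n * lenv v x := by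
  induction n with
  | zero => simp [lenv]
  | succ n ih =>
    have h := hx.disjoint_pow (y := 1) (by simp) n
    rw [mul_one] at h
    rw [pow_succ', lenv_mul_of_disjoint h, ih]
    ring

theorem CycRed.subset_pow {x : RAAG Γ} (hx : CycRed x) {n : ℕ} (hn : 0 < n) : W x ⊆ W (x ^ n) := by
  obtain ⟨m, rfl⟩ : ∃ m, n = m + 1 := ⟨n - 1, by omega⟩
  rw [(hx.W_pow_succ m).1]
  exact Set.subset_union_left

theorem CycRed.pow {x : RAAG Γ} (hx : CycRed x) {n : ℕ} (hn : 0 < n) : CycRed (x ^ n) := by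
  unfold CycRed
  rw [Set.disjoint_left]
  intro e he he'
  obtain ⟨s, h1, h2⟩ := exists_common_letter _ _ e he he'
  have h3 := hx.inv.disjoint_pow (y := 1) (by simp) n
  rw [mul_one, inv_inv, inv_pow] at h3
  have h4 : ∀ e ∈ W x, Γ.Adj s.1 e.1 := fun e he =>
    adj_of_letter (Set.disjoint_right.1 h3 h2) h1 (hx.subset_pow hn) he
  have h5 : x ∈ standardSub Γ (Γ.neighborSet s.1) := by
    rw [mem_standardSub]; exact h4
  have h6 := mem_standardSub.1 (pow_mem h5 n) _ h1
  rw [ew_fst] at h6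
  exact Γ.irrefl h6

theorem CycRed.conj_subset {h x : RAAG Γ} (hx : CycRed x)
    (hl : len (h * x * h⁻¹) = 2 * len h + len x) {k : ℕ} (hk : 0 < k) :
    W h ⊆ W ((h * x * h⁻¹) ^ k) := by
  have hl' := hl
  have e1 := len_mul_le h (x * h⁻¹)
  have e2 := len_mul_le x h⁻¹
  have e3 := len_mul_le (h * x) h⁻¹
  have e4 := len_mul_le h x
  rw [len_inv h] at *
  rw [← mul_assoc] at e1
  have d1 : Disjoint (W x⁻¹) (W h⁻¹) := disjoint_of_len (by rw [len_inv h]; omega)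
  have d2 : Disjoint (W h⁻¹) (W x) := disjoint_of_len (by omega)
  have key : Disjoint (W h⁻¹) (W (x ^ k * h⁻¹)) := by
    rw [Set.disjoint_left]
    intro e he he'
    obtain ⟨s, h1, h2⟩ := exists_common_letter _ _ e he he'
    obtain ⟨m, rfl⟩ : ∃ m, k = m + 1 := ⟨k - 1, by omega⟩
    have h3 : W x ⊆ W (x ^ (m + 1) * h⁻¹) := by
      rw [pow_succ', mul_assoc, (W_mul_of_disjoint (hx.disjoint_pow d1 m)).1]
      exact Set.subset_union_left
    have h4 : ∀ e ∈ W x, Γ.Adj s.1 e.1 := fun e he =>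
      adj_of_letter (Set.disjoint_left.1 d2 h1) h2 h3 he
    have h5 : Commute x (ltr s) := by
      refine comm_link_ltr ?_
      rw [mem_standardSub]
      exact h4
    have h6 := len_del h1
    have h7 : (h * ltr s) * x * (h * ltr s)⁻¹ = h * x * h⁻¹ := by
      rw [mul_assoc h, ← h5.eq]; group
    have h8 : len (h * ltr s) + 1 = len h := by
      rw [← len_inv h, ← h6, ← len_inv (h * ltr s), mul_inv_rev]
    have h9 := len_mul_le (h * ltr s * x) (h * ltr s)⁻¹
    have h10 := len_mul_le (h * ltr s) x
    rw [h7, len_inv] at h9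
    omega
  rw [conj_pow, mul_assoc, (W_mul_of_disjoint key).1]
  exact Set.subset_union_left

theorem cycRed_of_pow {x : RAAG Γ} {k : ℕ} (hk : 0 < k) (hx : CycRed (x ^ k)) : CycRed x := by
  obtain ⟨h, x₀, rfl, h0, hl⟩ := exists_cycRed x
  have h1 := h0.conj_subset hl hk
  have hl2 : len (h * x₀⁻¹ * h⁻¹) = 2 * len h + len x₀⁻¹ := by
    rw [len_inv, ← hl, ← len_inv]; congr 1; group
  have h2 := h0.inv.conj_subset hl2 hk
  have h3 : (h * x₀⁻¹ * h⁻¹) ^ k = ((h * x₀ * h⁻¹) ^ k)⁻¹ := by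
    rw [← inv_pow]; congr 1; group
  rw [h3] at h2
  have h4 : W h = ∅ := by
    rw [Set.eq_empty_iff_forall_notMem]
    intro e he
    exact Set.disjoint_left.1 hx (h1 he) (h2 he)
  rw [W_eq_empty] at h4
  subst h4
  simpa using h0

theorem nested_of_same_type {p q z : RAAG Γ} (hp : W p ⊆ W z) (hq : W q ⊆ W z) (v : V) :
    W p ∩ {e | e.1 = v} ⊆ W q ∩ {e | e.1 = v} ∨ W q ∩ {e | e.1 = v} ⊆ W p ∩ {e | e.1 = v} := by
  by_contra hcon
  rw [not_or, Set.not_subset, Set.not_subset] at hcon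
  obtain ⟨⟨e, ⟨he, hev⟩, he2⟩, e', ⟨he', hev'⟩, he2'⟩ := hcon
  rw [Set.mem_ofPred_eq] at hev hev'
  have := cross4 he (fun h => he2 ⟨h, hev⟩) he' (fun h => he2' ⟨h, hev'⟩) (hp he) (hq he')
  rw [hev, hev'] at this
  exact Γ.irrefl this

theorem eq_of_lenv {p q z : RAAG Γ} (hp : W p ⊆ W z) (hq : W q ⊆ W z)
    (h : ∀ v, lenv v p = lenv v q) : p = q := by
  have key : ∀ v, W p ∩ {e | e.1 = v} = W q ∩ {e | e.1 = v} := by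
    intro v
    rcases nested_of_same_type hp hq v with h1 | h1
    · exact Set.eq_of_subset_of_ncard_le h1 (h v).ge ((finite_W q).inter_of_left _)
    · exact (Set.eq_of_subset_of_ncard_le h1 (h v).le ((finite_W p).inter_of_left _)).symm
  apply W_injective
  ext e
  have := Set.ext_iff.1 (key e.1) e
  simpa using this

/-- Right-angled Artin groups have unique roots. -/
theorem unique_root {x y : RAAG Γ} {k : ℕ} (hk : 0 < k) (h : x ^ k = y ^ k) : x = y := by
  have red : ∀ x y : RAAG Γ, CycRed y → x ^ k = y ^ k → x = y := by
    intro x y hy h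
    have hz : CycRed (y ^ k) := hy.pow hk
    have hx := cycRed_of_pow hk (h ▸ hz)
    refine eq_of_lenv (hx.subset_pow hk) (h ▸ hy.subset_pow hk) fun v => ?_
    have h1 := hx.lenv_pow v k
    rw [h, hy.lenv_pow v k] at h1
    exact (Nat.eq_of_mul_eq_mul_left hk h1).symm
  obtain ⟨g, y₀, rfl, hy, -⟩ := exists_cycRed y
  have h1 : (g⁻¹ * x * g) ^ k = y₀ ^ k := by
    have h2 : (g⁻¹ * x * g⁻¹⁻¹) ^ k = g⁻¹ * x ^ k * g⁻¹⁻¹ := conj_pow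
    rw [inv_inv] at h2
    rw [h2, h, conj_pow]; group
  rw [← red _ _ hy h1]; group

theorem torsion_free {x : RAAG Γ} {k : ℕ} (hk : 0 < k) (h : x ^ k = 1) : x = 1 :=
  unique_root hk (by simpa using h)

theorem commute_of_pow {x y : RAAG Γ} {k : ℕ} (hk : 0 < k) (h : Commute x (y ^ k)) :
    Commute x y := by
  have h1 : x * y * x⁻¹ = y := unique_root hk (by rw [conj_pow, h.eq, mul_inv_cancel_right])
  rw [mul_inv_eq_iff_eq_mul] at h1
  exact h1

open Classical in
/-- The retraction onto a standard subgroup. -/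
noncomputable def ret (S : Set V) : RAAG Γ →* RAAG Γ :=
  raagLift (fun v => if v ∈ S then gen Γ v else 1) (by
    intro u v h
    split_ifs <;> simp [gen_comm h])

theorem ret_of_mem {S : Set V} {x : RAAG Γ} (h : x ∈ standardSub Γ S) : ret S x = x := by
  induction h using Subgroup.closure_induction with
  | mem x hx => obtain ⟨s, hs, rfl⟩ := hx; simp [ret, hs]
  | one => simp
  | mul a b _ _ ha hb => rw [map_mul, ha, hb]
  | inv a _ ha => rw [map_inv, ha]

theorem ret_mem (S : Set V) (x : RAAG Γ) : ret S x ∈ standardSub Γ S := by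
  induction x using raag_induction with
  | one => simp [one_mem]
  | mul x v ih =>
    rw [map_mul]
    refine mul_mem ih ?_
    simp only [ret, raagLift_gen]
    split_ifs with h
    exacts [gen_mem h, one_mem _]
  | mul_inv x v ih =>
    rw [map_mul, map_inv]
    refine mul_mem ih (inv_mem ?_)
    simp only [ret, raagLift_gen]
    split_ifs with h
    exacts [gen_mem h, one_mem _]

theorem ret_of_mem_of_disjoint {S T : Set V} (hST : Disjoint S T) {x : RAAG Γ}
    (h : x ∈ standardSub Γ T) : ret S x = 1 := by
  induction h using Subgroup.closure_induction with
  | mem x hx =>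
    obtain ⟨s, hs, rfl⟩ := hx
    simp [ret, Set.disjoint_right.1 hST hs]
  | one => simp
  | mul a b _ _ ha hb => rw [map_mul, ha, hb, one_mul]
  | inv a _ ha => rw [map_inv, ha, inv_one]

theorem mem_of_pow_mem {S : Set V} {x : RAAG Γ} {k : ℕ} (hk : 0 < k)
    (h : x ^ k ∈ standardSub Γ S) : x ∈ standardSub Γ S := by
  have h1 : ret S x = x := unique_root hk (by rw [← map_pow, ret_of_mem h])
  rw [← h1]
  exact ret_mem S x

end Geometry4

section Geometry5
variable {V : Type} {Γ : SimpleGraph V}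

theorem W_del {s : V × Bool} {h : RAAG Γ} (hs : ew s ∈ W h) :
    W ((ltr s)⁻¹ * h) = (ltr s : RAAG Γ)⁻¹ • (W h \ {ew s}) := by
  obtain ⟨h1, h2⟩ := W_ltr_mul (linv_notMem hs)
  rw [mul_inv_cancel_left] at h1
  have h3 : W h \ {ew s} = (ltr s : RAAG Γ) • W ((ltr s : RAAG Γ)⁻¹ * h) := by
    conv_lhs => rw [h1]
    rw [Set.insert_sdiff_of_mem _ (Set.mem_singleton _), Set.sdiff_singleton_eq_self h2]
  rw [h3, inv_smul_smul]

theorem W_del_subset {s : V × Bool} {g z : RAAG Γ} (hs : ew s ∈ W g) (h : W g ⊆ W z) :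
    W ((ltr s)⁻¹ * g) ⊆ W ((ltr s)⁻¹ * z) := by
  rw [W_del hs, W_del (h hs)]
  exact Set.smul_set_mono (Set.sdiff_subset_sdiff_left h)

theorem W_ltr_mul_subset {s : V × Bool} {g z : RAAG Γ} (hs : ew (linv s) ∉ W z) (h : W g ⊆ W z) :
    W (ltr s * g) ⊆ W (ltr s * z) := by
  rw [(W_ltr_mul hs).1, (W_ltr_mul fun h1 => hs (h h1)).1]
  exact Set.insert_subset_insert (Set.smul_set_mono h)

/-- Two prefixes of the same element have a join. -/
theorem exists_join {z g g' : RAAG Γ} (hg : W g ⊆ W z) (hg' : W g' ⊆ W z) :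
    ∃ j, W j = W g ∪ W g' := by
  induction hn : len g generalizing g g' z with
  | zero =>
    rw [len_eq_zero] at hn
    subst hn
    exact ⟨g', by simp⟩
  | succ n ih =>
    have h1 : g ≠ 1 := by rintro rfl; simp at hn
    obtain ⟨s, hs⟩ := exists_letter h1
    have key : ∀ g', W g' ⊆ W z → ew s ∈ W g' → ∃ j, W j = W g ∪ W g' := by
      intro g' hg' hs'
      have hl := len_del hs
      obtain ⟨j, hj⟩ := ih (W_del_subset hs hg) (W_del_subset hs' hg') (by omega)
      have hns : ew (linv s) ∉ W j := by
        rw [hj]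
        exact fun h => h.elim (linv_notMem hs) (linv_notMem hs')
      refine ⟨ltr s * j, ?_⟩
      rw [(W_ltr_mul hns).1, hj, W_del hs, W_del hs', ← Set.smul_set_union, smul_inv_smul,
        ← Set.union_sdiff_distrib, Set.insert_sdiff_singleton,
        Set.insert_eq_of_mem (Set.mem_union_left _ hs)]
    by_cases hs' : ew s ∈ W g'
    · exact key g' hg' hs'
    · have hadj : ∀ e ∈ W g', Γ.Adj s.1 e.1 := fun e he => adj_of_letter hs' (hg hs) hg' he
      have hmem : g' ∈ standardSub Γ (Γ.neighborSet s.1) := by rw [mem_standardSub]; exact hadj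
      have hW : W (g' * ltr s) = insert (ew s) (W g') := by
        ext e
        rw [mem_W_mul, W_ltr, Set.mem_singleton_iff, inv_smul_eq_iff, smul_ew_eq hmem,
          Set.mem_insert_iff]
        constructor
        · tauto
        · rintro (rfl | h)
          · exact Or.inr ⟨hs', rfl⟩
          · exact Or.inl ⟨h, fun h2 => hs' (h2 ▸ h)⟩
      obtain ⟨j, hj⟩ := key (g' * ltr s) (by rw [hW]; exact Set.insert_subset (hg hs) hg')
        (by rw [hW]; exact Set.mem_insert _ _)
      refine ⟨j, ?_⟩
      rw [hj, hW, Set.union_insert, Set.insert_eq_of_mem (Set.mem_union_left _ hs)]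

/-- The prefixes of `x` crossing at most `n v` walls of each type `v`. -/
def Adm (n : V → ℕ) (x g : RAAG Γ) : Prop := W g ⊆ W x ∧ ∀ v, lenv v g ≤ n v

theorem Adm.join {n : V → ℕ} {x g g' : RAAG Γ} (h : Adm n x g) (h' : Adm n x g') :
    ∃ j, Adm n x j ∧ W g ⊆ W j ∧ W g' ⊆ W j := by
  obtain ⟨j, hj⟩ := exists_join h.1 h'.1
  refine ⟨j, ⟨by rw [hj]; exact Set.union_subset h.1 h'.1, fun v => ?_⟩,
    by rw [hj]; exact Set.subset_union_left, by rw [hj]; exact Set.subset_union_right⟩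
  rw [lenv, hj, Set.union_inter_distrib_right]
  rcases nested_of_same_type h.1 h'.1 v with h1 | h1
  · rw [Set.union_eq_right.2 h1]; exact h'.2 v
  · rw [Set.union_eq_left.2 h1]; exact h.2 v

theorem exists_tr (n : V → ℕ) (x : RAAG Γ) :
    ∃ g, Adm n x g ∧ ∀ g', Adm n x g' → W g' ⊆ W g := by
  have h1 : Adm n x 1 := ⟨by simp, fun v => by simp [lenv]⟩
  have hfin : {g : RAAG Γ | Adm n x g}.Finite := by
    refine Set.Finite.of_finite_image (f := W) ?_ W_injective.injOn
    refine (finite_W x).finite_subsets.subset ?_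
    rintro _ ⟨g, hg, rfl⟩
    exact hg.1
  obtain ⟨g, hg, hmax⟩ := Set.exists_max_image _ len hfin ⟨1, h1⟩
  refine ⟨g, hg, fun g' hg' => ?_⟩
  obtain ⟨j, hj, h2, h3⟩ := hg.join hg'
  have : W g = W j := Set.eq_of_subset_of_ncard_le h2 (hmax j hj) (finite_W j)
  rw [this]; exact h3

/-- The largest prefix of `x` crossing at most `n v` walls of each type `v`. -/
noncomputable def tr (n : V → ℕ) (x : RAAG Γ) : RAAG Γ := (exists_tr n x).choose

theorem tr_adm (n : V → ℕ) (x : RAAG Γ) : Adm n x (tr n x) := (exists_tr n x).choose_spec.1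

theorem subset_tr {n : V → ℕ} {x g : RAAG Γ} (h : Adm n x g) : W g ⊆ W (tr n x) :=
  (exists_tr n x).choose_spec.2 g h

theorem tr_unique {n : V → ℕ} {x g : RAAG Γ} (h : Adm n x g)
    (hg : ∀ g', Adm n x g' → W g' ⊆ W g) : tr n x = g :=
  W_injective (Set.Subset.antisymm (hg _ (tr_adm n x)) (subset_tr h))

open Classical in
theorem lenv_ltr_mul {s : V × Bool} {h : RAAG Γ} (hs : ew (linv s) ∉ W h) (v : V) :
    lenv v (ltr s * h) = lenv v h + if v = s.1 then 1 else 0 := by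
  have h1 : Disjoint (W (ltr s : RAAG Γ)⁻¹) (W h) := by
    rw [← ltr_linv, W_ltr, Set.disjoint_singleton_left]; exact hs
  rw [lenv_mul_of_disjoint h1, add_comm]
  congr 1
  rw [lenv, W_ltr]
  split_ifs with h2
  · rw [Set.inter_eq_left.2, Set.ncard_singleton]
    rintro _ rfl
    exact (ew_fst s).trans h2.symm
  · rw [Set.ncard_eq_zero (Set.toFinite _), Set.eq_empty_iff_forall_notMem]
    rintro _ ⟨rfl, h3⟩
    exact h2 (h3.symm.trans (ew_fst s))

open Classical in
theorem tr_ltr_mul {n : V → ℕ} {s : V × Bool} {x : RAAG Γ} (hs : ew (linv s) ∉ W x)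
    (hn : 1 ≤ n s.1) :
    tr n (ltr s * x) = ltr s * tr (fun v => n v - if v = s.1 then 1 else 0) x := by
  set m : V → ℕ := fun v => n v - if v = s.1 then 1 else 0 with hm
  have hmn : ∀ v, m v + (if v = s.1 then 1 else 0) = n v := by
    intro v
    simp only [hm]
    split_ifs with h
    · subst h; omega
    · omega
  have h1 : ∀ g, Adm m x g → Adm n (ltr s * x) (ltr s * g) := by
    intro g hg
    refine ⟨W_ltr_mul_subset hs hg.1, fun v => ?_⟩
    rw [lenv_ltr_mul (fun h => hs (hg.1 h)), ← hmn v]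
    exact Nat.add_le_add_right (hg.2 v) _
  refine tr_unique (h1 _ (tr_adm m x)) fun g' hg' => ?_
  have hs1 : Adm n (ltr s * x) (ltr s) := by
    have := h1 1 ⟨by simp, fun v => by simp [lenv]⟩
    rwa [mul_one] at this
  obtain ⟨j, hj, h2, h3⟩ := hg'.join hs1
  refine h2.trans ?_
  have hsj : ew s ∈ W j := h3 (by rw [W_ltr]; rfl)
  have h4 : Adm m x ((ltr s)⁻¹ * j) := by
    refine ⟨?_, fun v => ?_⟩
    · have := W_del_subset hsj hj.1
      rwa [inv_mul_cancel_left] at this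
    · have h5 := lenv_ltr_mul (linv_notMem hsj) v
      rw [mul_inv_cancel_left] at h5
      have h6 := hj.2 v
      rw [h5, ← hmn v] at h6
      exact Nat.le_of_add_le_add_right h6
  have := W_ltr_mul_subset (fun h => hs ((tr_adm m x).1 h)) (subset_tr h4)
  rwa [mul_inv_cancel_left] at this

/-- Right multiplication by `k` does not change truncations when the walls of `k` are moved away. -/
theorem tr_mul_right {n : V → ℕ} {x k : RAAG Γ}
    (h : ∀ e ∈ W k, x • e ∉ W (tr n x) ∧ x • e ∉ W (tr n (x * k))) : tr n (x * k) = tr n x := by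
  have h1 : ∀ e, x⁻¹ • e ∈ W k → e ∉ W (tr n x) ∧ e ∉ W (tr n (x * k)) := fun e he => by
    simpa using h _ he
  refine tr_unique ⟨fun e he => ?_, (tr_adm n x).2⟩ fun g' hg' => ?_
  · rw [mem_W_mul]
    exact Or.inl ⟨(tr_adm n x).1 he, fun h2 => (h1 e h2).1 he⟩
  · refine (subset_tr hg').trans (subset_tr ⟨fun e he => ?_, (tr_adm n (x * k)).2⟩)
    have h2 := (tr_adm n (x * k)).1 he
    rw [mem_W_mul] at h2
    rcases h2 with h2 | h2
    · exact h2.1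
    · exact absurd he (h1 e h2.2).2

variable [Fintype V]

theorem len_le_sum (x : RAAG Γ) : len x ≤ ∑ v, lenv v x := by
  classical
  have h1 : W x ⊆ ⋃ v ∈ (Finset.univ : Finset V), W x ∩ {e | e.1 = v} := by
    intro e he
    simp only [Set.mem_iUnion]
    exact ⟨e.1, Finset.mem_univ _, he, rfl⟩
  refine (Set.ncard_le_ncard h1 ?_).trans (Finset.set_ncard_biUnion_le _ _)
  exact Set.Finite.biUnion (Finset.finite_toSet _) fun v _ => (finite_W x).inter_of_left _

theorem finite_ball (R : ℕ) : {x : RAAG Γ | len x ≤ R}.Finite := by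
  induction R with
  | zero =>
    refine (Set.finite_singleton 1).subset fun x hx => ?_
    exact len_eq_zero.1 (Nat.le_zero.1 hx)
  | succ R ih =>
    refine ((Set.finite_singleton (1 : RAAG Γ)).union
      (Set.Finite.image2 (fun (s : V × Bool) (x : RAAG Γ) => ltr s * x)
        Set.finite_univ ih)).subset fun x hx => ?_
    by_cases h1 : x = 1
    · exact Or.inl h1
    · obtain ⟨s, hs⟩ := exists_letter h1
      have h2 := len_del hs
      refine Or.inr ⟨s, trivial, (ltr s)⁻¹ * x, ?_, by simp⟩
      have : len x ≤ R + 1 := hx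
      show len _ ≤ R
      omega

/-- The walls crossed by elements of a ball. -/
def ballWalls (Γ : SimpleGraph V) (R : ℕ) : Set (Wall Γ) := ⋃ x ∈ {x : RAAG Γ | len x ≤ R}, W x

theorem finite_ballWalls (R : ℕ) : (ballWalls Γ R).Finite :=
  Set.Finite.biUnion (finite_ball R) fun x _ => finite_W x

/-- The sequence of bounds used for truncation. -/
def bd {N : ℕ} (n : V → Fin N) : V → ℕ := fun v => n v

theorem W_tr_subset {N : ℕ} (n : V → Fin N) (x : RAAG Γ) :
    W (tr (bd n) x) ⊆ ballWalls Γ (Fintype.card V * N) := by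
  refine Set.subset_biUnion_of_mem (u := W) ?_
  refine (len_le_sum _).trans ?_
  calc _ ≤ ∑ v : V, N := Finset.sum_le_sum fun v _ =>
        ((tr_adm (bd n) x).2 v).trans (n v).2.le
    _ = _ := by simp

open Classical in
/-- Number of truncations of `x` lying in `E`. -/
noncomputable def cnt (N : ℕ) (x : RAAG Γ) (E : Set (RAAG Γ)) : ℕ :=
  (Finset.univ.filter fun n : V → Fin N => tr (bd n) x ∈ E).card

open Classical in
theorem card_slice {N : ℕ} (v : V) (c : Fin N) :
    N * (Finset.univ.filter fun n : V → Fin N => n v = c).card = N ^ Fintype.card V := by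
  have h1 : (Finset.univ.filter fun n : V → Fin N => n v = c) =
      Fintype.piFinset (Function.update (fun _ : V => (Finset.univ : Finset (Fin N))) v
        ({c} : Finset (Fin N))) := by
    ext n
    simp only [Finset.mem_filter, Finset.mem_univ, true_and, Fintype.mem_piFinset]
    constructor
    · intro h w
      by_cases hw : w = v
      · subst hw; simp [h]
      · simp [hw]
    · intro h; simpa using h v
  rw [h1, Fintype.card_piFinset, ← Finset.mul_prod_erase _ _ (Finset.mem_univ v)]
  simp only [Function.update_self, Finset.card_singleton, one_mul]
  rw [Finset.prod_congr rfl (g := fun _ => N), Finset.prod_const, Finset.card_erase_of_mem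
    (Finset.mem_univ v), Finset.card_univ, ← pow_succ', Nat.sub_add_cancel]
  · exact Fintype.card_pos_iff.2 ⟨v⟩
  · intro w hw
    rw [Function.update_of_ne (Finset.ne_of_mem_erase hw)]
    simp

open Classical in
theorem cnt_ltr_mul_aux {N : ℕ} (hN : 0 < N) {s : V × Bool} {x : RAAG Γ} (hs : ew (linv s) ∉ W x)
    (E : Set (RAAG Γ)) :
    |(N * cnt N (ltr s * x) E : ℤ) - N * cnt N x ((ltr s : RAAG Γ)⁻¹ • E)| ≤ N ^ Fintype.card V := by
  obtain ⟨M, rfl⟩ : ∃ M, N = M + 1 := ⟨N - 1, by omega⟩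
  set A := Finset.univ.filter fun n : V → Fin (M + 1) => tr (bd n) (ltr s * x) ∈ E with hA
  set B := Finset.univ.filter fun n : V → Fin (M + 1) => tr (bd n) x ∈ (ltr s : RAAG Γ)⁻¹ • E with hB
  set Z := Finset.univ.filter fun n : V → Fin (M + 1) => n s.1 = 0 with hZ
  set L := Finset.univ.filter fun n : V → Fin (M + 1) => n s.1 = Fin.last M with hL
  have key : (A \ Z).card = (B \ L).card := by
    refine Finset.card_bij (fun n _ => Function.update n s.1 (n s.1 - 1)) ?_ ?_ ?_
    · intro n hn
      simp only [hA, hZ, hB, hL, Finset.mem_sdiff, Finset.mem_filter, Finset.mem_univ,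
        true_and] at hn ⊢
      have hpos : 1 ≤ (n s.1 : ℕ) := Nat.one_le_iff_ne_zero.2 fun h => hn.2 (Fin.ext h)
      have hval : ((n s.1 - 1 : Fin (M + 1)) : ℕ) = (n s.1 : ℕ) - 1 := by
        exact Fin.val_sub_one_of_ne_zero fun h => hn.2 h
      refine ⟨?_, ?_⟩
      · rw [tr_ltr_mul hs (by exact hpos)] at hn
        rw [Set.mem_smul_set_iff_inv_smul_mem, inv_inv, smul_eq_mul]
        convert hn.1 using 3
        funext v
        by_cases hv : v = s.1
        · subst hv; simp [bd, hval]
        · simp [bd, hv]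
      · rw [Function.update_self, Fin.ext_iff, hval, Fin.val_last]
        have := (n s.1).2
        omega
    · intro n hn n' hn' h
      funext v
      by_cases hv : v = s.1
      · subst hv
        have := congrFun h s.1
        simpa using this
      · have := congrFun h v
        simpa [hv] using this
    · intro n hn
      simp only [hA, hZ, hB, hL, Finset.mem_sdiff, Finset.mem_filter, Finset.mem_univ,
        true_and] at hn ⊢
      have hlt : (n s.1 : ℕ) < M := by
        have := (n s.1).2
        have h2 : (n s.1 : ℕ) ≠ M := fun h => hn.2 (Fin.ext h)
        omega
      have hval : ((n s.1 + 1 : Fin (M + 1)) : ℕ) = (n s.1 : ℕ) + 1 := by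
        exact Fin.val_add_one_of_lt (Fin.lt_def.2 hlt)
      refine ⟨Function.update n s.1 (n s.1 + 1), ⟨?_, ?_⟩, by simp⟩
      · rw [tr_ltr_mul hs (by simp [bd, hval])]
        rw [Set.mem_smul_set_iff_inv_smul_mem, inv_inv, smul_eq_mul] at hn
        convert hn.1 using 3
        funext v
        by_cases hv : v = s.1
        · subst hv; simp [bd, hval]
        · simp [bd, hv]
      · rw [Function.update_self, Fin.ext_iff, hval]
        simp
  have c1 : (A \ Z).card ≤ A.card := Finset.card_le_card Finset.sdiff_subset
  have c2 : A.card ≤ (A \ Z).card + Z.card := by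
    have := Finset.le_card_sdiff Z A; omega
  have c3 : (B \ L).card ≤ B.card := Finset.card_le_card Finset.sdiff_subset
  have c4 : B.card ≤ (B \ L).card + L.card := by
    have := Finset.le_card_sdiff L B; omega
  have c5 := card_slice (V := V) (N := M + 1) s.1 0
  have c6 := card_slice (V := V) (N := M + 1) s.1 (Fin.last M)
  have e1 : cnt (M + 1) (ltr s * x) E = A.card := rfl
  have e2 : cnt (M + 1) x ((ltr s)⁻¹ • E) = B.card := rfl
  rw [e1, e2, ← mul_sub, abs_mul]
  have d : |(A.card : ℤ) - B.card| ≤ Z.card := by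
    have : Z.card = L.card := Nat.eq_of_mul_eq_mul_left hN (c5.trans c6.symm)
    rw [abs_le]; omega
  calc _ ≤ |((M + 1 : ℕ) : ℤ)| * Z.card := by gcongr
    _ = _ := by rw [abs_of_nonneg (by positivity)]; exact_mod_cast c5

theorem cnt_ltr_mul {N : ℕ} (hN : 0 < N) (s : V × Bool) (x : RAAG Γ) (E : Set (RAAG Γ)) :
    |(N * cnt N (ltr s * x) E : ℤ) - N * cnt N x ((ltr s : RAAG Γ)⁻¹ • E)| ≤ N ^ Fintype.card V := by
  by_cases hs : ew (linv s) ∈ W x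
  · have h1 : ew (linv (linv s)) ∉ W (ltr s * x) := by
      have := linv_notMem hs
      rwa [ltr_linv, inv_inv] at this
    have h2 := cnt_ltr_mul_aux hN h1 ((ltr s : RAAG Γ)⁻¹ • E)
    rw [ltr_linv, inv_inv, smul_inv_smul, inv_mul_cancel_left, abs_sub_comm] at h2
    exact h2
  · exact cnt_ltr_mul_aux hN hs E

theorem cnt_mul {N : ℕ} (hN : 0 < N) (h x : RAAG Γ) (E : Set (RAAG Γ)) :
    |(N * cnt N (h * x) E : ℤ) - N * cnt N x (h⁻¹ • E)| ≤ len h * N ^ Fintype.card V := by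
  induction h using reduced_induction generalizing E with
  | one => simp
  | step s h hs ih =>
    have h1 := cnt_ltr_mul hN s (h * x) E
    have h2 := ih ((ltr s : RAAG Γ)⁻¹ • E)
    rw [len_ltr_mul hs, mul_assoc, mul_inv_rev, mul_smul]
    push_cast
    calc _ ≤ _ := abs_sub_le _ _ _
      _ ≤ _ := add_le_add h1 h2
      _ = _ := by ring

end Geometry5

section Geometry6
variable {V : Type} {Γ : SimpleGraph V}

open Classical in
/-- Exponent sum of a vertex. -/
noncomputable def expo (v : V) : RAAG Γ →* Multiplicative ℤ :=
  raagLift (fun w => if w = v then Multiplicative.ofAdd 1 else 1) fun _ _ _ => mul_comm _ _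

open Classical in
theorem expo_gen (v w : V) :
    expo v (gen Γ w) = if w = v then Multiplicative.ofAdd 1 else 1 := by
  simp [expo]

theorem expo_eq_one {v : V} {S : Set V} (hv : v ∉ S) {x : RAAG Γ} (hx : x ∈ standardSub Γ S) :
    expo v x = 1 := by
  have : standardSub Γ S ≤ (expo v : RAAG Γ →* _).ker := by
    rw [standardSub, Subgroup.closure_le]
    rintro _ ⟨w, hw, rfl⟩
    rw [SetLike.mem_coe, MonoidHom.mem_ker, expo_gen, if_neg]
    rintro rfl; exact hv hw
  exact this hx

/-- A set of pairwise adjacent vertices. -/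
def Clq (Γ : SimpleGraph V) (M : Set V) : Prop := ∀ u ∈ M, ∀ v ∈ M, u ≠ v → Γ.Adj u v

theorem Clq.commute {M : Set V} (hM : Clq Γ M) {x y : RAAG Γ} (hx : x ∈ standardSub Γ M)
    (hy : y ∈ standardSub Γ M) : Commute x y := by
  have h1 : ∀ u ∈ M, ∀ v ∈ M, Commute (gen Γ u) (gen Γ v) := fun u hu v hv => by
    by_cases h : u = v
    · rw [h]
    · exact gen_comm (hM u hu v hv h)
  have h2 : standardSub Γ M ≤ Subgroup.centralizer (standardSub Γ M : Set (RAAG Γ)) := by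
    rw [standardSub, Subgroup.centralizer_closure, Subgroup.closure_le]
    rintro _ ⟨u, hu, rfl⟩
    rw [SetLike.mem_coe, Subgroup.mem_centralizer_iff]
    rintro _ ⟨v, hv, rfl⟩
    exact h1 v hv u hu
  exact (Subgroup.mem_centralizer_iff.1 (h2 hy) x hx)

theorem exists_mem_wall {S : Set V} {t : RAAG Γ} (ht : t ∈ standardSub Γ S) :
    ∀ e ∈ W t, e.1 ∈ S ∧ ∃ g ∈ standardSub Γ S, e = g • wall Γ e.1 := by
  intro e he
  refine ⟨mem_standardSub.1 ht e he, ?_⟩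
  induction ht using Subgroup.closure_induction generalizing e with
  | mem x hx =>
    obtain ⟨v, hv, rfl⟩ := hx
    have h1 : e ∈ W (ltr (v, true) : RAAG Γ) := by simpa [ltr] using he
    rw [W_ltr] at h1
    have h2 : e = wall Γ v := by simpa [ew] using h1
    subst h2
    exact ⟨1, one_mem _, by simp⟩
  | one => simp at he
  | mul x y hx hy ihx ihy =>
    rw [mem_W_mul] at he
    rcases he with he | he
    · exact ihx e he.1
    · obtain ⟨g, hg, h⟩ := ihy _ he.2
      refine ⟨x * g, mul_mem hx hg, ?_⟩
      rw [mul_smul, ← inv_smul_eq_iff]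
      exact h
  | inv x hx ih =>
    rw [mem_W_inv] at he
    obtain ⟨g, hg, h⟩ := ih _ he
    refine ⟨x⁻¹ * g, mul_mem (inv_mem hx) hg, ?_⟩
    rw [mul_smul, eq_inv_smul_iff]
    exact h

theorem exists_full [Finite V] (M : Set V) :
    ∃ u ∈ standardSub Γ M, ∀ v ∈ M, expo v u = Multiplicative.ofAdd 1 := by
  induction M, M.toFinite using Set.Finite.induction_on with
  | empty => exact ⟨1, one_mem _, by simp⟩
  | @insert a S ha _ ih =>
    obtain ⟨u, hu, h⟩ := ih
    refine ⟨u * gen Γ a, mul_mem (standardSub_mono (Set.subset_insert _ _) hu)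
      (gen_mem (Set.mem_insert _ _)), ?_⟩
    rintro v (rfl | hv)
    · rw [map_mul, expo_eq_one ha hu, expo_gen, if_pos rfl, one_mul]
    · rw [map_mul, h v hv, expo_gen, if_neg, mul_one]
      rintro rfl; exact ha hv

theorem smul_wall_injective {M : Set V} {u : RAAG Γ}
    (hexp : ∀ v ∈ M, expo v u = Multiplicative.ofAdd 1) {g : RAAG Γ} {v : V} (hv : v ∈ M) : Function.Injective fun k : ℕ => u ^ k • g • wall Γ v := by
  intro k l h
  simp only [← mul_smul, smul_wall_eq_iff] at h
  have h1 := expo_eq_one (v := v) (Γ.irrefl) h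
  simp only [map_mul, map_inv, map_pow, hexp v hv] at h1
  have h2 : (k : ℤ) = l := by
    apply Multiplicative.ofAdd.injective
    rw [← mul_one (k : ℤ), ← mul_one (l : ℤ), ← nsmul_eq_mul, ← nsmul_eq_mul, ofAdd_nsmul,
      ofAdd_nsmul]
    rw [inv_mul_eq_one, mul_comm, mul_comm _ (expo v g)] at h1
    exact mul_left_cancel (by rw [← h1, mul_comm])
  exact_mod_cast h2

open Classical in
theorem cnt_congr [Fintype V] {N : ℕ} {x y : RAAG Γ}
    (h : ∀ n : V → Fin N, tr (bd n) x = tr (bd n) y) {E : Set (RAAG Γ)} :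
    cnt N x E = cnt N y E :=
  congrArg Finset.card (Finset.filter_congr fun n _ => by rw [h])

theorem folner [Fintype V] {M : Set V} (hM : Clq Γ M) {F : Set (RAAG Γ)} (hF : F.Finite)
    (hFM : ∀ t ∈ F, t ∈ standardSub Γ M) {N : ℕ} (hN : 0 < N) {R : ℕ}
    (hR : ∀ t ∈ F, len t ≤ R) :
    ∃ x : RAAG Γ, ∀ t ∈ F, ∀ E : Set (RAAG Γ),
      |(N * cnt N x (t⁻¹ • E) : ℤ) - N * cnt N x E| ≤ R * N ^ Fintype.card V := by
  obtain ⟨u, hu, hexp⟩ := exists_full (Γ := Γ) M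
  have hfin : (⋃ e ∈ ⋃ t ∈ F, W t, {k : ℕ | u ^ k • e ∈ ballWalls Γ (Fintype.card V * N)}).Finite := by
    refine Set.Finite.biUnion (hF.biUnion fun t _ => finite_W t) fun e he => ?_
    simp only [Set.mem_iUnion] at he
    obtain ⟨t, ht, he⟩ := he
    obtain ⟨h1, g, -, h2⟩ := exists_mem_wall (hFM t ht) e he
    refine Set.Finite.preimage ?_ (finite_ballWalls _)
    rw [h2]
    exact (smul_wall_injective hexp h1).injOn
  obtain ⟨k, hk⟩ := hfin.exists_notMem
  refine ⟨u ^ k, fun t ht E => ?_⟩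
  have hmove : ∀ e ∈ W t, u ^ k • e ∉ ballWalls Γ (Fintype.card V * N) := fun e he h => by
    refine hk ?_
    simp only [Set.mem_iUnion]
    exact ⟨e, ⟨t, ht, he⟩, h⟩
  have h1 : ∀ n : V → Fin N, tr (bd n) (t * u ^ k) = tr (bd n) (u ^ k) := fun n => by
    rw [(hM.commute (hFM t ht) (pow_mem hu k)).eq]
    exact tr_mul_right fun e he =>
      ⟨fun h => hmove e he (W_tr_subset n _ h), fun h => hmove e he (W_tr_subset n _ h)⟩
  have h2 : cnt N (t * u ^ k) E = cnt N (u ^ k) E := by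
    exact cnt_congr h1
  have h3 := cnt_mul hN t (u ^ k) E
  rw [h2, abs_sub_comm] at h3
  refine h3.trans ?_
  gcongr
  exact_mod_cast hR t ht

/-- A pair of elements exhibiting a paradoxical decomposition. -/
def Paradox {K : Type} [Group K] (a c : K) : Prop :=
  ∃ A₁ A₂ C₁ C₂ : Set K, Disjoint A₁ A₂ ∧ Disjoint C₁ C₂ ∧ Disjoint (A₁ ∪ A₂) (C₁ ∪ C₂) ∧
    (∀ g, g ∈ A₁ ∨ a⁻¹ * g ∈ A₂) ∧ ∀ g, g ∈ C₁ ∨ c⁻¹ * g ∈ C₂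

theorem Paradox.map {K L : Type} [Group K] [Group L] {a c : K} (h : Paradox a c) (e : K ≃* L) :
    Paradox (e a) (e c) := by
  obtain ⟨A₁, A₂, C₁, C₂, h1, h2, h3, h4, h5⟩ := h
  refine ⟨e.symm ⁻¹' A₁, e.symm ⁻¹' A₂, e.symm ⁻¹' C₁, e.symm ⁻¹' C₂, h1.preimage _,
    h2.preimage _, h3.preimage _, fun g => ?_, fun g => ?_⟩
  · simpa using h4 (e.symm g)
  · simpa using h5 (e.symm g)

theorem adj_of_two_letters {s t : V × Bool} (hst : s ≠ t) {z : RAAG Γ} (hs : ew s ∈ W z)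
    (ht : ew t ∈ W z) : Γ.Adj s.1 t.1 := by
  have h := cross4 (Γ := Γ) (p := ltr s) (q := ltr t) (z := z) (e := ew s) (e' := ew t)
    (by rw [W_ltr]; rfl) (by rw [W_ltr]; exact fun h => hst (ew_injective h))
    (by rw [W_ltr]; rfl) (by rw [W_ltr]; exact fun h => hst (ew_injective h).symm) hs ht
  simpa using h

theorem paradox_gen {u v : V} (hne : u ≠ v) (h : ¬ Γ.Adj u v) : Paradox (gen Γ u) (gen Γ v) := by
  have hd : ∀ s t : V × Bool, s ≠ t → ¬ Γ.Adj s.1 t.1 →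
      Disjoint {z : RAAG Γ | ew s ∈ W z} {z | ew t ∈ W z} := fun s t hst hn =>
    Set.disjoint_left.2 fun z h1 h2 => hn (adj_of_two_letters hst h1 h2)
  have hc : ∀ w (g : RAAG Γ), g ∈ {z : RAAG Γ | ew (w, true) ∈ W z} ∨
      (gen Γ w)⁻¹ * g ∈ {z : RAAG Γ | ew (w, false) ∈ W z} := by
    intro w g
    by_cases h1 : ew (w, true) ∈ W g
    · exact Or.inl h1
    · refine Or.inr ?_
      have h2 := (W_ltr_mul (s := (w, false)) (h := g) h1).1
      simp only [ltr, Bool.false_eq_true, if_false] at h2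
      show _ ∈ W _
      rw [h2]
      exact Set.mem_insert _ _
  refine ⟨{z | ew (u, true) ∈ W z}, {z | ew (u, false) ∈ W z}, {z | ew (v, true) ∈ W z},
    {z | ew (v, false) ∈ W z}, hd _ _ (by simp) Γ.irrefl, hd _ _ (by simp) Γ.irrefl, ?_, hc u, hc v⟩
  rw [Set.disjoint_union_left, Set.disjoint_union_right, Set.disjoint_union_right]
  exact ⟨⟨hd _ _ (by simp [hne]) h, hd _ _ (by simp) h⟩, hd _ _ (by simp) h,
    hd _ _ (by simp [hne]) h⟩

end Geometry6

section Geometry7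
variable {V : Type} {Γ : SimpleGraph V}

theorem mem_star_comm {u v : V} : u ∈ star Γ v ↔ v ∈ star Γ u := by
  simp [star, eq_comm, SimpleGraph.adj_comm]

theorem standardSub_empty {x : RAAG Γ} (h : x ∈ standardSub Γ ∅) : x = 1 := by
  rw [mem_standardSub] at h
  exact W_eq_empty.1 (Set.eq_empty_iff_forall_notMem.2 fun e he => h e he)

/-- A vertex with maximal star. -/
def MaxStar (Γ : SimpleGraph V) (b : V) : Prop := ∀ b', star Γ b ⊆ star Γ b' → star Γ b' ⊆ star Γ b

/-- An element whose centralizer is maximal among centralizers. -/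
def MaxElt {G : Type} [Group G] (x : G) : Prop :=
  ∀ y, y ≠ 1 → (∀ p, Commute p x → Commute p y) → ∀ g, Commute g y → Commute g x

theorem MaxStar.maxElt {b : V} (hb : MaxStar Γ b) : MaxElt (gen Γ b) := by
  intro β hβ h g hg
  set K : Set V := {w | star Γ w = star Γ b} with hK
  have hbK : β ∈ standardSub Γ K := by
    rw [mem_standardSub]
    intro e he
    have h1 : star Γ b ⊆ star Γ e.1 := fun v hv => by
      have h2 : Commute β (gen Γ v) :=
        (h _ ((centralizer_gen).2 (gen_mem hv))).symm
      exact mem_star_comm.1 (mem_standardSub.1 (centralizer_gen.1 h2) e he)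
    exact Set.Subset.antisymm (hb _ h1) h1
  have hKb : K ⊆ star Γ b := fun w hw => by
    rw [← show star Γ w = star Γ b from hw]; exact Set.mem_insert _ _
  have hclq : Clq Γ K := fun u hu v hv huv => by
    have h1 : u ∈ star Γ v := (show star Γ v = star Γ b from hv).symm ▸ hKb hu
    rcases h1 with h1 | h1
    · exact absurd h1 huv
    · exact SimpleGraph.Adj.symm h1
  obtain ⟨a, ha, U, hU, -, hiff⟩ := parabolic_inter K K g
  have h1 : a⁻¹ * β * a ∈ standardSub Γ U := by
    refine (hiff β).1 ⟨hbK, ?_⟩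
    rwa [mul_assoc, ← hg.eq, inv_mul_cancel_left]
  have hne : U.Nonempty := by
    by_contra h2
    rw [Set.not_nonempty_iff_eq_empty] at h2
    subst h2
    have h3 := standardSub_empty h1
    apply hβ
    rw [mul_assoc, inv_mul_eq_one] at h3
    exact (mul_eq_right.1 h3.symm)
  obtain ⟨w, hw⟩ := hne
  have h2 : g⁻¹ * gen Γ w * g ∈ standardSub Γ K := by
    refine ((hiff (gen Γ w)).2 ?_).2
    rw [mul_assoc, (hclq.commute (gen_mem (hU hw)) ha).eq, inv_mul_cancel_left]
    exact gen_mem hw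
  obtain ⟨-, a', ha', c', hc', d', hd', rfl⟩ := parabolic_le (S := {w}) (T := K) (g := g)
    fun p hp => conj_mem_of_closure (S := {w}) (fun s hs => by rw [Set.mem_singleton_iff.1 hs]; exact h2) hp
  have hwb : star Γ w = star Γ b := hU hw
  rw [centralizer_gen]
  refine mul_mem (mul_mem ?_ ?_) (standardSub_mono hKb hd')
  · exact standardSub_mono (Set.singleton_subset_iff.2 (hKb (hU hw))) ha'
  · refine standardSub_mono (fun v hv => ?_) hc'
    rw [← hwb]
    exact Or.inr ((hv w rfl).symm)

theorem star_subset_of_conj {b b' : V} {k : RAAG Γ}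
    (h : ∀ p, Commute p (gen Γ b) → Commute (k⁻¹ * p * k) (gen Γ b')) : star Γ b ⊆ star Γ b' :=
  (parabolic_le (g := k) fun p hp => centralizer_gen.1 (h p (centralizer_gen.2 hp))).1

theorem exists_pair [Finite V] (hc : Γ.Connected) (hu : ∀ v, star Γ v ≠ Set.univ) :
    ∃ b b', Γ.Adj b b' ∧ MaxStar Γ b ∧ MaxStar Γ b' ∧ star Γ b ≠ star Γ b' ∧
      ¬ Clq Γ (Γ.neighborSet b) ∧ ¬ Clq Γ (Γ.neighborSet b') := by
  have hmax : ∀ u, ∃ b, star Γ u ⊆ star Γ b ∧ MaxStar Γ b := by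
    intro u
    obtain ⟨b, hb, hb2⟩ := Set.exists_max_image {b | star Γ u ⊆ star Γ b}
      (fun b => (star Γ b).ncard) (Set.toFinite _) ⟨u, Set.Subset.refl _⟩
    refine ⟨b, hb, fun b' h => ?_⟩
    exact (Set.eq_of_subset_of_ncard_le h (hb2 b' (Set.Subset.trans hb h))).superset
  obtain ⟨u₀⟩ := hc.nonempty
  obtain ⟨b, -, hb⟩ := hmax u₀
  obtain ⟨x, hx⟩ := (Set.ne_univ_iff_exists_notMem _).1 (hu b)
  obtain ⟨u, t, hut, hub, htb⟩ : ∃ u t, Γ.Adj u t ∧ u ∈ star Γ b ∧ t ∉ star Γ b := by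
    obtain ⟨p⟩ := hc.preconnected b x
    obtain ⟨d, -, h1, h2⟩ := p.exists_boundary_dart (star Γ b) (Set.mem_insert _ _) hx
    exact ⟨d.fst, d.snd, d.adj, h1, h2⟩
  obtain ⟨b', hub', hb'⟩ := hmax u
  have hne : star Γ b ≠ star Γ b' := fun h => htb (h ▸ hub' (Or.inr hut))
  have hadj : Γ.Adj b b' := by
    have h1 : b ∈ star Γ b' := hub' (mem_star_comm.1 hub)
    rcases h1 with h1 | h1
    · exact absurd (by rw [h1]) hne
    · exact SimpleGraph.Adj.symm h1
  have hclq : ∀ {b b'}, Γ.Adj b b' → Clq Γ (Γ.neighborSet b) → star Γ b ⊆ star Γ b' := by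
    rintro b b' h h1 w (rfl | hw)
    · exact Or.inr h.symm
    · by_cases h2 : w = b'
      · exact Or.inl h2
      · exact Or.inr (h1 _ h _ hw (Ne.symm h2))
  refine ⟨b, b', hadj, hb, hb', hne, fun h => ?_, fun h => ?_⟩
  · have h1 := hclq hadj h
    exact hne (Set.Subset.antisymm h1 (hb _ h1))
  · have h1 := hclq hadj.symm h
    exact hne (Set.Subset.antisymm (hb' _ h1) h1)

/-- The consequence of the assumption on maximal join parabolic subgroups that is used. -/
def JoinCentral (Γ : SimpleGraph V) : Prop :=
  ∀ T : Set V, T.Nonempty → (lk Γ T).Nonempty →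
    ∃ β : RAAG Γ, β ≠ 1 ∧ ∀ p ∈ standardSub Γ (T ∪ lk Γ T), Commute p β

theorem joinCentral_of_max [Finite V]
    (hmax : ∀ P : Subgroup (RAAG Γ), IsMaxJoinParabolic Γ P → ∃ x ∈ subCenter P, x ≠ 1) :
    JoinCentral Γ := by
  intro T h1 h2
  have hj : IsJoin Γ (T ∪ lk Γ T) := ⟨T, lk Γ T, h1, h2, rfl, fun u hu v hv => (hv u hu).symm⟩
  obtain ⟨S, hS, hS2⟩ := Set.exists_max_image {S | IsJoin Γ S ∧ T ∪ lk Γ T ⊆ S} Set.ncard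
    (Set.toFinite _) ⟨_, hj, Set.Subset.refl _⟩
  obtain ⟨x, hx, hx1⟩ := hmax (conjSub 1 (standardSub Γ S)) ⟨1, S, ⟨hS.1, fun S' hS' h =>
    Set.eq_of_subset_of_ncard_le h (hS2 S' ⟨hS', hS.2.trans h⟩)⟩, rfl⟩
  refine ⟨x, hx1, fun p hp => (hx.2 p ?_).symm⟩
  exact ⟨p, standardSub_mono hS.2 hp, by simp⟩

end Geometry7

section Ends
variable {G A : Type} [Group G] [AddCommGroup A]

/-- A finitely supported cocycle is a coboundary on commuting independent elements. -/
theorem exists_fixed {c : G → G → A} (hc : ∀ g h e, c (g * h) e = c g e + c h (g⁻¹ * e))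
    (hfin : ∀ g, (Function.support (c g)).Finite) {u w : G} (huw : Commute u w)
    (hu : ∀ k : ℕ, 0 < k → u ^ k ≠ 1) (hw : ∀ j : ℕ, 0 < j → w ^ j ∉ Subgroup.zpowers u) :
    ∃ f : G → A, (Function.support f).Finite ∧ (∀ e, f e = c u e + f (u⁻¹ * e)) ∧
      ∀ e, f e = c w e + f (w⁻¹ * e) := by
  have hinj : ∀ e : G, Function.Injective fun k : ℕ => u ^ k * e := fun e =>
    (mul_left_injective e).comp
      (injective_pow_iff_not_isOfFinOrder.2 fun h => by
        obtain ⟨n, hn, h1⟩ := isOfFinOrder_iff_pow_eq_one.1 h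
        exact hu n hn h1)
  have hinj' : ∀ e : G, Function.Injective fun k : ℕ => (u ^ k)⁻¹ * e := fun e =>
    (mul_left_injective e).comp (inv_injective.comp fun k l h => hinj 1 (by simpa using h))
  have hev : ∀ g e, ∀ᶠ k : ℕ in Filter.atTop, c g (u ^ k * e) = 0 := fun g e => by
    have := (hfin g).preimage (hinj e).injOn
    rw [← Nat.cofinite_eq_atTop]
    filter_upwards [this.compl_mem_cofinite] with k hk
    simpa using hk
  have hev' : ∀ g e, ∀ᶠ k : ℕ in Filter.atTop, c g ((u ^ k)⁻¹ * e) = 0 := fun g e => by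
    have := (hfin g).preimage (hinj' e).injOn
    rw [← Nat.cofinite_eq_atTop]
    filter_upwards [this.compl_mem_cofinite] with k hk
    simpa using hk
  have hlim : ∀ e, ∃ a, ∀ᶠ n : ℕ in Filter.atTop, c (u ^ n) e = a := by
    intro e
    obtain ⟨N, hN⟩ := Filter.eventually_atTop.1 (hev' u e)
    refine ⟨c (u ^ N) e, Filter.eventually_atTop.2 ⟨N, fun n hn => ?_⟩⟩
    induction n, hn using Nat.le_induction with
    | base => rfl
    | succ n hn ih => rw [pow_succ, hc, hN n hn, add_zero, ih]
  choose f hf using hlim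
  have hfu : ∀ e, f e = c u e + f (u⁻¹ * e) := fun e => by
    obtain ⟨n, h1, h2⟩ := (((Filter.tendsto_add_atTop_nat 1).eventually (hf e)).and
      (hf (u⁻¹ * e))).exists
    rw [← h1, ← h2, pow_succ', hc]
  have hfw : ∀ e, f e = c w e + f (w⁻¹ * e) := fun e => by
    obtain ⟨n, ⟨h1, h2⟩, h3⟩ := (((hf e).and (hf (w⁻¹ * e))).and (hev' w e)).exists
    have h4 := hc w (u ^ n) e
    rw [← (huw.pow_left n).eq, hc, h3, add_zero] at h4
    rw [← h1, ← h2, h4]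
  have hfwj : ∀ (j : ℕ) e, f e = c (w ^ j) e + f ((w ^ j)⁻¹ * e) := by
    intro j
    induction j with
    | zero =>
      intro e
      have := hc 1 1 e
      simp at this
      simp [this]
    | succ j ih =>
      intro e
      rw [ih e, pow_succ, hc, hfw ((w ^ j)⁻¹ * e)]
      simp only [mul_inv_rev, mul_assoc, add_assoc]
  refine ⟨f, ?_, hfu, hfw⟩
  have hsupp : ∀ e, f e ≠ 0 → ∃ κ ∈ Function.support (c u), ∃ k : ℕ, e = u ^ k * κ := by
    intro e he
    by_contra! h
    apply he
    obtain ⟨n, hn⟩ := (hf e).exists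
    rw [← hn]
    clear hn
    induction n with
    | zero =>
      have := hc 1 1 e
      simp at this
      simpa using this
    | succ n ih =>
      rw [pow_succ, hc, ih, zero_add]
      by_contra h1
      exact h _ h1 n (by simp)
  have hzero : ∀ κ, ∀ᶠ k : ℕ in Filter.atTop, f (u ^ k * κ) = 0 := by
    intro κ
    obtain ⟨j, hj⟩ : ∃ j : ℕ, ∀ κ' ∈ Function.support (c u), ∀ k l : ℕ,
        (w ^ j)⁻¹ * (u ^ k * κ) ≠ u ^ l * κ' := by
      by_contra! h
      choose κ' hκ' k l hkl using h
      obtain ⟨i, j, hij, h1⟩ : ∃ i j, i < j ∧ κ' i = κ' j := by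
        have := (hfin u).exists_lt_map_eq_of_forall_mem (f := κ') hκ'
        exact this
      refine hw (j - i) (by omega) ?_
      have e1 : ∀ n, w ^ n * (u ^ l n * κ' n) = u ^ k n * κ := fun n => by rw [← hkl n]; simp
      have e2 : ∀ n, w ^ n = u ^ k n * κ * (κ' n)⁻¹ * (u ^ l n)⁻¹ := fun n => by
        rw [← e1 n]; group
      have e3 : w ^ (j - i) = (w ^ i)⁻¹ * w ^ j := by
        rw [eq_inv_mul_iff_mul_eq, ← pow_add]; congr 1; omega
      have e4 : (w ^ i)⁻¹ * w ^ j = w ^ j * (w ^ i)⁻¹ := by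
        exact (((Commute.refl w).pow_pow i j).inv_left).eq
      have e5 : w ^ (j - i) = u ^ k j * (u ^ l j)⁻¹ * (u ^ l i * (u ^ k i)⁻¹) := by
        have e6 : w ^ j * u ^ l j = u ^ k j * κ * (κ' j)⁻¹ := by rw [e2 j]; group
        have e7 : w ^ i * u ^ l i = u ^ k i * κ * (κ' j)⁻¹ := by rw [e2 i, h1]; group
        have e8 : w ^ j = u ^ k j * (κ * (κ' j)⁻¹) * (u ^ l j)⁻¹ := by
          rw [← mul_assoc, ← e6]; group
        have e9 : κ * (κ' j)⁻¹ = (u ^ k i)⁻¹ * (w ^ i * u ^ l i) := by rw [e7]; group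
        rw [e3, e4, e8, e9]
        have cw : ∀ a b : ℕ, Commute (w ^ a) (u ^ b) := fun a b => (huw.symm).pow_pow a b
        have cu : ∀ a b : ℕ, Commute (u ^ a) (u ^ b) := fun a b => (Commute.refl u).pow_pow a b
        have p1 : (u ^ k i)⁻¹ * (w ^ i * u ^ l i) = w ^ i * ((u ^ k i)⁻¹ * u ^ l i) := by
          rw [← mul_assoc, ← mul_assoc, ((cw i (k i)).symm.inv_left).eq]
        rw [p1]
        have p2 : Commute (w ^ i) (u ^ k j) := cw _ _
        have p3 : ∀ z, u ^ k j * (w ^ i * z) = w ^ i * (u ^ k j * z) := fun z => by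
          rw [← mul_assoc, ← p2.eq, mul_assoc]
        rw [p3]
        have p4 : Commute (w ^ i) (u ^ k j * ((u ^ k i)⁻¹ * u ^ l i) * (u ^ l j)⁻¹) :=
          ((cw i _).mul_right (((cw i _).inv_right).mul_right (cw i _))).mul_right
            ((cw i _).inv_right)
        rw [mul_assoc (w ^ i), p4.eq, mul_inv_cancel_right]
        have p5 : (u ^ k i)⁻¹ * u ^ l i = u ^ l i * (u ^ k i)⁻¹ := ((cu (k i) (l i)).inv_left).eq
        rw [p5, mul_assoc, mul_assoc, mul_assoc]
        congr 1
        rw [← mul_assoc]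
        exact (((cu (l i) (l j)).inv_right).mul_left
          (((cu (k i) (l j)).inv_right).inv_left)).eq
      rw [e5]
      have m : ∀ n : ℕ, u ^ n ∈ Subgroup.zpowers u := fun n => pow_mem (Subgroup.mem_zpowers u) n
      exact mul_mem (mul_mem (m _) (inv_mem (m _))) (mul_mem (m _) (inv_mem (m _)))
    filter_upwards [hev (w ^ j) κ] with k hk
    rw [hfwj j, hk, zero_add]
    by_contra h1
    obtain ⟨κ', h2, l, h3⟩ := hsupp _ h1
    exact hj κ' h2 k l h3
  have : Function.support f ⊆
      ⋃ κ ∈ Function.support (c u), (fun k : ℕ => u ^ k * κ) '' {k | f (u ^ k * κ) ≠ 0} := by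
    intro e he
    obtain ⟨κ, h1, k, rfl⟩ := hsupp e he
    exact Set.mem_biUnion h1 ⟨k, he, rfl⟩
  refine Set.Finite.subset ((hfin u).biUnion fun κ _ => Set.Finite.image _ ?_) this
  have := hzero κ
  rw [← Nat.cofinite_eq_atTop] at this
  exact this

theorem fixed_unique {c : G → G → A} {u : G} (hu : ∀ k : ℕ, 0 < k → u ^ k ≠ 1) {f f' : G → A}
    (h1 : (Function.support f).Finite) (h1' : (Function.support f').Finite)
    (h2 : ∀ e, f e = c u e + f (u⁻¹ * e)) (h2' : ∀ e, f' e = c u e + f' (u⁻¹ * e)) : f = f' := by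
  funext e
  have h3 : ∀ n : ℕ, f e - f' e = f ((u ^ n)⁻¹ * e) - f' ((u ^ n)⁻¹ * e) := by
    intro n
    induction n with
    | zero => simp
    | succ n ih =>
      rw [ih, h2, h2' ((u ^ n)⁻¹ * e), pow_succ]
      simp [mul_assoc]
  have hinj : Function.Injective fun k : ℕ => (u ^ k)⁻¹ * e :=
    (mul_left_injective e).comp (inv_injective.comp
      (injective_pow_iff_not_isOfFinOrder.2 fun h => by
        obtain ⟨n, hn, h1⟩ := isOfFinOrder_iff_pow_eq_one.1 h
        exact hu n hn h1))
  obtain ⟨n, hn⟩ := ((h1.union h1').preimage hinj.injOn).exists_notMem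
  simp only [Set.mem_preimage, Set.mem_union, Function.mem_support, not_or, not_not] at hn
  rw [← sub_eq_zero, h3 n, hn.1, hn.2, sub_zero]

end Ends

section Transfer
variable {V V' : Type} {Γ : SimpleGraph V} {Δ : SimpleGraph V'}

theorem expo_gen_pow (v : V) (n : ℕ) : expo v (gen Γ v ^ n) = Multiplicative.ofAdd (n : ℤ) := by
  rw [map_pow, expo_gen, if_pos rfl, ← ofAdd_nsmul]; simp

theorem gen_ne_one (v : V) : gen Γ v ≠ 1 := by
  intro h
  have := expo_gen_pow (Γ := Γ) v 1
  rw [h] at this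
  simp at this
  exact absurd this (by decide)

theorem gen_pow_notMem_zpowers {u w : V} (h : u ≠ w) {j : ℕ} (hj : 0 < j) :
    gen Γ w ^ j ∉ Subgroup.zpowers (gen Γ u) := by
  rintro ⟨k, hk⟩
  have h1 := congrArg (expo w) hk
  rw [expo_gen_pow] at h1
  simp only [map_zpow, expo_gen, if_neg h, one_zpow] at h1
  have : (j : ℤ) = 0 := Multiplicative.ofAdd.injective h1.symm
  omega

theorem connected_of_equiv (hc : Γ.Connected) [Nontrivial V] (e : RAAG Δ ≃* RAAG Γ) :
    Δ.Connected := by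
  classical
  have hne : Nonempty V' := by
    by_contra h
    rw [not_nonempty_iff] at h
    obtain ⟨v⟩ := hc.nonempty
    apply gen_ne_one (Γ := Γ) v
    have h1 : (⊤ : Subgroup (RAAG Δ)) = ⊥ := by
      rw [← raag_closure, Set.range_eq_empty, Subgroup.closure_empty]
    have h2 : e.symm (gen Γ v) ∈ (⊤ : Subgroup (RAAG Δ)) := trivial
    rw [h1, Subgroup.mem_bot] at h2
    simpa using h2
  refine { preconnected := ?_, nonempty := hne }
  by_contra hcon
  simp only [SimpleGraph.Preconnected, not_forall] at hcon
  obtain ⟨x, y, hxy⟩ := hcon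
  set d : V' → RAAG Δ → ℤ := fun v z => if Δ.Reachable x v then 0 else
    (if z = 1 then 1 else 0) - if z = gen Δ v then 1 else 0 with hd
  have hadj : ∀ u v, Δ.Adj u v → (Δ.Reachable x u ↔ Δ.Reachable x v) := fun u v h =>
    ⟨fun h1 => h1.trans h.reachable, fun h1 => h1.trans h.symm.reachable⟩
  obtain ⟨c, hc1, hc2⟩ := exists_crossed (Γ := Δ) (Ω := RAAG Δ) d (by
    intro u v h z
    have e1 : ((gen Δ u)⁻¹ * z = 1) = (z = gen Δ u) := propext (by rw [inv_mul_eq_one, eq_comm])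
    have e2 : ((gen Δ v)⁻¹ * z = 1) = (z = gen Δ v) := propext (by rw [inv_mul_eq_one, eq_comm])
    have e3 : ((gen Δ u)⁻¹ * z = gen Δ v) = (z = gen Δ u * gen Δ v) :=
      propext (by rw [inv_mul_eq_iff_eq_mul])
    have e4 : ((gen Δ v)⁻¹ * z = gen Δ u) = (z = gen Δ u * gen Δ v) :=
      propext (by rw [inv_mul_eq_iff_eq_mul, gen_comm h])
    by_cases hv : Δ.Reachable x v
    · simp only [hd, hadj u v h, hv, if_true]
    · simp only [hd, hadj u v h, hv, if_false, smul_eq_mul, e1, e2, e3, e4]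
      ring)
  have hfin : ∀ g, (Function.support (c g)).Finite := by
    have hgen : ∀ v, (Function.support (c (gen Δ v))).Finite := fun v => by
      rw [hc1]
      refine (Set.toFinite {1, gen Δ v}).subset fun z hz => ?_
      by_contra h
      simp only [Set.mem_insert_iff, Set.mem_singleton_iff, not_or] at h
      simp [hd, h.1, h.2] at hz
    have hmul : ∀ g h, (Function.support (c g)).Finite → (Function.support (c h)).Finite →
        (Function.support (c (g * h))).Finite := fun g h h1 h2 => by
      refine (h1.union (h2.image (g * ·))).subset fun z hz => ?_
      by_contra h3
      simp only [Set.mem_union, Function.mem_support, not_or, not_not, Set.mem_image] at h3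
      apply hz
      rw [hc2, h3.1, zero_add]
      by_contra h4
      exact h3.2 ⟨g⁻¹ * z, h4, by simp⟩
    have hone : ∀ z, c 1 z = 0 := fun z => by
      have := hc2 1 1 z
      simpa using this
    have hinv : ∀ g, (Function.support (c g)).Finite → (Function.support (c g⁻¹)).Finite :=
      fun g h => by
      refine (h.image (g⁻¹ * ·)).subset fun z hz => ⟨g * z, ?_, by simp⟩
      have := hc2 g⁻¹ g z
      rw [inv_mul_cancel, hone] at this
      intro h4
      apply hz
      rw [inv_inv, smul_eq_mul, h4, add_zero] at this
      exact this.symm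
    intro g
    induction g using raag_induction with
    | one => rw [show Function.support (c 1) = ∅ by ext z; simp [hone]]; exact Set.finite_empty
    | mul g v ih => exact hmul _ _ ih (hgen v)
    | mul_inv g v ih => exact hmul _ _ ih (hinv _ (hgen v))
  have htf : ∀ v : V, ∀ k : ℕ, 0 < k → (e.symm (gen Γ v)) ^ k ≠ 1 := fun v k hk h => by
    apply gen_ne_one (Γ := Γ) v
    simpa using torsion_free hk h
  set Fix : V → (RAAG Δ → ℤ) → Prop := fun v f => (Function.support f).Finite ∧
    ∀ z, f z = c (e.symm (gen Γ v)) z + f ((e.symm (gen Γ v))⁻¹ * z) with hFix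
  have huniq : ∀ v f f', Fix v f → Fix v f' → f = f' := fun v f f' h h' =>
    fixed_unique (htf v) h.1 h'.1 h.2 h'.2
  have hex : ∀ u w, Γ.Adj u w → ∃ f, Fix u f ∧ Fix w f := fun u w h => by
    obtain ⟨f, h1, h2, h3⟩ := exists_fixed (c := c) hc2 hfin (u := e.symm (gen Γ u))
      (w := e.symm (gen Γ w)) (by
        have := gen_comm h
        rw [Commute, SemiconjBy, ← map_mul, this, map_mul]) (htf u) (fun j hj hmem => by
        rw [← map_pow] at hmem
        obtain ⟨k, hk⟩ := hmem
        have h2 : e.symm (gen Γ u ^ k) = e.symm (gen Γ w ^ j) := by rw [← hk, map_zpow]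
        exact gen_pow_notMem_zpowers h.ne hj ⟨k, e.symm.injective h2⟩)
    exact ⟨f, ⟨h1, h2⟩, h1, h3⟩
  obtain ⟨u₀⟩ := hc.nonempty
  obtain ⟨u₁, hu₁⟩ : ∃ u₁, Γ.Adj u₀ u₁ := by
    obtain ⟨u', hu'⟩ := exists_ne u₀
    obtain ⟨d, -, h1, h2⟩ := (hc.preconnected u₀ u').some.exists_boundary_dart {u₀} rfl hu'
    exact ⟨d.snd, by rw [← Set.mem_singleton_iff.1 h1]; exact d.adj⟩
  obtain ⟨f, hf, -⟩ := hex u₀ u₁ hu₁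
  have hall : ∀ v, Fix v f := by
    have hw : ∀ {a b : V}, Γ.Walk a b → Fix a f → Fix b f := by
      intro a b p
      induction p with
      | nil => exact id
      | @cons a b _ h p ih =>
        intro ha
        obtain ⟨f', h1, h2⟩ := hex a b h
        exact ih (huniq _ _ _ ha h1 ▸ h2)
    exact fun v => hw (hc.preconnected u₀ v).some hf
  have hglob : ∀ g : RAAG Δ, ∀ z, f z = c g z + f (g⁻¹ * z) := by
    intro g
    obtain ⟨g, rfl⟩ := e.symm.surjective g
    have hone : ∀ z, c 1 z = 0 := fun z => by
      have := hc2 1 1 z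
      simpa using this
    have hmul : ∀ g h, (∀ z, f z = c g z + f (g⁻¹ * z)) → (∀ z, f z = c h z + f (h⁻¹ * z)) →
        ∀ z, f z = c (g * h) z + f ((g * h)⁻¹ * z) := fun g h h1 h2 z => by
      rw [hc2, h1, h2 (g⁻¹ * z), mul_inv_rev, smul_eq_mul, mul_assoc, add_assoc]
    have hinv : ∀ g, (∀ z, f z = c g z + f (g⁻¹ * z)) →
        ∀ z, f z = c g⁻¹ z + f (g⁻¹⁻¹ * z) := fun g h1 z => by
      have h3 := hc2 g⁻¹ g z
      rw [inv_mul_cancel, hone, inv_inv, smul_eq_mul] at h3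
      have h4 := h1 (g * z)
      rw [inv_mul_cancel_left] at h4
      rw [inv_inv]; omega
    induction g using raag_induction with
    | one => intro z; simp [hone]
    | mul g v ih => rw [map_mul]; exact hmul _ _ ih (hall v).2
    | mul_inv g v ih => rw [map_mul, map_inv]; exact hmul _ _ ih (hinv _ (hall v).2)
  have htf' : ∀ v : V', ∀ k : ℕ, 0 < k → (gen Δ v) ^ k ≠ 1 := fun v k hk h =>
    gen_ne_one (Γ := Δ) v (torsion_free hk h)
  have h0 : f = 0 := fixed_unique (c := c) (htf' x) (hall u₀).1 (by simp) (hglob _)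
    (by intro z; simp [hc1, hd])
  have h1 : f = Pi.single 1 1 := fixed_unique (c := c) (htf' y) (hall u₀).1
    ((Set.finite_singleton 1).subset fun z hz => by
      by_contra h
      rw [Set.mem_singleton_iff] at h
      simp [h] at hz) (hglob _) (by
      intro z
      simp only [hc1, hd, if_neg hxy, Pi.single_apply, inv_mul_eq_one, eq_comm (a := gen Δ y)]
      ring)
  have h2 := congrFun (h0.symm.trans h1) 1
  simp at h2

theorem star_ne_univ_of_equiv (hu : ∀ v, star Γ v ≠ Set.univ) (e : RAAG Δ ≃* RAAG Γ) (v : V') :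
    star Δ v ≠ Set.univ := by
  intro h
  have h1 : ∀ g, Commute g (e (gen Δ v)) := fun g => by
    have h2 : Commute (e.symm g) (gen Δ v) := centralizer_gen.2 (by rw [h, standardSub_univ]; trivial)
    simpa using h2.map e
  have h3 : e (gen Δ v) = 1 := by
    rw [← W_eq_empty, Set.eq_empty_iff_forall_notMem]
    intro w hw
    apply hu w.1
    ext u
    simp only [Set.mem_univ, iff_true]
    rw [mem_star_comm]
    exact mem_standardSub.1 (centralizer_gen.1 (h1 (gen Γ u)).symm) w hw
  exact gen_ne_one (Γ := Δ) v (by simpa using h3)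

instance [Finite V] : Countable (RAAG Γ) := by
  cases nonempty_fintype V
  have : (Set.univ : Set (RAAG Γ)) = ⋃ n : ℕ, {x | len x ≤ n} := by
    ext x; simp only [Set.mem_univ, Set.mem_iUnion, true_iff]; exact ⟨len x, le_refl (len x)⟩
  rw [← Set.countable_univ_iff, this]
  exact Set.countable_iUnion fun n => (finite_ball n).countable

end Transfer

section Measured
variable {H Z : Type} [MeasurableSpace Z] {D D' : Type}

/-- All fibres over subsets of a (discrete) target are measurable. -/
def MF (θ : Z → D) : Prop := ∀ s : Set D, MeasurableSet (θ ⁻¹' s)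

theorem MF.comp {θ : Z → D} (h : MF θ) (f : D → D') : MF fun z => f (θ z) := fun s => h (f ⁻¹' s)

theorem MF.eq {θ : Z → D} (h : MF θ) (d : D) : MeasurableSet {z | θ z = d} := h {d}

theorem MF.mem {θ : Z → D} (h : MF θ) (s : Set D) : MeasurableSet {z | θ z ∈ s} := h s

theorem MF.comp_measurable {θ : Z → D} (h : MF θ) {T : Z → Z} (hT : Measurable T) :
    MF fun z => θ (T z) := fun s => hT (h s)

theorem MF.pair [Countable D] {θ : Z → D} {θ' : Z → D'} (h : MF θ) (h' : MF θ') :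
    MF fun z => (θ z, θ' z) := fun s => by
  have : (fun z => (θ z, θ' z)) ⁻¹' s = ⋃ d : D, θ ⁻¹' {d} ∩ θ' ⁻¹' {e | (d, e) ∈ s} := by
    ext z; simp
  rw [this]
  exact MeasurableSet.iUnion fun d => (h _).inter (h' _)

theorem MF.of_fibers [Countable D] {θ : Z → D} (h : ∀ d, MeasurableSet (θ ⁻¹' {d})) : MF θ :=
  fun s => by
  rw [← Set.biUnion_preimage_singleton]
  exact MeasurableSet.biUnion s.to_countable fun d _ => h d

/-- A function selected among countably many by a countably valued map. -/
theorem MF.select [Countable D] {θ : Z → D} (h : MF θ) {f : D → Z → D'} (hf : ∀ d, MF (f d)) :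
    MF fun z => f (θ z) z := fun s => by
  have : (fun z => f (θ z) z) ⁻¹' s = ⋃ d : D, θ ⁻¹' {d} ∩ f d ⁻¹' s := by
    ext z; simp
  rw [this]
  exact MeasurableSet.iUnion fun d => (h _).inter (hf d _)

theorem tight [Countable D] {μ : Measure Z} [IsFiniteMeasure μ] {θ : Z → D} (h : MF θ)
    {ε : ℝ≥0∞} (hε : 0 < ε) : ∃ K : Set D, K.Finite ∧ μ {z | θ z ∉ K} < ε := by
  classical
  by_cases hD : Nonempty D
  swap
  · rw [not_nonempty_iff] at hD
    refine ⟨∅, Set.finite_empty, ?_⟩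
    rw [show {z | θ z ∉ (∅ : Set D)} = ∅ by
      ext z; exact (hD.false (θ z)).elim]
    simpa using hε
  obtain ⟨e, he⟩ := exists_surjective_nat D
  have ht := tendsto_measure_iInter_atTop (μ := μ) (s := fun n : ℕ => {z | θ z ∉ e '' Set.Iio n})
    (fun n => ((h (e '' Set.Iio n)ᶜ)).nullMeasurableSet)
    (fun m n hmn z hz hz' => hz (Set.image_mono (Set.Iio_subset_Iio hmn) hz'))
    ⟨0, measure_ne_top _ _⟩
  have h0 : ⋂ n : ℕ, {z | θ z ∉ e '' Set.Iio n} = ∅ := by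
    rw [Set.eq_empty_iff_forall_notMem]
    intro z hz
    obtain ⟨k, hk⟩ := he (θ z)
    exact Set.mem_iInter.1 hz (k + 1) ⟨k, Nat.lt_succ_self k, hk⟩
  rw [h0, measure_empty] at ht
  obtain ⟨n, hn⟩ := (ht.eventually_lt_const hε).exists
  exact ⟨_, (Set.finite_Iio n).image e, hn⟩

variable [Group H] [MulAction H Z]

structure Eqv (H : Type) [Group H] [MulAction H Z] [SMul H D] (θ : Z → D) : Prop where
  mf : MF θ
  smul : ∀ (h : H) z, θ (h • z) = h • θ z

theorem Eqv.mul {Θ : Z → H} (hΘ : Eqv H Θ) (h : H) z : Θ (h • z) = h * Θ z := hΘ.smul h z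

theorem Eqv.mul_right {Θ : Z → H} (hΘ : Eqv H Θ) (k : H) : Eqv H fun z => Θ z * k :=
  ⟨hΘ.mf.comp (· * k), fun h z => by simp [hΘ.mul, mul_assoc]⟩

variable [Countable H] {m : Measure Z} (hm : ∀ h : H, MeasurePreserving (fun z : Z => h • z) m m)
include hm

theorem ae_forall_smul {φ : Z → Prop} (h : ∀ᵐ z ∂m, φ z) : ∀ᵐ z ∂m, ∀ h : H, φ (h • z) :=
  ae_all_iff.2 fun h' => (hm h').quasiMeasurePreserving.ae h

omit hm [Group H] [MulAction H Z] in
theorem measure_eq_tsum {Θ : Z → H} (hΘ : MF Θ) {E : Set Z} (hE : MeasurableSet E) :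
    m E = ∑' h : H, m (E ∩ {z | Θ z = h}) := by
  rw [← measure_iUnion]
  · congr 1; ext z; simp
  · intro h h' hne
    refine Set.disjoint_left.2 ?_
    rintro z ⟨-, h1⟩ ⟨-, h2⟩
    exact hne (h1.symm.trans h2)
  · exact fun h => hE.inter (hΘ {h})

omit [Countable H] in
theorem measure_translate {E : Set Z} (hE : MeasurableSet E) (h : H) :
    m {z | h • z ∈ E} = m E := (hm h).measure_preimage hE.nullMeasurableSet

theorem exchange {Θ Θ' : Z → H} (hΘ : Eqv H Θ) (hΘ' : Eqv H Θ') {E : Set Z}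
    (hE : MeasurableSet E) (hinv : ∀ (h : H) z, h • z ∈ E ↔ z ∈ E) :
    m (E ∩ {z | Θ z = 1}) = m (E ∩ {z | Θ' z = 1}) := by
  rw [measure_eq_tsum hΘ'.mf (hE.inter (hΘ.mf.eq 1)),
    measure_eq_tsum hΘ.mf (hE.inter (hΘ'.mf.eq 1)), ← (Equiv.inv H).tsum_eq]
  congr 1; ext h
  rw [← measure_translate hm ((hE.inter (hΘ.mf.eq 1)).inter (hΘ'.mf.eq ((Equiv.inv H) h))) h⁻¹]
  congr 1; ext z
  simp only [Set.mem_inter_iff, hinv, Set.mem_ofPred_eq, 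
    hΘ.mul, hΘ'.mul, Equiv.inv_apply, inv_mul_eq_one, mul_eq_left]
  constructor
  · rintro ⟨⟨h1, h2⟩, h3⟩; exact ⟨⟨h1, h3⟩, h2.symm⟩
  · rintro ⟨⟨h1, h2⟩, h3⟩; exact ⟨⟨h1, h3.symm⟩, h2⟩

theorem exchange_map {Θ : Z → H} (hΘ : Eqv H Θ) {T T' : Z → Z} (hT : MeasurePreserving T m m)
    (hT' : Measurable T') (hTT : ∀ z, T' (T z) = z) (hc : ∀ (h : H) z, T' (h • z) = h • T' z)
    {E : Set Z} (hE : MeasurableSet E) (hinv : ∀ (h : H) z, h • z ∈ E ↔ z ∈ E) :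
    m ({z | T z ∈ E} ∩ {z | Θ z = 1}) = m (E ∩ {z | Θ z = 1}) := by
  have h1 : Eqv H fun z => Θ (T' z) := ⟨hΘ.mf.comp_measurable hT', fun h z => by
    rw [hc, hΘ.smul]⟩
  rw [exchange hm hΘ h1 hE hinv, ← hT.measure_preimage
    (hE.inter (h1.mf.eq 1)).nullMeasurableSet]
  congr 1; ext z; simp [hTT]

theorem null_of_domain {Θ : Z → H} (hΘ : Eqv H Θ) {E : Set Z} (hE : MeasurableSet E)
    (hinv : ∀ (h : H) z, h • z ∈ E ↔ z ∈ E) (h0 : m (E ∩ {z | Θ z = 1}) = 0) : m E = 0 := by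
  rw [measure_eq_tsum hΘ.mf hE, ENNReal.tsum_eq_zero]
  intro h
  rw [← measure_translate hm (hE.inter (hΘ.mf.eq h)) h, ← h0]
  congr 1; ext z
  simp [hinv, hΘ.mul]

/-- The σ-algebra of `H`-invariant measurable sets. -/
abbrev invσ (H Z : Type) [MeasurableSpace Z] [Group H] [MulAction H Z] : MeasurableSpace Z where
  MeasurableSet' s := MeasurableSet s ∧ ∀ (h : H) z, h • z ∈ s ↔ z ∈ s
  measurableSet_empty := ⟨MeasurableSet.empty, by simp⟩
  measurableSet_compl s hs := ⟨hs.1.compl, fun h z => not_congr (hs.2 h z)⟩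
  measurableSet_iUnion f hf := ⟨MeasurableSet.iUnion fun i => (hf i).1, fun h z => by
    simp only [Set.mem_iUnion, (hf _).2 h z]⟩

omit hm [Countable H] in
theorem invσ_le : invσ H Z ≤ ‹MeasurableSpace Z› := fun _ hs => hs.1

/-- The measure on the quotient by `H`, carried by the `H`-invariant σ-algebra. -/
noncomputable def mq (m : Measure Z) (Θ : Z → H) : @Measure Z (invσ H Z) :=
  (m.restrict {z | Θ z = 1}).trim invσ_le

omit hm [Countable H] in
theorem mq_apply {Θ : Z → H} {E : Set Z} (hE : MeasurableSet[invσ H Z] E) :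
    mq m Θ E = m (E ∩ {z | Θ z = 1}) := by
  rw [mq, trim_measurableSet_eq invσ_le hE, Measure.restrict_apply hE.1]

theorem mq_mp {Θ : Z → H} (hΘ : Eqv H Θ) {T T' : Z → Z} (hT : MeasurePreserving T m m)
    (hT' : Measurable T') (hTT : ∀ z, T' (T z) = z) (hc : ∀ (h : H) z, T (h • z) = h • T z)
    (hc' : ∀ (h : H) z, T' (h • z) = h • T' z) :
    @MeasurePreserving Z Z (invσ H Z) (invσ H Z) T (mq m Θ) (mq m Θ) := by
  have hmeas : @Measurable Z Z (invσ H Z) (invσ H Z) T := fun s hs =>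
    ⟨hT.measurable hs.1, fun h z => by simp only [Set.mem_preimage, hc, hs.2]⟩
  refine @MeasurePreserving.mk Z Z (invσ H Z) (invσ H Z) _ _ _ hmeas ?_
  refine @Measure.ext Z (invσ H Z) _ _ fun s hs => ?_
  rw [@Measure.map_apply Z Z (invσ H Z) (invσ H Z) _ _ hmeas _ hs, mq_apply hs,
    mq_apply (hmeas hs)]
  exact exchange_map hm hΘ hT hT' hTT hc' hs.1 hs.2

end Measured

section CouplingBasics
variable {G H Z : Type} [MeasurableSpace Z] [Group G] [Group H] [MulAction G Z] [MulAction H Z]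

theorem smul_mem_orbit_iff' {D : Type} [MulAction H D] {h : H} {d e : D} :
    h • d ∈ MulAction.orbit H e ↔ d ∈ MulAction.orbit H e := by
  rw [← MulAction.orbit_eq_iff, MulAction.orbit_smul, MulAction.orbit_eq_iff]

/-- A measured coupling of `G` and `H`: commuting measure-preserving actions, each with an
equivariant map to the group whose fibre over `1` is a fundamental domain of finite measure. -/
structure Coupling (G H : Type) {Z : Type} [MeasurableSpace Z] [Group G] [Group H]
    [MulAction G Z] [MulAction H Z] (m : Measure Z) where
  rG : Z → G
  rH : Z → H
  comm : ∀ (g : G) (h : H) (z : Z), g • h • z = h • g • z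
  mpG : ∀ g : G, MeasurePreserving (fun z : Z => g • z) m m
  mpH : ∀ h : H, MeasurePreserving (fun z : Z => h • z) m m
  eqvG : Eqv G rG
  eqvH : Eqv H rH
  finG : m {z | rG z = 1} < ⊤
  finH : m {z | rH z = 1} < ⊤
  ne_zero : m ≠ 0

variable {m : Measure Z}

def Coupling.swap (C : Coupling G H m) : Coupling H G m where
  rG := C.rH
  rH := C.rG
  comm := fun h g z => (C.comm g h z).symm
  mpG := C.mpH
  mpH := C.mpG
  eqvG := C.eqvH
  eqvH := C.eqvG
  finG := C.finH
  finH := C.finG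
  ne_zero := C.ne_zero

/-- `A` acts ergodically on the quotient of `Z` by `H`. -/
def Erg (H : Type) [Group H] [MulAction H Z] (A : Set G) (m : Measure Z) : Prop :=
  ∀ E : Set Z, MeasurableSet E → (∀ (h : H) z, h • z ∈ E ↔ z ∈ E) →
    (∀ a ∈ A, ∀ᵐ z ∂m, a • z ∈ E ↔ z ∈ E) → m E = 0 ∨ m Eᶜ = 0

/-- The `H`-equivariant map `Θ` conjugates the cocycle of the elements of `A` into `Q`. -/
def RedBy (A : Set G) (Q : Subgroup H) (m : Measure Z) (Θ : Z → H) : Prop :=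
  Eqv H Θ ∧ ∀ a ∈ A, ∀ᵐ z ∂m, (Θ z)⁻¹ * Θ (a • z) ∈ Q

def Red (A : Set G) (Q : Subgroup H) (m : Measure Z) : Prop := ∃ Θ : Z → H, RedBy A Q m Θ

theorem RedBy.mono {A A' : Set G} {Q Q' : Subgroup H} {Θ : Z → H} (h : RedBy A Q m Θ)
    (hA : A' ⊆ A) (hQ : Q ≤ Q') : RedBy A' Q' m Θ :=
  ⟨h.1, fun a ha => (h.2 a (hA ha)).mono fun _ hz => hQ hz⟩

theorem RedBy.conj {A : Set G} {Q Q' : Subgroup H} {Θ : Z → H} (h : RedBy A Q m Θ) (k : H)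
    (hQ : ∀ q ∈ Q, k⁻¹ * q * k ∈ Q') : RedBy A Q' m fun z => Θ z * k :=
  ⟨h.1.mul_right k, fun a ha => (h.2 a ha).mono fun z hz => by
    have := hQ _ hz
    simpa [mul_assoc] using this⟩

variable [Countable G] [Countable H] (C : Coupling G H m)
include C

omit [Countable G] in
theorem Coupling.dom_eq {Θ : Z → H} (hΘ : Eqv H Θ) :
    m {z | Θ z = 1} = m {z | C.rH z = 1} := by
  have := exchange C.mpH hΘ C.eqvH MeasurableSet.univ (by simp)
  simpa using this

omit [Countable G] in
theorem Coupling.dom_ne_zero {Θ : Z → H} (hΘ : Eqv H Θ) : m {z | Θ z = 1} ≠ 0 := fun h => by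
  apply C.ne_zero
  rw [← Measure.measure_univ_eq_zero]
  exact null_of_domain C.mpH hΘ MeasurableSet.univ (by simp) (by simpa using h)

theorem Coupling.dom_lt_top {Θ : Z → H} (hΘ : Eqv H Θ) : m {z | Θ z = 1} < ⊤ :=
  C.dom_eq hΘ ▸ C.finH

theorem Coupling.isFinite {Θ : Z → H} (hΘ : Eqv H Θ) :
    IsFiniteMeasure (m.restrict {z | Θ z = 1}) :=
  ⟨by rw [Measure.restrict_apply_univ]; exact C.dom_lt_top hΘ⟩

omit [Countable G] [Countable H] in
theorem Coupling.eqv_smul {Θ : Z → H} (hΘ : Eqv H Θ) (g : G) : Eqv H fun z => Θ (g • z) :=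
  ⟨hΘ.mf.comp_measurable (C.mpG g).measurable, fun h z => by rw [C.comm, hΘ.smul]⟩

omit [Countable G] in
theorem Coupling.exchange_smul {Θ : Z → H} (hΘ : Eqv H Θ) (g : G) {E : Set Z}
    (hE : MeasurableSet E) (hinv : ∀ (h : H) z, h • z ∈ E ↔ z ∈ E) :
    m ({z | g • z ∈ E} ∩ {z | Θ z = 1}) = m (E ∩ {z | Θ z = 1}) :=
  exchange_map C.mpH hΘ (C.mpG g) (C.mpG g⁻¹).measurable (by simp)
    (fun h z => C.comm g⁻¹ h z) hE hinv

omit [Countable G] [Countable H] in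
theorem Coupling.ae_smul {φ : Z → Prop} (h : ∀ᵐ z ∂m, φ z) (g : G) : ∀ᵐ z ∂m, φ (g • z) :=
  (C.mpG g).quasiMeasurePreserving.ae h

omit [Countable G] in
theorem Coupling.exists_gauge {A : Set G} (hA : Erg H A m) {D : Type} [Countable D]
    [MulAction H D] {θ : Z → D} (hθ : Eqv H θ) (hinv : ∀ a ∈ A, ∀ᵐ z ∂m, θ (a • z) = θ z) :
    ∃ (d₀ : D) (Θ : Z → H), Eqv H Θ ∧ ∀ᵐ z ∂m, Θ z • d₀ = θ z := by
  classical
  have hmeas : ∀ d, MeasurableSet {z | θ z ∈ MulAction.orbit H d} := fun d => hθ.mf.mem _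
  obtain ⟨d₀, hd₀⟩ : ∃ d₀, m {z | θ z ∈ MulAction.orbit H d₀} ≠ 0 := by
    by_contra hcon
    push Not at hcon
    apply C.ne_zero
    rw [← Measure.measure_univ_eq_zero, show (Set.univ : Set Z) =
      ⋃ d, {z | θ z ∈ MulAction.orbit H d} by
        ext z; simpa using ⟨θ z, MulAction.mem_orbit_self _⟩]
    exact measure_iUnion_null hcon
  have h1 : m {z | θ z ∈ MulAction.orbit H d₀}ᶜ = 0 := by
    refine (hA _ (hmeas d₀) (fun h z => ?_) (fun a ha => ?_)).resolve_left hd₀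
    · simp only [Set.mem_ofPred_eq, hθ.smul, smul_mem_orbit_iff']
    · filter_upwards [hinv a ha] with z hz
      simp only [Set.mem_ofPred_eq, hz]
  have hσ : ∀ d, ∃ k : H, d ∈ MulAction.orbit H d₀ → k • d₀ = d := fun d => by
    by_cases hd : d ∈ MulAction.orbit H d₀
    · obtain ⟨k, hk⟩ := hd; exact ⟨k, fun _ => hk⟩
    · exact ⟨1, fun h => absurd h hd⟩
  choose σ hσ using hσ
  refine ⟨d₀, fun z => C.rH z * σ ((C.rH z)⁻¹ • θ z), ⟨?_, fun h z => ?_⟩, ?_⟩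
  · exact (C.eqvH.mf.pair hθ.mf).comp fun p => p.1 * σ (p.1⁻¹ • p.2)
  · simp only [C.eqvH.mul, hθ.smul, smul_smul, smul_eq_mul, mul_assoc]
    congr 3; group
  · have h2 : ∀ᵐ z ∂m, θ z ∈ MulAction.orbit H d₀ := h1
    filter_upwards [h2] with z hz
    rw [mul_smul, hσ _ ((smul_mem_orbit_iff').2 hz), smul_inv_smul]

omit [Countable G] in
theorem Coupling.intersect {A : Set G} (hA : Erg H A m) {Q₁ Q₂ : Subgroup H} {Θ₁ Θ₂ : Z → H}
    (h₁ : RedBy A Q₁ m Θ₁) (h₂ : RedBy A Q₂ m Θ₂) :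
    ∃ (k : H) (Θ : Z → H), Eqv H Θ ∧ (∀ᵐ z ∂m, (Θ₁ z)⁻¹ * Θ z ∈ Q₁) ∧
      ∀ᵐ z ∂m, (Θ₂ z)⁻¹ * (Θ z * k) ∈ Q₂ := by
  have : Countable (H ⧸ Q₁) := QuotientGroup.mk_surjective.countable
  have : Countable (H ⧸ Q₂) := QuotientGroup.mk_surjective.countable
  obtain ⟨⟨x, y⟩, Θ, hΘ, h⟩ := C.exists_gauge hA
    (θ := fun z => ((Θ₁ z : H ⧸ Q₁), (Θ₂ z : H ⧸ Q₂)))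
    ⟨(h₁.1.mf.comp (QuotientGroup.mk (s := Q₁))).pair (h₂.1.mf.comp (QuotientGroup.mk (s := Q₂))),
      fun h z => by
        simp only [h₁.1.mul, h₂.1.mul]; rfl⟩
    (fun a ha => by
      filter_upwards [h₁.2 a ha, h₂.2 a ha] with z hz hz'
      rw [Prod.mk.injEq]
      exact ⟨(QuotientGroup.eq.2 hz).symm, (QuotientGroup.eq.2 hz').symm⟩)
  obtain ⟨x, rfl⟩ := QuotientGroup.mk_surjective x
  obtain ⟨y, rfl⟩ := QuotientGroup.mk_surjective y
  have h' : ∀ᵐ z ∂m, (Θ₁ z)⁻¹ * (Θ z * x) ∈ Q₁ ∧ (Θ₂ z)⁻¹ * (Θ z * y) ∈ Q₂ := by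
    filter_upwards [h] with z hz
    have h1 := congrArg Prod.fst hz
    have h2 := congrArg Prod.snd hz
    exact ⟨QuotientGroup.eq.1 h1.symm, QuotientGroup.eq.1 h2.symm⟩
  refine ⟨x⁻¹ * y, fun z => Θ z * x, hΘ.mul_right x, h'.mono fun z hz => hz.1,
    h'.mono fun z hz => ?_⟩
  simpa [mul_assoc] using hz.2

omit [Countable G] [Countable H] in
theorem Coupling.redBy_change {A : Set G} {Q : Subgroup H} {Θ Θ' : Z → H} (h : RedBy A Q m Θ)
    (hΘ' : Eqv H Θ') (hc : ∀ᵐ z ∂m, (Θ z)⁻¹ * Θ' z ∈ Q) : RedBy A Q m Θ' :=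
  ⟨hΘ', fun a ha => by
    filter_upwards [h.2 a ha, hc, C.ae_smul hc a] with z h1 h2 h3
    have := Q.mul_mem (Q.mul_mem (Q.inv_mem h2) h1) h3
    simpa [mul_assoc] using this⟩

theorem Coupling.recurrence {E : Set Z} (hE : MeasurableSet E)
    (hinv : ∀ (h : H) z, h • z ∈ E ↔ z ∈ E) (h0 : m E ≠ 0) (p : G) :
    ∃ n : ℕ, 0 < n ∧ m {z | z ∈ E ∧ p ^ n • z ∈ E} ≠ 0 := by
  have hΘ := C.eqvH
  have hYm : MeasurableSet[invσ H Z] E := ⟨hE, hinv⟩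
  have hmp := mq_mp C.mpH hΘ (C.mpG p) (C.mpG p⁻¹).measurable (by simp)
    (fun h z => C.comm p h z) (fun h z => C.comm p⁻¹ h z)
  have hfin : @IsFiniteMeasure Z (invσ H Z) (mq m C.rH) := by
    refine @IsFiniteMeasure.mk Z (invσ H Z) _ ?_
    rw [mq_apply (@MeasurableSet.univ Z (invσ H Z)), Set.univ_inter]
    exact C.dom_lt_top hΘ
  have hcons := @MeasurePreserving.conservative Z (invσ H Z) _ _ hfin hmp
  have hne : m (E ∩ {z | C.rH z = 1}) ≠ 0 := fun h1 => h0 (null_of_domain C.mpH hΘ hE hinv h1)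
  obtain ⟨n, hn, hne'⟩ := @Conservative.exists_gt_measure_inter_ne_zero Z (invσ H Z) _ _ _
    hcons (@MeasurableSet.nullMeasurableSet Z (invσ H Z) _ _ hYm) (by rwa [mq_apply hYm]) 0
  rw [smul_iterate] at hne'
  have hYn : MeasurableSet[invσ H Z] (E ∩ (p ^ n • ·) ⁻¹' E) :=
    ⟨hE.inter ((C.mpG (p ^ n)).measurable hE), fun h z => by
      simp only [Set.mem_inter_iff, Set.mem_preimage, C.comm, hinv]⟩
  rw [mq_apply hYn] at hne'
  exact ⟨n, hn, mt (measure_mono_null (Set.inter_subset_left)) hne'⟩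

/-- If the cocycle on `P` takes values in `Q` and that on `Q` takes values in `P'`, then
every element of `P` has a power in a fixed conjugate of `P'`. -/
theorem Coupling.exists_pow_mem {P : Set G} {Q : Subgroup H} {P' : Subgroup G}
    (h₁ : Red P Q m) (h₂ : Red (Q : Set H) P' m) :
    ∃ k : G, ∀ p ∈ P, ∃ n : ℕ, 0 < n ∧ k⁻¹ * p ^ n * k ∈ P' := by
  obtain ⟨Θ, hΘ, hred⟩ := h₁
  obtain ⟨Ψ, hΨ, hred'⟩ := h₂
  set f : Z → G := fun z => Ψ ((Θ z)⁻¹ • z) with hf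
  have hfmf : MF f := MF.select (f := fun (h : H) z => Ψ (h⁻¹ • z)) hΘ.mf fun h =>
    hΨ.mf.comp_measurable (C.mpH h⁻¹).measurable
  have hfinv : ∀ (h : H) z, f (h • z) = f z := fun h z => by
    simp [hf, hΘ.mul, mul_smul]
  have hfp : ∀ p ∈ P, ∀ᵐ z ∂m, (f z)⁻¹ * p⁻¹ * f (p • z) ∈ P' := fun p hp => by
    have h3 : ∀ᵐ z ∂m, ∀ h : H, ∀ q : Q, (Ψ (h • z))⁻¹ * Ψ ((q : H) • h • z) ∈ P' :=
      ae_forall_smul C.mpH (φ := fun z => ∀ q : Q, (Ψ z)⁻¹ * Ψ ((q : H) • z) ∈ P')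
        (ae_all_iff.2 fun q => hred' q q.2)
    filter_upwards [h3, hred p hp] with z h4 h5
    have h6 := h4 (Θ z)⁻¹ ⟨_, Q.inv_mem h5⟩
    have h7 : f (p • z) = p * Ψ ((Θ (p • z))⁻¹ • z) := by
      rw [hf]; simp only [← C.comm, hΨ.mul]
    rw [h7]
    simp only [mul_inv_rev, inv_inv, smul_smul, mul_assoc, mul_inv_cancel, mul_one] at h6
    simpa [mul_assoc, hf] using h6
  obtain ⟨k, hk⟩ : ∃ k, m {z | f z = k} ≠ 0 := by
    by_contra hcon
    push Not at hcon
    apply C.ne_zero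
    rw [← Measure.measure_univ_eq_zero, show (Set.univ : Set Z) = ⋃ k, {z | f z = k} by ext; simp]
    exact measure_iUnion_null hcon
  refine ⟨k, fun p hp => ?_⟩
  have hY : ∀ (h : H) z, h • z ∈ {z | f z = k} ↔ z ∈ {z | f z = k} := fun h z => by
    simp only [Set.mem_ofPred_eq, hfinv]
  have hpow : ∀ n : ℕ, ∀ᵐ z ∂m, (f z)⁻¹ * (p ^ n)⁻¹ * f (p ^ n • z) ∈ P' := by
    intro n
    induction n with
    | zero => simp [P'.one_mem]
    | succ n ih =>
      filter_upwards [C.ae_smul (hfp p hp) (p ^ n), ih] with z h1 h2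
      have := P'.mul_mem h2 h1
      rw [pow_succ', mul_smul, ]
      simpa [mul_assoc] using this
  obtain ⟨n, hn, hne⟩ := C.recurrence (hfmf.eq k) hY hk p
  obtain ⟨z, ⟨h1, h2⟩, h3⟩ := ((frequently_ae_mem_iff.2 hne).and_eventually (hpow n)).exists
  simp only [Set.mem_ofPred_eq] at h1 h2
  refine ⟨n, hn, ?_⟩
  rw [h1, h2] at h3
  simpa [mul_assoc] using P'.inv_mem h3

/-- An element of infinite order cannot fix an equivariant map. -/
theorem Coupling.not_fixed {a : G} (ha : ∀ n : ℕ, 0 < n → a ^ n ≠ 1) {Θ : Z → H}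
    (hΘ : Eqv H Θ) (h : ∀ᵐ z ∂m, Θ (a • z) = Θ z) : False := by
  obtain ⟨k, hk⟩ := C.exists_pow_mem (P := {a}) (Q := ⊥) (P' := ⊥)
    ⟨Θ, hΘ, fun x hx => by
      rw [Set.mem_singleton_iff.1 hx]
      filter_upwards [h] with z hz
      simp [hz]⟩
    ⟨C.rG, C.eqvG, fun x hx => by
      rw [(Subgroup.mem_bot.1 hx : x = 1)]; simp⟩
  obtain ⟨n, hn, h1⟩ := hk a rfl
  rw [Subgroup.mem_bot, mul_eq_one_iff_eq_inv, inv_mul_eq_iff_eq_mul, mul_inv_cancel] at h1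
  exact ha n hn h1

end CouplingBasics

section Support
variable {G Z : Type} [MeasurableSpace Z] [Group G] [MulAction G Z] {W : Type} [Fintype W]
  {Λ : SimpleGraph W} [MulAction (RAAG Λ) Z] {m : Measure Z} [Countable G]
  (C : Coupling G (RAAG Λ) m)
include C

/-- `S` is the smallest set of vertices such that the cocycle of `A` can be conjugated into
the corresponding standard subgroup, and `Θ` realizes the conjugation. -/
def Supp (m : Measure Z) (A : Set G) (S : Set W) (Θ : Z → RAAG Λ) : Prop :=
  RedBy A (standardSub Λ S) m Θ ∧ ∀ T, Red A (standardSub Λ T) m → S ⊆ T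

theorem Coupling.intersect_standard {A : Set G} (hA : Erg (RAAG Λ) A m) {S T : Set W}
    {Θ Ψ : Z → RAAG Λ} (hS : RedBy A (standardSub Λ S) m Θ) (hT : RedBy A (standardSub Λ T) m Ψ) :
    ∃ k, (∀ᵐ z ∂m, ∃ s ∈ standardSub Λ S, ∃ t ∈ standardSub Λ T, (Θ z)⁻¹ * Ψ z = s * k * t) ∧
      ∃ a ∈ standardSub Λ S, ∃ U, U ⊆ S ∧ U ⊆ T ∧ Red A (standardSub Λ U) m ∧
      ∀ p, (p ∈ standardSub Λ S ∧ k⁻¹ * p * k ∈ standardSub Λ T) ↔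
        a⁻¹ * p * a ∈ standardSub Λ U := by
  obtain ⟨k, Φ, hΦ, h1, h2⟩ := C.intersect hA hS hT
  obtain ⟨a, ha, U, hU1, hU2, hU⟩ := parabolic_inter S T k
  have h3 := C.redBy_change hS hΦ h1
  have h4 := C.redBy_change hT (hΦ.mul_right k) h2
  refine ⟨k, ?_, a, ha, U, hU1, hU2, ⟨fun z => Φ z * a, hΦ.mul_right a, fun x hx => ?_⟩, hU⟩
  · filter_upwards [h1, h2] with z h5 h6
    refine ⟨_, h5, _, inv_mem h6, ?_⟩
    group
  · filter_upwards [h3.2 x hx, h4.2 x hx] with z h5 h6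
    have := (hU _).1 ⟨h5, by simpa [mul_assoc] using h6⟩
    simpa [mul_assoc] using this

theorem Coupling.exists_supp {A : Set G} (hA : Erg (RAAG Λ) A m) :
    ∃ S Θ, Supp (Λ := Λ) m A S Θ := by
  have hex : ∃ n, ∃ S : Set W, S.ncard = n ∧ Red A (standardSub Λ S) m :=
    ⟨_, Set.univ, rfl, C.rH, C.eqvH, fun a _ => by simp [standardSub_univ]⟩
  classical
  obtain ⟨S, hS, Θ, hΘ⟩ := Nat.find_spec hex
  refine ⟨S, Θ, hΘ, fun T ⟨Ψ, hΨ⟩ => ?_⟩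
  obtain ⟨k, -, a, -, U, hUS, hUT, hred, -⟩ := C.intersect_standard hA hΘ hΨ
  have h1 : S.ncard ≤ U.ncard := hS ▸ Nat.find_min' hex ⟨U, rfl, hred⟩
  rw [← Set.eq_of_subset_of_ncard_le hUS h1 S.toFinite]
  exact hUT

theorem Coupling.commuting_mem {A : Set G} (hA : Erg (RAAG Λ) A m) {S : Set W} {Θ : Z → RAAG Λ}
    (hS : Supp m A S Θ) {p : G} (hp : ∀ a ∈ A, Commute p a) :
    ∀ᵐ z ∂m, (Θ z)⁻¹ * Θ (p • z) ∈ standardSub Λ (S ∪ lk Λ S) := by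
  have h1 : RedBy A (standardSub Λ S) m fun z => Θ (p • z) :=
    ⟨C.eqv_smul hS.1.1 p, fun a ha => by
      filter_upwards [C.ae_smul (hS.1.2 a ha) p] with z hz
      rwa [smul_smul, (hp a ha).eq, mul_smul]⟩
  obtain ⟨k, hk, a, ha, U, hUS, -, hred, hU⟩ := C.intersect_standard hA hS.1 h1
  obtain rfl : U = S := hUS.antisymm (hS.2 U hred)
  obtain ⟨-, a, ha, c, hc, b, hb, rfl⟩ := parabolic_le (Γ := Λ) (S := U) (T := U) (g := k)
    fun p hp => ((hU p).2 (mul_mem (mul_mem (inv_mem ha) hp) ha)).2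
  have h2 := standardSub_mono (Γ := Λ) (Set.subset_union_left (s := U) (t := lk Λ U))
  have h3 := standardSub_mono (Γ := Λ) (Set.subset_union_right (s := U) (t := lk Λ U))
  filter_upwards [hk] with z ⟨s, hs, t, ht, hz⟩
  rw [hz]
  exact mul_mem (mul_mem (h2 hs) (mul_mem (mul_mem (h2 ha) (h3 hc)) (h2 hb))) (h2 ht)

theorem Coupling.red_commuting {A : Set G} (hA : Erg (RAAG Λ) A m) {S : Set W} {Θ : Z → RAAG Λ}
    (hS : Supp m A S Θ) {P : Set G} (hP : ∀ p ∈ P, ∀ a ∈ A, Commute p a) :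
    RedBy P (standardSub Λ (S ∪ lk Λ S)) m Θ :=
  ⟨hS.1.1, fun _ hp => C.commuting_mem hA hS (hP _ hp)⟩

end Support

section MinNorm

/-- If all translates of a finite measure set meet it in a uniformly positive amount, then
there is an almost invariant set of finite positive measure. -/
theorem exists_invariant_set {A Ω : Type} [Mul A] [Nonempty A] [MeasurableSpace Ω]
    {μ : Measure Ω} {T : A → Ω → Ω} (hT : ∀ a, MeasurePreserving (T a) μ μ)
    (hmul : ∀ a b ω, T (a * b) ω = T a (T b ω)) {B : Set Ω} (hB : MeasurableSet B)
    (hBfin : μ B ≠ ⊤) {ε : ℝ} (hε : 0 < ε) (hbig : ∀ a, ε ≤ μ.real (T a ⁻¹' B ∩ B)) :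
    ∃ L : Set Ω, MeasurableSet L ∧ μ L ≠ 0 ∧ μ L ≠ ⊤ ∧ ∀ a, ∀ᵐ ω ∂μ, T a ω ∈ L ↔ ω ∈ L := by
  set U : A → Lp ℝ 2 μ →ₗᵢ[ℝ] Lp ℝ 2 μ := fun a => Lp.compMeasurePreservingₗᵢ ℝ (T a) (hT a)
    with hU
  have hUapp : ∀ a f, U a f = Lp.compMeasurePreserving (T a) (hT a) f := fun a f => rfl
  set ξ : Lp ℝ 2 μ := indicatorConstLp 2 hB hBfin 1 with hξ
  have hinner : ∀ a, inner ℝ (U a ξ) ξ = μ.real (T a ⁻¹' B ∩ B) := fun a => by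
    rw [hUapp, hξ, Lp.indicatorConstLp_compMeasurePreserving,
      L2.real_inner_indicatorConstLp_one_indicatorConstLp_one ((hT a).measurable hB) hB
        (by rwa [(hT a).measure_preimage hB.nullMeasurableSet]) hBfin]
  have hcomp : ∀ a b, U a (U b ξ) = U (b * a) ξ := fun a b => by
    simp only [hUapp]
    rw [← Lp.compMeasurePreserving_comp_apply]
    have h : T b ∘ T a = T (b * a) := funext fun ω => (hmul b a ω).symm
    congr 1; simp only [h]
  set R := Set.range fun a => U a ξ
  set C := closure (convexHull ℝ R) with hC
  have hCconv : Convex ℝ C := (convex_convexHull ℝ R).closure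
  obtain ⟨a₀⟩ := ‹Nonempty A›
  have hCne : C.Nonempty := ⟨U a₀ ξ, subset_closure (subset_convexHull ℝ R ⟨a₀, rfl⟩)⟩
  obtain ⟨v, hv, hmin⟩ := exists_norm_eq_iInf_of_complete_convex hCne
    isClosed_closure.isComplete hCconv (0 : Lp ℝ 2 μ)
  rw [norm_eq_iInf_iff_real_inner_le_zero hCconv hv] at hmin
  have hinv : ∀ a, U a v = v := fun a => by
    have hmem : U a v ∈ C := by
      have h1 : U a v ∈ closure (U a '' convexHull ℝ R) :=
        image_closure_subset_closure_image (U a).continuous ⟨v, hv, rfl⟩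
      refine closure_mono ?_ h1
      rw [show (U a '' convexHull ℝ R) = (U a).toLinearMap '' convexHull ℝ R from rfl,
        LinearMap.image_convexHull]
      refine convexHull_mono ?_
      rintro _ ⟨_, ⟨b, rfl⟩, rfl⟩
      exact ⟨b * a, (hcomp a b).symm⟩
    have h1 := hmin _ hmem
    rw [zero_sub, inner_neg_left, inner_sub_right, real_inner_self_eq_norm_sq] at h1
    have h2 := norm_sub_sq_real v (U a v)
    rw [(U a).norm_map] at h2
    have h3 : ‖v - U a v‖ = 0 := by
      have := sq_nonneg ‖v - U a v‖
      nlinarith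
    exact (sub_eq_zero.1 (norm_eq_zero.1 h3)).symm
  have hvξ : ε ≤ inner ℝ v ξ := by
    have hcl : IsClosed {w : Lp ℝ 2 μ | ε ≤ inner ℝ w ξ} :=
      isClosed_le continuous_const (continuous_id.inner continuous_const)
    have hcv : Convex ℝ {w : Lp ℝ 2 μ | ε ≤ inner ℝ w ξ} := by
      intro x hx y hy s t hs ht hst
      simp only [Set.mem_ofPred_eq, inner_add_left, real_inner_smul_left] at hx hy ⊢
      nlinarith
    refine closure_minimal (convexHull_min ?_ hcv) hcl hv
    rintro _ ⟨a, rfl⟩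
    simpa only [Set.mem_ofPred_eq, hinner] using hbig a
  have hv0 : v ≠ 0 := fun h => by
    rw [h, inner_zero_left] at hvξ
    exact absurd hvξ (not_le.2 hε)
  have hmeas := (Lp.stronglyMeasurable v).measurable
  obtain ⟨n, hn⟩ : ∃ n : ℕ, μ {ω | ((n + 1 : NNReal)⁻¹) ≤ ‖v ω‖₊} ≠ 0 := by
    by_contra hcon
    push Not at hcon
    apply hv0
    rw [Lp.eq_zero_iff_ae_eq_zero]
    have h1 := measure_iUnion_null hcon
    refine measure_mono_null (fun ω hω => ?_) h1
    have h2 : 0 < ‖v ω‖₊ := by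
      rw [pos_iff_ne_zero]; simpa using hω
    obtain ⟨n, hn⟩ := exists_nat_gt (‖v ω‖₊⁻¹)
    rw [Set.mem_iUnion]
    refine ⟨n, ?_⟩
    simp only [Set.mem_ofPred_eq]
    rw [inv_le_comm₀ (by positivity) h2]
    exact hn.le.trans (by simp)
  refine ⟨{ω | ((n + 1 : NNReal)⁻¹) ≤ ‖v ω‖₊}, measurableSet_le measurable_const hmeas.nnnorm, hn,
    ((Lp.memLp v).meas_ge_lt_top (by simp) (by simp) (by positivity)).ne, fun a => ?_⟩
  have h1 := Lp.coeFn_compMeasurePreserving v (hT a)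
  rw [← hUapp, hinv] at h1
  filter_upwards [h1] with ω hω
  show _ ≤ ‖v (T a ω)‖₊ ↔ _ ≤ ‖v ω‖₊
  rw [hω]; rfl

end MinNorm

section Product
variable {Z D : Type} [MeasurableSpace Z] [MeasurableSpace D] [DiscreteMeasurableSpace D]
  {m : Measure Z}

/-- The product of `m` with the counting measure on `D`. -/
noncomputable def prodCount (m : Measure Z) (D : Type) [MeasurableSpace D] : Measure (Z × D) :=
  Measure.sum fun d : D => m.map fun z => (z, d)

omit [DiscreteMeasurableSpace D] in
theorem prodCount_apply {E : Set (Z × D)} (hE : MeasurableSet E) :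
    prodCount m D E = ∑' d, m {z | (z, d) ∈ E} := by
  rw [prodCount, Measure.sum_apply _ hE]
  congr 1; ext d
  rw [Measure.map_apply measurable_prodMk_right hE]; rfl

theorem prodCount_mp [Countable D] {T : Z → Z} (hT : MeasurePreserving T m m) (σ : D ≃ D) :
    MeasurePreserving (fun p : Z × D => (T p.1, σ p.2)) (prodCount m D) (prodCount m D) := by
  have hmeas : Measurable fun p : Z × D => (T p.1, σ p.2) :=
    (hT.measurable.comp measurable_fst).prodMk ((Measurable.of_discrete (f := σ)).comp measurable_snd)
  refine ⟨hmeas, Measure.ext fun E hE => ?_⟩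
  rw [Measure.map_apply hmeas hE, prodCount_apply hE, prodCount_apply (hmeas hE),
    ← σ.tsum_eq fun d => m {z | (z, d) ∈ E}]
  congr 1; ext d
  exact hT.measure_preimage (measurable_prodMk_right (y := σ d) hE).nullMeasurableSet

end Product

section Popa
variable {G H Z D : Type} [MeasurableSpace Z] [Group G] [Group H] [MulAction G Z] [MulAction H Z]
  {m : Measure Z} [Countable G] [Countable H] (C : Coupling G H m) [MulAction H D] [Countable D]
include C

theorem Coupling.mixing_or_finite (A : Subgroup G) {Θ : Z → H} (hΘ : Eqv H Θ) {E : Set D}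
    (hE : E.Finite) {ε : ℝ≥0∞} (hε : 0 < ε) :
    (∃ a ∈ A, m {z | Θ z = 1 ∧ ∃ d ∈ E, (Θ (a • z))⁻¹ • d ∈ E} < ε) ∨
    ∃ L : Z → Set D, (∀ d, MeasurableSet {z | d ∈ L z}) ∧ (∀ (h : H) z, L (h • z) = h • L z) ∧
      (∀ a ∈ A, ∀ᵐ z ∂m, L (a • z) = L z) ∧ (∀ᵐ z ∂m, (L z).Finite) ∧
      m {z | (L z).Nonempty} ≠ 0 := by
  rw [or_iff_not_imp_left]
  intro hno
  push Not at hno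
  let _ : MeasurableSpace D := ⊤
  have : DiscreteMeasurableSpace D := ⟨fun _ => trivial⟩
  set M := prodCount m D with hM
  have hMH : ∀ h : H, MeasurePreserving (fun p : Z × D => h • p) M M := fun h =>
    prodCount_mp (C.mpH h) (MulAction.toPerm h)
  have hMG : ∀ g : G, MeasurePreserving (fun p : Z × D => (g • p.1, p.2)) M M := fun g =>
    prodCount_mp (C.mpG g) (Equiv.refl D)
  have hΘ' : Eqv H fun p : Z × D => Θ p.1 :=
    ⟨fun s => measurable_fst (hΘ.mf s), fun h p => hΘ.smul h p.1⟩
  have hmp : ∀ g : G, @MeasurePreserving (Z × D) (Z × D) (invσ H (Z × D)) (invσ H (Z × D))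
      (fun p => (g • p.1, p.2)) (mq M fun p : Z × D => Θ p.1) (mq M fun p : Z × D => Θ p.1) :=
    fun g => mq_mp hMH hΘ' (hMG g) (hMG g⁻¹).measurable (by simp)
      (fun h p => by ext <;> simp [C.comm]) (fun h p => by ext <;> simp [C.comm])
  have hBmf : MeasurableSet {p : Z × D | (Θ p.1)⁻¹ • p.2 ∈ E} := by
    have h1 : MF fun p : Z × D => (Θ p.1, p.2) :=
      hΘ'.mf.pair (θ' := Prod.snd) fun s => measurable_snd (MeasurableSet.of_discrete (s := s))
    exact (h1.comp fun q => q.1⁻¹ • q.2).mem E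
  have hB : MeasurableSet[invσ H (Z × D)] {p : Z × D | (Θ p.1)⁻¹ • p.2 ∈ E} :=
    ⟨hBmf, fun h p => by simp [hΘ.mul, smul_smul]⟩
  have hsec : ∀ {F : Set (Z × D)}, MeasurableSet[invσ H (Z × D)] F →
      mq M (fun p : Z × D => Θ p.1) F = ∑' d, m {z | (z, d) ∈ F ∧ Θ z = 1} := fun {F} hF => by
    rw [mq_apply hF, hM, prodCount_apply (hF.1.inter (hΘ'.mf.eq 1))]
    rfl
  have hBeq : mq M (fun p : Z × D => Θ p.1) {p : Z × D | (Θ p.1)⁻¹ • p.2 ∈ E} < ⊤ := by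
    rw [hsec hB]
    have h1 : ∀ d, m {z | (z, d) ∈ {p : Z × D | (Θ p.1)⁻¹ • p.2 ∈ E} ∧ Θ z = 1} =
        E.indicator (fun _ => m {z | Θ z = 1}) d := fun d => by
      by_cases hd : d ∈ E
      · rw [Set.indicator_of_mem hd]
        congr 1; ext z
        simp only [Set.mem_ofPred_eq, and_iff_right_iff_imp]
        intro h; simpa [h] using hd
      · rw [Set.indicator_of_notMem hd]
        convert measure_empty (μ := m)
        ext z
        simp only [Set.mem_ofPred_eq, Set.mem_empty_iff_false, iff_false]
        rintro ⟨h, h'⟩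
        simp [h', hd] at h
    simp only [h1]
    rw [tsum_eq_sum (s := hE.toFinset) fun d hd => Set.indicator_of_notMem (by simpa using hd) _]
    refine ENNReal.sum_lt_top.2 fun d _ => ?_
    exact (Set.indicator_le_self _ _ d).trans_lt (C.dom_lt_top hΘ)
  obtain ⟨δ, hδ, hδε⟩ : ∃ δ : ℝ, 0 < δ ∧ ENNReal.ofReal δ ≤ ε := by
    rcases eq_or_ne ε ⊤ with rfl | h
    · exact ⟨1, one_pos, le_top⟩
    · exact ⟨ε.toReal, ENNReal.toReal_pos hε.ne' h, ENNReal.ofReal_toReal_le⟩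
  obtain ⟨L, hL, hL0, hLtop, hLinv⟩ := @exists_invariant_set A (Z × D) _ _ (invσ H (Z × D))
    (mq M fun p : Z × D => Θ p.1) (fun a p => ((a : G) • p.1, p.2)) (fun a => hmp a)
    (fun a b p => by simp [mul_smul]) _ hB hBeq.ne δ hδ (fun a => by
      refine (ENNReal.ofReal_le_iff_le_toReal (@measure_ne_top_of_subset _ (invσ H (Z × D)) _ _ _
        Set.inter_subset_right hBeq.ne)).1 ?_
      refine hδε.trans ((hno a a.2).trans ?_)
      have h1 : MeasurableSet[invσ H (Z × D)] ((fun p : Z × D => ((a : G) • p.1, p.2)) ⁻¹'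
          {p : Z × D | (Θ p.1)⁻¹ • p.2 ∈ E} ∩ {p : Z × D | (Θ p.1)⁻¹ • p.2 ∈ E}) :=
        @MeasurableSet.inter _ (invσ H (Z × D)) _ _ (@MeasurePreserving.measurable _ _ (invσ H (Z × D)) (invσ H (Z × D)) _ _ _ (hmp a) _ hB) hB
      rw [hsec h1]
      refine le_trans (measure_mono ?_) (measure_iUnion_le _)
      rintro z ⟨hz, d, hd, hd'⟩
      rw [Set.mem_iUnion]
      exact ⟨d, ⟨hd', by simpa [hz] using hd⟩, hz⟩)
  refine ⟨fun z => {d | (z, d) ∈ L}, fun d => measurable_prodMk_right hL.1, fun h z => ?_,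
    fun a ha => ?_, ?_, ?_⟩
  · ext d
    rw [Set.mem_smul_set_iff_inv_smul_mem]
    simp only [Set.mem_ofPred_eq]
    rw [← hL.2 h (z, h⁻¹ • d)]
    simp
  · have h1 := hLinv ⟨a, ha⟩
    have h2 : MeasurableSet[invσ H (Z × D)]
        {p : Z × D | ¬(((a • p.1, p.2) : Z × D) ∈ L ↔ p ∈ L)} := by
      refine ⟨?_, fun h p => ?_⟩
      · have := (((hMG a).measurable hL.1).symmDiff hL.1)
        convert this using 1
        ext p
        simp only [Set.mem_ofPred_eq, Set.mem_symmDiff, Set.mem_preimage]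
        tauto
      · have h3 := hL.2 h p
        have h4 := hL.2 h (a • p.1, p.2)
        simp only [Set.mem_ofPred_eq, h3]
        rw [← h4]
        simp [C.comm]
    have h5 : M {p : Z × D | ¬(((a • p.1, p.2) : Z × D) ∈ L ↔ p ∈ L)} = 0 := by
      refine null_of_domain hMH hΘ' h2.1 h2.2 ?_
      rw [← mq_apply h2]
      exact h1
    rw [hM, prodCount_apply h2.1, ENNReal.tsum_eq_zero] at h5
    have h6 : ∀ᵐ z ∂m, ∀ d, (a • z, d) ∈ L ↔ (z, d) ∈ L := ae_all_iff.2 fun d => h5 d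
    filter_upwards [h6] with z hz
    ext d; exact hz d
  · have h1 : ∑' d, m.restrict {z | Θ z = 1} {z | (z, d) ∈ L} ≠ ⊤ := by
      convert hLtop using 1
      rw [hsec hL]
      congr 1; ext d
      exact Measure.restrict_apply (measurable_prodMk_right hL.1)
    have h2 := ae_finite_setOfPred_mem h1
    rw [ae_restrict_iff' (hΘ.mf.eq 1)] at h2
    filter_upwards [ae_forall_smul C.mpH h2] with z hz
    have h3 := hz (Θ z)⁻¹ (by simp [hΘ.smul])
    have h4 : {d | ((Θ z)⁻¹ • z, d) ∈ L} = (Θ z)⁻¹ • {d | (z, d) ∈ L} := by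
      ext d
      rw [Set.mem_smul_set_iff_inv_smul_mem]
      simp only [Set.mem_ofPred_eq]
      rw [← hL.2 (Θ z)⁻¹ (z, (Θ z)⁻¹⁻¹ • d)]
      simp
    rwa [← Set.finite_smul_set (a := (Θ z)⁻¹), ← h4]
  · intro h
    apply hL0
    rw [hsec hL, ENNReal.tsum_eq_zero]
    exact fun d => measure_mono_null (fun z hz => show Set.Nonempty _ from ⟨d, hz.1⟩) h
end Popa

section Walls
variable {V : Type} {Γ : SimpleGraph V}

instance [Finite V] : Countable (Wall Γ) := by
  have : Function.Surjective fun p : RAAG Γ × V => p.1 • wall Γ p.2 := fun w => by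
    obtain ⟨g, hg⟩ := exists_smul_wall w
    exact ⟨(g, w.1), hg.symm⟩
  exact this.countable

theorem mem_conj_of_smul_eq {F : Set (Wall Γ)} (hF : F.Finite) {w : Wall Γ} (hw : w ∈ F) :
    ∃ g : RAAG Γ, ∀ h : RAAG Γ, h • F = F →
      g⁻¹ * h * g ∈ standardSub Γ (Γ.neighborSet w.1) := by
  obtain ⟨g, hg⟩ := exists_smul_wall w
  refine ⟨g, fun h hh => ?_⟩
  have h1 : ∀ k : ℕ, h ^ k • w ∈ F := fun k => by
    induction k with
    | zero => simpa using hw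
    | succ k ih => rw [pow_succ', mul_smul, ← hh]; exact Set.smul_mem_smul_set ih
  obtain ⟨i, j, hij, he⟩ : ∃ i j : ℕ, i < j ∧ h ^ i • w = h ^ j • w := by
    have : ¬ Function.Injective fun k : ℕ => h ^ k • w := fun hinj =>
      Set.infinite_range_of_injective hinj (hF.subset (by rintro _ ⟨k, rfl⟩; exact h1 k))
    rw [Function.Injective] at this
    push Not at this
    obtain ⟨i, j, he, hij⟩ := this
    rcases lt_or_gt_of_ne hij with h2 | h2
    · exact ⟨i, j, h2, he⟩
    · exact ⟨j, i, h2, he.symm⟩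
  obtain ⟨k, rfl⟩ := Nat.exists_eq_add_of_lt hij
  have h2 : w = h ^ (k + 1) • w := by
    rw [add_assoc, pow_add, mul_smul] at he
    exact MulAction.injective _ he
  refine mem_of_pow_mem (k := k + 1) (by omega) ?_
  rw [hg, smul_smul, smul_wall_eq_iff] at h2
  have h3 : (g⁻¹ * h * g) ^ (k + 1) = g⁻¹ * h ^ (k + 1) * g := by
    simpa using conj_pow (a := g⁻¹) (b := h) (i := k + 1)
  rw [h3, mul_assoc]
  simpa [mul_assoc] using h2
end Walls

section Mixing
variable {G Z : Type} [MeasurableSpace Z] [Group G] [MulAction G Z] {W : Type} [Fintype W]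
  {Λ : SimpleGraph W} [MulAction (RAAG Λ) Z] {m : Measure Z} [Countable G]
  (C : Coupling G (RAAG Λ) m)
include C

theorem Coupling.mixing {A : Subgroup G} (hA : Erg (RAAG Λ) (A : Set G) m) {S : Set W}
    {Θ : Z → RAAG Λ} (hS : Supp m (A : Set G) S Θ) {E : Set (Wall Λ)} (hE : E.Finite)
    (hES : ∀ e ∈ E, e.1 ∈ S) {ε : ℝ≥0∞} (hε : 0 < ε) :
    ∃ a ∈ A, m {z | Θ z = 1 ∧ ∃ d ∈ E, (Θ (a • z))⁻¹ • d ∈ E} < ε := by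
  classical
  let D : SubMulAction (RAAG Λ) (Wall Λ) := ⟨{w | w.1 ∈ S}, fun _ _ h => h⟩
  have : Countable (Wall Λ) := inferInstance
  have : Countable D := Subtype.countable
  rcases C.mixing_or_finite A hS.1.1 (D := D) (E := Subtype.val ⁻¹' E)
    (hE.preimage Subtype.val_injective.injOn) hε with ⟨a, ha, h⟩ | ⟨L, hLm, hLH, hLA, hLf, hL0⟩
  · refine ⟨a, ha, lt_of_eq_of_lt (congrArg m ?_) h⟩
    ext z
    refine and_congr_right fun _ => ⟨?_, ?_⟩
    · rintro ⟨d, hd, hd'⟩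
      exact ⟨⟨d, hES d hd⟩, hd, hd'⟩
    · rintro ⟨d, hd, hd'⟩
      exact ⟨d, hd, hd'⟩
  · exfalso
    let θ : Z → Finset D := fun z => if h : (L z).Finite then h.toFinset else ∅
    have hθL : ∀ z, (L z).Finite → (θ z : Set D) = L z := fun z h => by simp [θ, h]
    have hθ0 : ∀ z, ¬ (L z).Finite → θ z = ∅ := fun z h => by simp [θ, h]
    have hfin : ∀ (h : RAAG Λ) z, (L (h • z)).Finite ↔ (L z).Finite := fun h z => by
      rw [hLH, Set.finite_smul_set]
    have hθ : Eqv (RAAG Λ) θ := by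
      constructor
      · have h1 : ∀ F : Finset D, MeasurableSet {z | L z = F} := fun F => by
          have : {z | L z = F} = ⋂ d : D, {z | d ∈ L z ↔ d ∈ F} := by
            ext z; simp [Set.ext_iff]
          rw [this]
          refine MeasurableSet.iInter fun d => ?_
          by_cases hd : d ∈ F
          · simpa [hd] using hLm d
          · simp only [hd, iff_false]
            exact (hLm d).compl
        have h2 : MeasurableSet {z | (L z).Finite} := by
          have : {z | (L z).Finite} = ⋃ F : Finset D, {z | L z = F} := by
            ext z
            simp only [Set.mem_ofPred_eq, Set.mem_iUnion]
            exact ⟨fun h => ⟨h.toFinset, by simp⟩, fun ⟨F, hF⟩ => hF ▸ F.finite_toSet⟩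
          rw [this]
          exact MeasurableSet.iUnion h1
        refine MF.of_fibers fun F => ?_
        have : θ ⁻¹' {F} = {z | L z = F} ∪ ({z | (L z).Finite}ᶜ ∩ {_z | F = ∅}) := by
          ext z
          simp only [Set.mem_preimage, Set.mem_singleton_iff, Set.mem_union, Set.mem_ofPred_eq,
            Set.mem_inter_iff, Set.mem_compl_iff]
          by_cases hf : (L z).Finite
          · rw [← Finset.coe_inj, hθL z hf]; simp [hf]
          · rw [hθ0 z hf]
            constructor
            · exact fun h => Or.inr ⟨hf, h.symm⟩
            · rintro (h | h)
              · exact absurd (h ▸ F.finite_toSet) hf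
              · exact h.2.symm
        rw [this]
        exact (h1 F).union (h2.compl.inter (MeasurableSet.const _))
      · intro h z
        by_cases hf : (L z).Finite
        · rw [← Finset.coe_inj, hθL _ ((hfin h z).2 hf), Finset.coe_smul_finset, hθL _ hf, hLH]
        · rw [hθ0 _ hf, hθ0 _ (fun h' => hf ((hfin h z).1 h')), Finset.smul_finset_empty]
    obtain ⟨d₀, Φ, hΦ, hd₀⟩ := C.exists_gauge hA hθ fun a ha => by
      filter_upwards [hLA a ha] with z hz
      simp only [θ, hz]
    have hne : ∀ᵐ z ∂m, (L z).Nonempty := by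
      have hmeas : MeasurableSet {z | (L z).Nonempty} := by
        have : {z | (L z).Nonempty} = ⋃ d, {z | d ∈ L z} := by ext z; simp [Set.Nonempty]
        rw [this]
        exact MeasurableSet.iUnion hLm
      refine (hA _ hmeas (fun h z => ?_) fun a ha => ?_).resolve_left hL0
      · simp [hLH]
      · filter_upwards [hLA a ha] with z hz
        simp [hz]
    have : (ae m).NeBot := ae_neBot.2 C.ne_zero
    have hd : ∃ d, d ∈ d₀ := by
      obtain ⟨z, h1, h2, h3⟩ := (hd₀.and (hne.and hLf)).exists
      obtain ⟨d, hd⟩ := h2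
      rw [← hθL z h3, ← h1, Finset.mem_coe, Finset.mem_smul_finset] at hd
      obtain ⟨e, he, -⟩ := hd
      exact ⟨e, he⟩
    obtain ⟨d, hd⟩ := hd
    obtain ⟨g, hg⟩ := mem_conj_of_smul_eq (F := Subtype.val '' (d₀ : Set D))
      (d₀.finite_toSet.image _) (w := d.1) ⟨d, hd, rfl⟩
    have hred : Red (A : Set G) (standardSub Λ (Λ.neighborSet d.1.1)) m := by
      refine ⟨fun z => Φ z * g, hΦ.mul_right g, fun a ha => ?_⟩
      filter_upwards [hd₀, C.ae_smul hd₀ a, hLA a ha] with z h1 h2 h3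
      have h4 : Φ (a • z) • d₀ = Φ z • d₀ := by
        rw [h1, h2]; simp only [θ, h3]
      have h5 : ((Φ z)⁻¹ * Φ (a • z)) • d₀ = d₀ := by
        rw [mul_smul, h4, inv_smul_smul]
      have := hg ((Φ z)⁻¹ * Φ (a • z)) (by
        conv_rhs => rw [← h5]
        rw [Finset.coe_smul_finset]
        ext w
        simp only [Set.mem_smul_set, Set.mem_image]
        constructor
        · rintro ⟨_, ⟨e, he, rfl⟩, rfl⟩
          exact ⟨_, ⟨e, he, rfl⟩, rfl⟩
        · rintro ⟨_, ⟨e, he, rfl⟩, rfl⟩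
          exact ⟨_, ⟨e, he, rfl⟩, rfl⟩)
      simpa [mul_assoc] using this
    exact Λ.loopless.irrefl _ (hS.2 _ hred d.2)

end Mixing

section Num
variable {ι K : Type} [Fintype ι]

/-- The number of indices `i` with `f i ∈ E`. -/
noncomputable def num (f : ι → K) (E : Set K) : ℝ := ∑ i, E.indicator (fun _ => (1 : ℝ)) (f i)

open Classical in
theorem num_mul_tr {V : Type} [Fintype V] {Γ : SimpleGraph V} (N : ℕ) (g x : RAAG Γ)
    (E : Set (RAAG Γ)) :
    num (fun n : V → Fin N => g * tr (bd n) x) E = cnt N x (g⁻¹ • E) := by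
  rw [num, cnt, Finset.card_filter]
  push_cast
  refine Finset.sum_congr rfl fun n _ => ?_
  simp [Set.indicator_apply, Set.mem_smul_set_iff_inv_smul_mem]

theorem cnt_conj {V : Type} [Fintype V] {Γ : SimpleGraph V} {N R : ℕ} (hN : 0 < N) {S : Set V}
    {s u u' : RAAG Γ} (hu' : u' ∈ standardSub Γ S) (hR : len u ≤ R) (hR' : len u' ≤ R)
    (hs : ∀ e ∈ ballWalls Γ (Fintype.card V * N) ∪ ballWalls Γ R, e.1 ∈ S →
      s • e ∉ ballWalls Γ (Fintype.card V * N) ∪ ballWalls Γ R) (E : Set (RAAG Γ)) :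
    |(cnt N (u⁻¹ * s * u') (u⁻¹ • E) : ℝ) - cnt N s E| ≤ R / N * N ^ Fintype.card V := by
  have h1 := cnt_mul hN u⁻¹ (s * u') (u⁻¹ • E)
  rw [inv_inv, smul_inv_smul, len_inv, cnt_congr (E := E) (y := s) fun n => tr_mul_right
    fun e he => ?_] at h1
  · have h2 : (|(N * cnt N (u⁻¹ * s * u') (u⁻¹ • E) : ℝ) - N * cnt N s E|) ≤
        len u * N ^ Fintype.card V := by
      rw [mul_assoc u⁻¹]; exact_mod_cast h1
    have hN' : (0 : ℝ) < N := by exact_mod_cast hN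
    rw [← mul_sub, abs_mul, abs_of_pos hN'] at h2
    rw [div_mul_eq_mul_div, le_div_iff₀ hN', mul_comm]
    refine h2.trans ?_
    gcongr
  · have he1 : e ∈ ballWalls Γ R := Set.mem_biUnion (show u' ∈ {x | len x ≤ R} from hR') he
    have := hs e (Or.inr he1) (mem_standardSub.1 hu' e he)
    exact ⟨fun h => this (Or.inl (W_tr_subset n _ h)), fun h => this (Or.inl (W_tr_subset n _ h))⟩

end Num

section Amen
variable {G H Z : Type} [MeasurableSpace Z] [Group G] [Group H] [MulAction G Z] [MulAction H Z]

/-- There are finite families of equivariant maps, almost invariant under the elements of `F`. -/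
def Amen (m : Measure Z) (ρ : H →* H) (Θ : Z → H) (F : Set G) : Prop :=
  ∀ ε : ℝ, 0 < ε → ∃ (ι : Type) (_ : Fintype ι) (_ : Nonempty ι) (κ : ι → Z → H) (O : Set Z),
    (∀ i, MF (κ i)) ∧ (∀ i h z, κ i (h • z) = ρ h * κ i z) ∧ MeasurableSet O ∧
    (∀ (h : H) z, h • z ∈ O ↔ z ∈ O) ∧ m (Oᶜ ∩ {z | Θ z = 1}) ≤ ENNReal.ofReal ε ∧
    ∀ p ∈ F, ∀ z ∈ O, ∀ E, |num (κ · (p • z)) E - num (κ · z) E| ≤ ε * Fintype.card ι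

end Amen

section Families
variable {G Z : Type} [MeasurableSpace Z] [Group G] [MulAction G Z] {W : Type} [Fintype W]
  {Λ : SimpleGraph W} [MulAction (RAAG Λ) Z] {m : Measure Z} [Countable G]
  (C : Coupling G (RAAG Λ) m)
include C

theorem Coupling.exists_bound {Θ : Z → RAAG Λ} (hΘ : Eqv (RAAG Λ) Θ) {F : Set G} (hF : F.Finite)
    (ρ : RAAG Λ →* RAAG Λ) {ε : ℝ≥0∞} (hε : 0 < ε) :
    ∃ R, ∀ p ∈ F, m ({z | ¬ len (ρ ((Θ z)⁻¹ * Θ (p • z))) ≤ R} ∩ {z | Θ z = 1}) < ε := by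
  have := C.isFinite hΘ
  have hmf : ∀ p : G, MF fun z => ρ ((Θ z)⁻¹ * Θ (p • z)) := fun p =>
    (hΘ.mf.pair (C.eqv_smul hΘ p).mf).comp fun q => ρ (q.1⁻¹ * q.2)
  have h1 : ∀ p : G, ∃ R, m ({z | ¬ len (ρ ((Θ z)⁻¹ * Θ (p • z))) ≤ R} ∩ {z | Θ z = 1}) < ε :=
    fun p => by
    obtain ⟨K, hK, hlt⟩ := tight (μ := m.restrict {z | Θ z = 1}) (hmf p) hε
    obtain ⟨R, hR⟩ := (hK.image len).bddAbove
    refine ⟨R, lt_of_le_of_lt ?_ hlt⟩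
    refine le_of_le_of_eq (measure_mono ?_) (Measure.restrict_apply ((hmf p).mem Kᶜ)).symm
    exact fun z hz => ⟨fun h => hz.1 (hR ⟨_, h, rfl⟩), hz.2⟩
  choose R hR using h1
  obtain ⟨B, hB⟩ := (hF.image R).bddAbove
  exact ⟨B, fun p hp => (measure_mono (Set.inter_subset_inter_left _ fun z
    (hz : ¬ len (ρ ((Θ z)⁻¹ * Θ (p • z))) ≤ B) h =>
    hz (le_trans h (hB ⟨p, hp, rfl⟩)))).trans_lt (hR p)⟩

open Classical in
theorem Coupling.amen_of_supp {A : Subgroup G} (hA : Erg (RAAG Λ) (A : Set G) m) {S : Set W}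
    {Θ : Z → RAAG Λ} (hS : Supp m (A : Set G) S Θ) {F : Set G} (hF : F.Finite)
    (hFA : ∀ p ∈ F, ∀ a ∈ A, Commute p a) {ρ : RAAG Λ →* RAAG Λ}
    (hρ : ∀ x ∈ standardSub Λ S, ρ x = x)
    (hρ' : ∀ x ∈ standardSub Λ (S ∪ lk Λ S), ρ x ∈ standardSub Λ S) : Amen m ρ Θ F := by
  intro ε hε
  have hΘ := hS.1.1
  set n := F.ncard with hn
  set δ : ℝ≥0∞ := ENNReal.ofReal ε / (2 * n + 1) with hδ
  have hδ0 : 0 < δ := ENNReal.div_pos (ENNReal.ofReal_pos.2 hε).ne'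
    (by simpa using ENNReal.mul_ne_top (by simp) (by simp))
  obtain ⟨R, hR⟩ := C.exists_bound hΘ hF ρ hδ0
  obtain ⟨N, hN⟩ := exists_nat_gt (R / ε : ℝ)
  have hN0 : (0 : ℝ) < N := lt_of_le_of_lt (by positivity) hN
  have hN1 : 0 < N := by exact_mod_cast hN0
  set B := ballWalls Λ (Fintype.card W * N) ∪ ballWalls Λ R with hB
  obtain ⟨a, ha, haE⟩ := C.mixing hA hS (E := {e ∈ B | e.1 ∈ S})
    (((finite_ballWalls _).union (finite_ballWalls _)).subset (Set.sep_subset _ _))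
    (fun e he => he.2) hδ0
  set t : G → Z → RAAG Λ := fun p z => (Θ z)⁻¹ * Θ (p • z) with ht
  have htmf : ∀ p, MF (t p) := fun p =>
    (hΘ.mf.pair (C.eqv_smul hΘ p).mf).comp fun q => q.1⁻¹ * q.2
  have htinv : ∀ p (h : RAAG Λ) z, t p (h • z) = t p z := fun p h z => by
    simp only [ht, C.comm p h z, hΘ.mul]; group
  let O : Set Z := {z | t a z ∈ standardSub Λ S ∧ (∀ e ∈ B, e.1 ∈ S → t a z • e ∉ B) ∧
    ∀ p ∈ F, t a (p • z) ∈ standardSub Λ S ∧ t p z ∈ standardSub Λ (S ∪ lk Λ S) ∧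
      t p (a • z) ∈ standardSub Λ (S ∪ lk Λ S) ∧ len (ρ (t p z)) ≤ R ∧ len (ρ (t p (a • z))) ≤ R}
  have hO : MeasurableSet O := by
    refine ((htmf a).mem {x | x ∈ standardSub Λ S ∧ ∀ e ∈ B, e.1 ∈ S → x • e ∉ B}).inter
      (MeasurableSet.biInter hF.countable fun p _ =>
      (((htmf a).comp_measurable (C.mpG p).measurable).mem (standardSub Λ S)).inter
      (((htmf p).mem {x | x ∈ standardSub Λ (S ∪ lk Λ S) ∧ len (ρ x) ≤ R}).inter
      (((htmf p).comp_measurable (C.mpG a).measurable).mem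
        {x | x ∈ standardSub Λ (S ∪ lk Λ S) ∧ len (ρ x) ≤ R}))) |>.congr ?_
    ext z
    simp only [O, Set.mem_inter_iff, Set.mem_iInter, Set.mem_ofPred_eq, SetLike.mem_coe, and_assoc]
    refine and_congr_right fun _ => and_congr_right fun _ => forall₂_congr fun p _ => ?_
    tauto
  have hOinv : ∀ (h : RAAG Λ) z, h • z ∈ O ↔ z ∈ O := fun h z => by
    simp only [O, Set.mem_ofPred_eq, htinv, C.comm]
  refine ⟨W → Fin N, inferInstance, ⟨fun _ => ⟨0, hN1⟩⟩, fun i z => ρ (Θ z) * tr (bd i) (t a z), O,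
    fun i => (hΘ.mf.pair (htmf a)).comp fun q => ρ q.1 * tr (bd i) q.2, fun i h z => ?_, hO,
    hOinv, ?_, fun p hp z hz E => ?_⟩
  · simp only [htinv, hΘ.mul, map_mul, mul_assoc]
  · set X : G → Set Z := fun p => {z | ¬ len (ρ (t p z)) ≤ R} with hX
    have hXm : ∀ p, MeasurableSet (X p) := fun p => (htmf p).mem {x | ¬ len (ρ x) ≤ R}
    have hXi : ∀ p (h : RAAG Λ) z, h • z ∈ X p ↔ z ∈ X p := fun p h z => by
      simp only [hX, Set.mem_ofPred_eq, htinv]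
    have hsub : (Oᶜ ∩ {z | Θ z = 1} : Set Z) ≤ᵐ[m]
        ({z | Θ z = 1 ∧ ∃ d ∈ {e ∈ B | e.1 ∈ S}, (Θ (a • z))⁻¹ • d ∈ {e ∈ B | e.1 ∈ S}} ∪
        ⋃ p ∈ hF.toFinset, (X p ∩ {z | Θ z = 1} ∪ {z | a • z ∈ X p} ∩ {z | Θ z = 1}) : Set Z) := by
      have h1 : ∀ᵐ z ∂m, ∀ p ∈ F, t a (p • z) ∈ standardSub Λ S ∧
          t p z ∈ standardSub Λ (S ∪ lk Λ S) ∧ t p (a • z) ∈ standardSub Λ (S ∪ lk Λ S) := by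
        rw [ae_ball_iff hF.countable]
        intro p hp
        have h2 := C.commuting_mem hA hS (hFA p hp)
        filter_upwards [C.ae_smul (hS.1.2 a ha) p, h2, C.ae_smul h2 a] with z h3 h4 h5
        exact ⟨h3, h4, h5⟩
      filter_upwards [hS.1.2 a ha, h1] with z h2 h3
      rintro ⟨hz, hz1⟩
      by_contra hcon
      have hcon2 : ∀ p ∈ F, z ∉ X p ∩ {z | Θ z = 1} ∪ {z | a • z ∈ X p} ∩ {z | Θ z = 1} :=
        fun p hp h => hcon (Or.inr (Set.mem_biUnion (hF.mem_toFinset.2 hp) h))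
      refine hz ⟨h2, fun e he heS hbad => hcon (Or.inl ⟨hz1, t a z • e, ⟨hbad, heS⟩, ?_⟩),
        fun p hp => ?_⟩
      · have hz1 : Θ z = 1 := hz1
        simpa [ht, hz1] using ⟨he, heS⟩
      · obtain ⟨h4, h5, h6⟩ := h3 p hp
        exact ⟨h4, h5, h6, not_not.1 fun h => hcon2 p hp (Or.inl ⟨h, hz1⟩),
          not_not.1 fun h => hcon2 p hp (Or.inr ⟨h, hz1⟩)⟩
    refine (measure_mono_ae hsub).trans ((measure_union_le _ _).trans ?_)
    calc _ ≤ δ + ∑ p ∈ hF.toFinset, (δ + δ) := by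
          refine add_le_add haE.le ((measure_biUnion_finset_le _ _).trans
            (Finset.sum_le_sum fun p hp => (measure_union_le _ _).trans ?_))
          rw [C.exchange_smul hΘ a (hXm p) (hXi p)]
          have := (hR p (hF.mem_toFinset.1 hp)).le
          exact add_le_add this this
      _ = δ * (2 * n + 1) := by
          rw [Finset.sum_const, ← Set.ncard_eq_toFinset_card F hF, ← hn, nsmul_eq_mul]; ring
      _ = ENNReal.ofReal ε := ENNReal.div_mul_cancel (by simp)
          (by simpa using ENNReal.mul_ne_top (by simp) (by simp))
  · obtain ⟨h1, h2, h3⟩ := hz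
    obtain ⟨h4, h5, h6, h7, h8⟩ := h3 p hp
    have hcomm : t a (p • z) = (t p z)⁻¹ * t a z * t p (a • z) := by
      simp only [ht, smul_smul, (hFA p hp a ha).eq]; group
    have hconj : t a (p • z) = (ρ (t p z))⁻¹ * t a z * ρ (t p (a • z)) := by
      rw [← hρ _ h4, hcomm, map_mul, map_mul, hρ _ h1, map_inv]
    have hΘp : ρ (Θ (p • z)) = ρ (Θ z) * ρ (t p z) := by rw [← map_mul]; simp [ht]
    have h9 := cnt_conj (Γ := Λ) hN1 (hρ' _ h6) h7 h8 h2 ((ρ (Θ z))⁻¹ • E)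
    rw [num_mul_tr, num_mul_tr, hconj, hΘp, mul_inv_rev, mul_smul]
    refine h9.trans ?_
    rw [Fintype.card_fun, Fintype.card_fin]
    push_cast
    gcongr
    rw [div_le_iff₀ hN0, mul_comm]
    exact ((div_lt_iff₀ hε).1 hN).le

end Families

section Core
variable {Ω ι K : Type} [MeasurableSpace Ω] [Fintype ι] {μ : Measure Ω}

theorem num_nonneg (f : ι → K) (E : Set K) : 0 ≤ num f E :=
  Finset.sum_nonneg fun _ _ => Set.indicator_nonneg (fun _ _ => zero_le_one) _

theorem num_le_card (f : ι → K) (E : Set K) : num f E ≤ Fintype.card ι := by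
  have : num f E ≤ ∑ _i : ι, (1 : ℝ) :=
    Finset.sum_le_sum fun _ _ => Set.indicator_le_self' (fun _ _ => zero_le_one) _
  simpa using this

theorem num_congr {K' : Type} {f : ι → K} {f' : ι → K'} {E : Set K} {E' : Set K'}
    (h : ∀ i, f i ∈ E ↔ f' i ∈ E') : num f E = num f' E' :=
  Finset.sum_congr rfl fun i _ => by
    by_cases hi : f i ∈ E
    · rw [Set.indicator_of_mem hi, Set.indicator_of_mem ((h i).1 hi)]
    · rw [Set.indicator_of_notMem hi, Set.indicator_of_notMem fun h' => hi ((h i).2 h')]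

omit [MeasurableSpace Ω] in
theorem num_eq_sum {θ : ι → Ω → K} (E : Set K) (z : Ω) :
    num (θ · z) E = ∑ i, (θ i ⁻¹' E).indicator (fun _ => (1 : ℝ)) z := rfl

variable [IsFiniteMeasure μ]

theorem integrable_num {θ : ι → Ω → K} (h : ∀ i, MF (θ i)) (E : Set K) :
    Integrable (fun z => num (θ · z) E) μ := by
  simp only [num_eq_sum]
  exact integrable_finsetSum _ fun i _ => (integrable_const _).indicator (h i E)

theorem integral_num {θ : ι → Ω → K} (h : ∀ i, MF (θ i)) (E : Set K) :
    ∫ z, num (θ · z) E ∂μ = ∑ i, μ.real (θ i ⁻¹' E) := by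
  simp only [num_eq_sum]
  rw [integral_finsetSum _ fun i _ => (integrable_const _).indicator (h i E)]
  refine Finset.sum_congr rfl fun i _ => ?_
  rw [integral_indicator_const _ (h i E), smul_eq_mul, mul_one]

theorem sum_real_close [Nonempty ι] {θ θ' : ι → Ω → K} (h : ∀ i, MF (θ i)) (h' : ∀ i, MF (θ' i))
    {E E' : Set K} {O : Set Ω} (hO : MeasurableSet O) {ε : ℝ} (hε : 0 < ε)
    (hOε : μ Oᶜ ≤ ENNReal.ofReal ε)
    (hclose : ∀ z ∈ O, |num (θ' · z) E - num (θ · z) E'| ≤ ε * Fintype.card ι) :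
    |∑ i, μ.real (θ' i ⁻¹' E) - ∑ i, μ.real (θ i ⁻¹' E')| ≤
      ε * (μ.real Set.univ + 1) * Fintype.card ι := by
  rw [← integral_num h, ← integral_num h', ← integral_sub (integrable_num h' E) (integrable_num h E')]
  refine (abs_integral_le_integral_abs).trans ?_
  have hc : (0 : ℝ) ≤ Fintype.card ι := by positivity
  have hb : ∀ z, |num (θ' · z) E - num (θ · z) E'| ≤
      ε * Fintype.card ι + Oᶜ.indicator (fun _ => (Fintype.card ι : ℝ)) z := fun z => by
    by_cases hz : z ∈ O
    · rw [Set.indicator_of_notMem (by simpa using hz), add_zero]; exact hclose z hz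
    · rw [Set.indicator_of_mem (by simpa using hz), abs_le]
      have h1 := num_nonneg (θ' · z) E
      have h2 := num_nonneg (θ · z) E'
      have h3 := num_le_card (θ' · z) E
      have h4 := num_le_card (θ · z) E'
      have h5 : 0 ≤ ε * Fintype.card ι := by positivity
      constructor <;> linarith
  refine (integral_mono ((integrable_num h' E).sub (integrable_num h E')).abs
    ((integrable_const _).add ((integrable_const _).indicator hO.compl)) hb).trans ?_
  have h6 : μ.real Oᶜ ≤ ε := ENNReal.toReal_le_of_le_ofReal hε.le hOε
  rw [integral_add' (integrable_const _) ((integrable_const _).indicator hO.compl),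
    integral_indicator_const _ hO.compl, integral_const, smul_eq_mul, smul_eq_mul]
  nlinarith

theorem measure_eq_zero_of_paradox {K : Type} [Group K] {a c : K} (hP : Paradox a c)
    (h : ∀ ε : ℝ, 0 < ε → ∃ (ι : Type) (_ : Fintype ι) (_ : Nonempty ι) (θ : ι → Ω → K),
      (∀ i, MF (θ i)) ∧ ∀ p ∈ ({a, c} : Set K), ∃ (θ' : ι → Ω → K) (O : Set Ω),
      (∀ i, MF (θ' i)) ∧ (∀ i E, μ (θ' i ⁻¹' E) = μ (θ i ⁻¹' E)) ∧ MeasurableSet O ∧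
      μ Oᶜ ≤ ENNReal.ofReal ε ∧
      ∀ z ∈ O, ∀ E, |num (θ' · z) E - num (θ · z) (p⁻¹ • E)| ≤ ε * Fintype.card ι) : μ = 0 := by
  set t := μ.real Set.univ with ht
  have ht0 : 0 ≤ t := measureReal_nonneg
  have key : ∀ ε : ℝ, 0 < ε → t ≤ 2 * (ε * (t + 1)) := by
    intro ε hε
    obtain ⟨ι, _, _, θ, hθ, hp⟩ := h ε hε
    set ν : Set K → ℝ := fun E => ∑ i, μ.real (θ i ⁻¹' E) with hν
    have hc : (0 : ℝ) < Fintype.card ι := by exact_mod_cast Fintype.card_pos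
    have hadd : ∀ E F, Disjoint E F → ν (E ∪ F) = ν E + ν F := fun E F hEF => by
      simp only [hν, Set.preimage_union, ← Finset.sum_add_distrib]
      exact Finset.sum_congr rfl fun i _ =>
        measureReal_union (hEF.preimage _) (hθ i F)
    have hmono : ∀ E F, E ⊆ F → ν E ≤ ν F := fun E F hEF =>
      Finset.sum_le_sum fun i _ => measureReal_mono (Set.preimage_mono hEF)
    have huniv : ν Set.univ = Fintype.card ι * t := by simp [hν, ht]
    have hclose : ∀ p ∈ ({a, c} : Set K), ∀ E, ν (p • E) ≤ ν E + ε * (t + 1) * Fintype.card ι := by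
      intro p hpm E
      obtain ⟨θ', O, h1, h2, h3, h4, h5⟩ := hp p hpm
      have h6 := sum_real_close hθ h1 h3 hε h4 fun z hz => h5 z hz (p • E)
      have h7 : ∑ i, μ.real (θ' i ⁻¹' (p • E)) = ν (p • E) :=
        Finset.sum_congr rfl fun i _ => congrArg ENNReal.toReal (h2 i _)
      rw [h7, inv_smul_smul] at h6
      have := (abs_le.1 h6).2
      simp only [hν] at this ⊢
      linarith
    obtain ⟨A₁, A₂, C₁, C₂, hA, hC, hAC, hA', hC'⟩ := hP
    have hcov : ∀ p ∈ ({a, c} : Set K), ∀ E F : Set K, Disjoint E F → (∀ g, g ∈ E ∨ p⁻¹ * g ∈ F) →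
        Fintype.card ι * t ≤ ν (E ∪ F) + ε * (t + 1) * Fintype.card ι := by
      intro p hpm E F hEF hcv
      have h1 : ν Set.univ ≤ ν E + ν (p • F) := by
        have : (Set.univ : Set K) ⊆ E ∪ p • F := fun g _ =>
          (hcv g).imp id fun h => Set.mem_smul_set_iff_inv_smul_mem.2 h
        refine (hmono _ _ this).trans ?_
        simp only [hν, Set.preimage_union, ← Finset.sum_add_distrib]
        exact Finset.sum_le_sum fun i _ => measureReal_union_le _ _
      rw [hadd E F hEF, ← huniv]
      linarith [hclose p hpm F]
    have h1 := hcov a (by simp) _ _ hA hA'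
    have h2 := hcov c (by simp) _ _ hC hC'
    have h3 := hmono _ _ (Set.subset_univ ((A₁ ∪ A₂) ∪ (C₁ ∪ C₂)))
    rw [hadd _ _ hAC, huniv] at h3
    have h4 : Fintype.card ι * t ≤ Fintype.card ι * (2 * (ε * (t + 1))) := by linarith
    exact le_of_mul_le_mul_left h4 hc
  have : t = 0 := by
    refine le_antisymm (le_of_forall_pos_le_add fun δ hδ => ?_) ht0
    have := key (δ / (2 * (t + 1))) (by positivity)
    rw [zero_add]
    refine this.trans (le_of_eq ?_)
    field_simp
  rw [ht, measureReal_eq_zero_iff] at this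
  exact Measure.measure_univ_eq_zero.1 this
end Core

section Clique
variable {G Z : Type} [MeasurableSpace Z] [Group G] [MulAction G Z] {W : Type} [Fintype W]
  {Λ : SimpleGraph W} [MulAction (RAAG Λ) Z] {m : Measure Z} [Countable G]
  (C : Coupling G (RAAG Λ) m)
include C

open Classical in
theorem Coupling.amen_of_clique {F : Set G} (hF : F.Finite) {M : Set W} (hM : Clq Λ M)
    {Θ : Z → RAAG Λ} (hΘ : RedBy F (standardSub Λ M) m Θ) : Amen m (MonoidHom.id _) Θ F := by
  intro ε hε
  set n := F.ncard with hn
  set δ : ℝ≥0∞ := ENNReal.ofReal ε / (n + 1) with hδ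
  have hδ0 : 0 < δ := ENNReal.div_pos (ENNReal.ofReal_pos.2 hε).ne' (by simp)
  obtain ⟨R, hR⟩ := C.exists_bound hΘ.1 hF (MonoidHom.id _) hδ0
  obtain ⟨N, hN⟩ := exists_nat_gt (R / ε : ℝ)
  have hN0 : (0 : ℝ) < N := lt_of_le_of_lt (by positivity) hN
  have hN1 : 0 < N := by exact_mod_cast hN0
  set t : G → Z → RAAG Λ := fun p z => (Θ z)⁻¹ * Θ (p • z) with ht
  have htmf : ∀ p, MF (t p) := fun p =>
    (hΘ.1.mf.pair (C.eqv_smul hΘ.1 p).mf).comp fun q => q.1⁻¹ * q.2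
  have htinv : ∀ p (h : RAAG Λ) z, t p (h • z) = t p z := fun p h z => by
    simp only [ht, C.comm p h z, hΘ.1.mul]; group
  obtain ⟨x, hx⟩ := folner hM (F := {t | t ∈ standardSub Λ M ∧ len t ≤ R})
    ((finite_ball R).subset fun _ h => h.2) (fun _ h => h.1) hN1 (fun _ h => h.2)
  set X : G → Set Z := fun p => {z | ¬ len (t p z) ≤ R} with hX
  let O : Set Z := {z | ∀ p ∈ F, t p z ∈ {t | t ∈ standardSub Λ M ∧ len t ≤ R}}
  refine ⟨W → Fin N, inferInstance, ⟨fun _ => ⟨0, hN1⟩⟩, fun i z => Θ z * tr (bd i) x, O,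
    fun i => hΘ.1.mf.comp (· * _), fun i h z => by simp [hΘ.1.mul, mul_assoc], ?_,
    fun h z => by simp only [O, Set.mem_ofPred_eq, htinv], ?_, fun p hp z hz E => ?_⟩
  · refine (MeasurableSet.biInter hF.countable fun p _ => (htmf p).mem
      {t | t ∈ standardSub Λ M ∧ len t ≤ R}).congr ?_
    ext z; simp [O]
  · have hsub : (Oᶜ ∩ {z | Θ z = 1} : Set Z) ≤ᵐ[m]
        (⋃ p ∈ hF.toFinset, X p ∩ {z | Θ z = 1} : Set Z) := by
      filter_upwards [(ae_ball_iff hF.countable).2 hΘ.2] with z h1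
      rintro ⟨hz, hz1⟩
      by_contra hcon
      exact hz fun p hp => ⟨h1 p hp, not_not.1 fun h =>
        hcon (Set.mem_biUnion (hF.mem_toFinset.2 hp) ⟨h, hz1⟩)⟩
    refine (measure_mono_ae hsub).trans ((measure_biUnion_finset_le _ _).trans ?_)
    calc _ ≤ ∑ p ∈ hF.toFinset, δ := Finset.sum_le_sum fun p hp => (hR p (hF.mem_toFinset.1 hp)).le
      _ = δ * n := by
          rw [Finset.sum_const, ← Set.ncard_eq_toFinset_card F hF, ← hn, nsmul_eq_mul, mul_comm]
      _ ≤ δ * (n + 1) := by gcongr; exact le_self_add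
      _ = ENNReal.ofReal ε := ENNReal.div_mul_cancel (by simp) (by simp)
  · have h1 := hx _ (hz p hp) ((Θ z)⁻¹ • E)
    have h2 : Θ (p • z) = Θ z * t p z := by simp [ht]
    rw [num_mul_tr, num_mul_tr, h2, mul_inv_rev, mul_smul]
    have h3 : |(N * cnt N x ((t p z)⁻¹ • (Θ z)⁻¹ • E) : ℝ) - N * cnt N x ((Θ z)⁻¹ • E)| ≤
      R * N ^ Fintype.card W := by exact_mod_cast h1
    rw [← mul_sub, abs_mul, abs_of_pos hN0, ← le_div_iff₀' hN0] at h3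
    refine h3.trans ?_
    rw [Fintype.card_fun, Fintype.card_fin]
    push_cast
    rw [div_le_iff₀ hN0]
    have := ((div_lt_iff₀ hε).1 hN).le
    calc (R : ℝ) * N ^ Fintype.card W ≤ (N * ε) * N ^ Fintype.card W := by gcongr
      _ = _ := by ring
end Clique

section NonAmenable
variable {G H Z : Type} [MeasurableSpace Z] [Group G] [Group H] [MulAction G Z] [MulAction H Z]
  {m : Measure Z} [Countable G] [Countable H] (C : Coupling G H m)
include C

theorem Coupling.not_amen {Θ : Z → H} (hΘ : Eqv H Θ) {a c : G} (hP : Paradox a c)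
    (h : Amen m (MonoidHom.id H) Θ {a, c}) : False := by
  have := C.isFinite hΘ
  have hz : m.restrict {z | Θ z = 1} = 0 := by
    refine measure_eq_zero_of_paradox hP fun ε hε => ?_
    obtain ⟨ι, _, _, κ, O, hκ, hκH, hO, hOH, hOε, hcl⟩ := h ε hε
    set θ : ι → Z → G := fun i z => C.rG ((κ i z)⁻¹ • z) with hθ
    have hθm : ∀ i, MF (θ i) := fun i =>
      (hκ i).select fun k => C.eqvG.mf.comp_measurable (C.mpH k⁻¹).measurable
    have hθH : ∀ i (h : H) z, θ i (h • z) = θ i z := fun i h z => by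
      simp only [hθ, hκH, MonoidHom.id_apply, smul_smul]; congr 2; group
    refine ⟨ι, inferInstance, inferInstance, θ, hθm, fun p hp => ⟨fun i z => θ i (p • z), O,
      fun i => (hθm i).comp_measurable (C.mpG p).measurable, fun i E => ?_, hO, ?_,
      fun z hz E => ?_⟩⟩
    · rw [Measure.restrict_apply (hθm i E),
        Measure.restrict_apply ((hθm i).comp_measurable (C.mpG p).measurable E)]
      exact C.exchange_smul hΘ p (hθm i E) fun h z => by simp [hθH]
    · rwa [Measure.restrict_apply hO.compl]
    · have h1 := hcl p hp z hz {k | p * C.rG (k⁻¹ • z) ∈ E}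
      rw [num_congr (f' := (κ · (p • z))) (E' := {k | p * C.rG (k⁻¹ • z) ∈ E}) fun i => by
          simp [hθ, ← C.comm, C.eqvG.mul],
        num_congr (f := (θ · z)) (f' := (κ · z)) (E' := {k | p * C.rG (k⁻¹ • z) ∈ E}) fun i => by
          simp [hθ, Set.mem_smul_set_iff_inv_smul_mem]]
      exact h1
  rw [Measure.restrict_eq_zero] at hz
  exact C.dom_ne_zero hΘ hz

end NonAmenable

section Consequences
variable {G Z : Type} [MeasurableSpace Z] [Group G] [MulAction G Z] {W : Type} [Fintype W]
  {Λ : SimpleGraph W} [MulAction (RAAG Λ) Z] {m : Measure Z} [Countable G]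
  (C : Coupling G (RAAG Λ) m)
include C

theorem Coupling.lk_nonempty {A : Subgroup G} (hA : Erg (RAAG Λ) (A : Set G) m) {S : Set W}
    {Θ : Z → RAAG Λ} (hS : Supp m (A : Set G) S Θ) {a c : G} (hP : Paradox a c)
    (ha : ∀ x ∈ A, Commute a x) (hc : ∀ x ∈ A, Commute c x) : (lk Λ S).Nonempty := by
  by_contra hne
  rw [Set.not_nonempty_iff_eq_empty] at hne
  refine C.not_amen hS.1.1 hP (C.amen_of_supp hA hS (F := {a, c}) (Set.toFinite _) ?_ (fun _ _ => rfl) ?_)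
  · rintro p (rfl | rfl)
    exacts [ha, hc]
  · simp [hne]

theorem Coupling.not_clique {P : Set G} {M : Set W} (hM : Clq Λ M)
    (hP : Red P (standardSub Λ M) m) {a c : G} (hac : Paradox a c) (ha : a ∈ P) (hc : c ∈ P) :
    False := by
  obtain ⟨Θ, hΘ⟩ := hP
  have h1 : RedBy {a, c} (standardSub Λ M) m Θ := hΘ.mono
    (Set.insert_subset ha (Set.singleton_subset_iff.2 hc)) le_rfl
  exact C.not_amen hΘ.1 hac (C.amen_of_clique (F := {a, c}) (Set.toFinite _) hM h1)

theorem Coupling.supp_nonempty {A : Set G} {S : Set W} {Θ : Z → RAAG Λ} (hS : Supp m A S Θ)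
    {a : G} (ha : a ∈ A) (hinf : ∀ n : ℕ, 0 < n → a ^ n ≠ 1) : S.Nonempty := by
  by_contra hne
  rw [Set.not_nonempty_iff_eq_empty] at hne
  subst hne
  refine C.not_fixed hinf hS.1.1 ?_
  filter_upwards [hS.1.2 a ha] with z hz
  exact (inv_mul_eq_one.1 (standardSub_empty hz)).symm

theorem Coupling.measure_compl_le {Θ : Z → RAAG Λ} (hΘ : Eqv (RAAG Λ) Θ) {Ψ : Z → G}
    (hΨ : Eqv G Ψ) {ε : ℝ≥0∞} (hε : 0 < ε) : ∃ δ : ℝ, 0 < δ ∧ ∀ O : Set Z, MeasurableSet O →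
      (∀ (h : RAAG Λ) z, h • z ∈ O ↔ z ∈ O) → m (Oᶜ ∩ {z | Θ z = 1}) ≤ ENNReal.ofReal δ →
      m (Oᶜ ∩ {z | Ψ z = 1}) ≤ ε := by
  have := C.swap.isFinite hΨ
  have hε2 : 0 < ε / 2 := ENNReal.half_pos hε.ne'
  obtain ⟨K, hK, hlt⟩ := tight (μ := m.restrict {z | Ψ z = 1}) hΘ.mf hε2
  set δ : ℝ≥0∞ := ε / 2 / (K.ncard + 1) with hδ
  have hδ0 : 0 < δ := ENNReal.div_pos hε2.ne' (by simp)
  obtain ⟨r, hr, hrδ⟩ : ∃ r : ℝ, 0 < r ∧ ENNReal.ofReal r ≤ δ := by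
    rcases eq_or_ne δ ⊤ with h | h
    · exact ⟨1, one_pos, h ▸ le_top⟩
    · exact ⟨δ.toReal, ENNReal.toReal_pos hδ0.ne' h, ENNReal.ofReal_toReal_le⟩
  refine ⟨r, hr, fun O hO hOH hle => ?_⟩
  have h1 : ∀ k, m (Oᶜ ∩ {z | Θ z = k}) ≤ δ := fun k => by
    rw [← measure_translate C.mpH (hO.compl.inter (hΘ.mf.eq k)) k]
    refine (measure_mono (show {z | k • z ∈ Oᶜ ∩ {z | Θ z = k}} ⊆ Oᶜ ∩ {z | Θ z = 1} from
      fun z hz => ⟨fun h => hz.1 ((hOH k z).2 h), ?_⟩)).trans (hle.trans hrδ)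
    simpa [hΘ.mul] using hz.2
  have h2 : Oᶜ ∩ {z | Ψ z = 1} ⊆ ({z | Θ z ∈ Kᶜ} ∩ {z | Ψ z = 1}) ∪
      ⋃ k ∈ hK.toFinset, Oᶜ ∩ {z | Θ z = k} := fun z hz => by
    by_cases hk : Θ z ∈ K
    · exact Or.inr (Set.mem_biUnion (hK.mem_toFinset.2 hk) ⟨hz.1, rfl⟩)
    · exact Or.inl ⟨hk, hz.2⟩
  have h3 : m ({z | Θ z ∈ Kᶜ} ∩ {z | Ψ z = 1}) < ε / 2 := by
    rwa [← Measure.restrict_apply (hΘ.mf.mem Kᶜ)]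
  have h4 : m (⋃ k ∈ hK.toFinset, Oᶜ ∩ {z | Θ z = k}) ≤ ε / 2 :=
    calc _ ≤ ∑ k ∈ hK.toFinset, δ := (measure_biUnion_finset_le _ _).trans
            (Finset.sum_le_sum fun k _ => h1 k)
      _ = δ * K.ncard := by
          rw [Finset.sum_const, ← Set.ncard_eq_toFinset_card K hK, nsmul_eq_mul, mul_comm]
      _ ≤ δ * (K.ncard + 1) := by gcongr; exact le_self_add
      _ = ε / 2 := ENNReal.div_mul_cancel (by simp) (by simp)
  calc _ ≤ _ := (measure_mono h2).trans (measure_union_le _ _)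
    _ ≤ ε / 2 + ε / 2 := add_le_add h3.le h4
    _ = ε := ENNReal.add_halves ε

theorem Coupling.clique_of_red {A : Subgroup G} (hA : Erg (RAAG Λ) (A : Set G) m) {S : Set W}
    {Θ : Z → RAAG Λ} (hS : Supp m (A : Set G) S Θ) {P : Subgroup G}
    (hP : ∀ p ∈ P, ∀ a ∈ A, Commute p a) {Q : Set (RAAG Λ)} (hQ : ∀ s ∈ S, gen Λ s ∈ Q)
    {Ψ : Z → G} (hΨ : RedBy Q P m Ψ) : Clq Λ S := by
  intro u hu v hv huv
  by_contra hadj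
  have hPar := paradox_gen huv hadj
  have := C.swap.isFinite hΨ.1
  have hz : m.restrict {z | Ψ z = 1} = 0 := by
    refine measure_eq_zero_of_paradox hPar fun ε hε => ?_
    have hε2 : 0 < ENNReal.ofReal (ε / 2) := ENNReal.ofReal_pos.2 (by positivity)
    have htm : ∀ p : RAAG Λ, MF fun z => (Ψ z)⁻¹ * Ψ (p • z) := fun p =>
      (hΨ.1.mf.pair (C.swap.eqv_smul hΨ.1 p).mf).comp fun q => q.1⁻¹ * q.2
    choose K hK hlt using fun p => tight (μ := m.restrict {z | Ψ z = 1}) (htm p) hε2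
    obtain ⟨δ, hδ, hδO⟩ := C.measure_compl_le hS.1.1 hΨ.1 hε2
    set F : Set G := {g | g ∈ P ∧ ∃ p ∈ ({gen Λ u, gen Λ v} : Set (RAAG Λ)), g⁻¹ ∈ K p} with hF
    have hFf : F.Finite := by
      refine (Set.Finite.biUnion (Set.toFinite {gen Λ u, gen Λ v}) fun p _ =>
        (hK p).inv).subset ?_
      rintro g ⟨-, p, hp, hg⟩
      exact Set.mem_biUnion hp hg
    obtain ⟨ι, _, _, κ, O, hκ, hκH, hO, hOH, hOε, hcl⟩ := C.amen_of_supp hA hS hFf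
      (fun p hp => hP p hp.1) (ρ := ret S) (fun x hx => ret_of_mem hx) (fun x _ => ret_mem S x)
      (min δ ε) (lt_min hδ hε)
    have hO1 := hδO O hO hOH (hOε.trans (ENNReal.ofReal_le_ofReal (min_le_left _ _)))
    set θ : ι → Z → RAAG Λ := fun i z => κ i ((Ψ z)⁻¹ • z) with hθ
    have hθm : ∀ i, MF (θ i) := fun i =>
      hΨ.1.mf.select fun k => (hκ i).comp_measurable (C.mpG k⁻¹).measurable
    have hθG : ∀ i (g : G) z, θ i (g • z) = θ i z := fun i g z => by
      simp only [hθ, hΨ.1.mul, smul_smul]; congr 2; group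
    refine ⟨ι, inferInstance, inferInstance, θ, hθm, fun p hp => ⟨fun i z => θ i (p • z),
      O ∩ {z | ((Ψ z)⁻¹ * Ψ (p • z))⁻¹ ∈ F} ∩ {z | Ψ z = 1},
      fun i => (hθm i).comp_measurable (C.mpH p).measurable, fun i E => ?_,
      (hO.inter ((htm p).mem {g | g⁻¹ ∈ F})).inter (hΨ.1.mf.eq 1), ?_, fun z hz E => ?_⟩⟩
    · rw [Measure.restrict_apply (hθm i E),
        Measure.restrict_apply ((hθm i).comp_measurable (C.mpH p).measurable E)]
      exact C.swap.exchange_smul hΨ.1 p (hθm i E) fun h z => by simp [hθG]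
    · have hpQ : p ∈ Q := by
        rcases hp with rfl | rfl
        exacts [hQ u hu, hQ v hv]
      refine (Measure.restrict_apply ((hO.inter ((htm p).mem {g | g⁻¹ ∈ F})).inter
        (hΨ.1.mf.eq 1)).compl).trans_le ?_
      have hsub : ((O ∩ {z | ((Ψ z)⁻¹ * Ψ (p • z))⁻¹ ∈ F} ∩ {z | Ψ z = 1})ᶜ ∩ {z | Ψ z = 1} : Set Z)
          ≤ᵐ[m] (Oᶜ ∩ {z | Ψ z = 1} ∪
            {z | (Ψ z)⁻¹ * Ψ (p • z) ∈ (K p)ᶜ} ∩ {z | Ψ z = 1} : Set Z) := by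
        filter_upwards [hΨ.2 p hpQ] with z h1
        rintro ⟨h2, h3⟩
        by_cases h4 : z ∈ O
        · refine Or.inr ⟨fun h5 => h2 ⟨⟨h4, inv_mem h1, p, hp, ?_⟩, h3⟩, h3⟩
          rwa [inv_inv]
        · exact Or.inl ⟨h4, h3⟩
      refine (measure_mono_ae hsub).trans ((measure_union_le _ _).trans ?_)
      refine (add_le_add hO1 ((Measure.restrict_apply ((htm p).mem (K p)ᶜ)).symm.trans_le
        (hlt p).le)).trans ?_
      rw [← ENNReal.ofReal_add (by positivity) (by positivity), add_halves]
    · obtain ⟨⟨h1, h2⟩, h3⟩ := hz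
      have h3 : Ψ z = 1 := h3
      have h4 := hcl _ h2 z h1 (p⁻¹ • E)
      have hpS : ret S p = p := by
        rcases hp with rfl | rfl
        exacts [ret_of_mem (Subgroup.subset_closure ⟨u, hu, rfl⟩),
          ret_of_mem (Subgroup.subset_closure ⟨v, hv, rfl⟩)]
      rw [num_congr (f' := (κ · (((Ψ z)⁻¹ * Ψ (p • z))⁻¹ • z))) (E' := p⁻¹ • E) fun i => by
          simp [hθ, h3, C.comm, hκH, hpS, Set.mem_smul_set_iff_inv_smul_mem],
        num_congr (f := (θ · z)) (f' := (κ · z)) (E' := p⁻¹ • E) fun i => by simp [hθ, h3]]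
      refine h4.trans ?_
      gcongr
      exact min_le_right _ _
  rw [Measure.restrict_eq_zero] at hz
  exact C.swap.dom_ne_zero hΨ.1 hz

end Consequences

section Ergodic
variable {G H Z : Type} [MeasurableSpace Z] [Group G] [Group H] [MulAction G Z] [MulAction H Z]
  {m : Measure Z}

theorem Erg.mono {A A' : Set G} (h : Erg H A m) (hA : A ⊆ A') : Erg H A' m :=
  fun E hE h1 h2 => h E hE h1 fun a ha => h2 a (hA ha)

theorem Erg.zpowers {x : G} (h : Erg H {x} m) : Erg H (Subgroup.zpowers x : Set G) m :=
  h.mono (Set.singleton_subset_iff.2 (Subgroup.mem_zpowers x))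

theorem mem_cen {x g : G} : g ∈ Subgroup.centralizer {x} ↔ Commute g x := by
  rw [Subgroup.mem_centralizer_singleton_iff]; exact Iff.rfl

theorem commute_zpowers {x g a : G} (h : Commute g x) (ha : a ∈ Subgroup.zpowers x) :
    Commute g a := by
  obtain ⟨n, rfl⟩ := ha
  exact h.zpow_right n

variable [Countable G] [Countable H] (C : Coupling G H m)
include C

omit [Countable G] [Countable H] in
theorem Coupling.redBy_closure {A : Set G} {Q : Subgroup H} {Θ : Z → H} (h : RedBy A Q m Θ) :
    RedBy (Subgroup.closure A : Set G) Q m Θ := by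
  refine ⟨h.1, fun a ha => ?_⟩
  induction ha using Subgroup.closure_induction with
  | mem a ha => exact h.2 a ha
  | one => simp [one_mem]
  | mul a b _ _ iha ihb =>
    filter_upwards [C.ae_smul iha b, ihb] with z h1 h2
    have := Q.mul_mem h2 h1
    simpa [mul_assoc, mul_smul] using this
  | inv a _ ih =>
    filter_upwards [C.ae_smul ih a⁻¹] with z h1
    have := Q.inv_mem h1
    simpa using this

omit [Countable G] [Countable H] in
theorem Coupling.ae_ne {φ : Z → Prop} (h : ∀ᵐ z ∂m, φ z) : ∃ z, φ z := by
  have := ae_neBot.2 C.ne_zero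
  exact h.exists

omit [Countable G] [Countable H] in
theorem Coupling.exists_value {D : Type} [Countable D] (θ : Z → D) : ∃ d, m {z | θ z = d} ≠ 0 := by
  by_contra hcon
  push Not at hcon
  apply C.ne_zero
  rw [← Measure.measure_univ_eq_zero, show (Set.univ : Set Z) = ⋃ d, {z | θ z = d} by ext; simp]
  exact measure_iUnion_null hcon

omit [Countable G] [Countable H] in
theorem Coupling.ae_const {A : Set G} (hA : Erg H A m) {D : Type} [Countable D] {θ : Z → D}
    (hθ : MF θ) (hH : ∀ (h : H) z, θ (h • z) = θ z) (hinv : ∀ a ∈ A, ∀ᵐ z ∂m, θ (a • z) = θ z) :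
    ∃ d, ∀ᵐ z ∂m, θ z = d := by
  obtain ⟨d, hd⟩ := C.exists_value θ
  refine ⟨d, (hA _ (hθ.eq d) (fun h z => by simp [hH]) fun a ha => ?_).resolve_left hd⟩
  filter_upwards [hinv a ha] with z hz
  simp [hz]

omit [Countable G] [Countable H] in
/-- Elements along which the cocycle given by `Θ` is constant form a subgroup, and the
constants define a homomorphism. -/
theorem Coupling.exists_hom {Θ : Z → H} {A : Set G}
    (hA : ∀ a ∈ A, ∃ h, ∀ᵐ z ∂m, Θ (a • z) = Θ z * h) (htop : Subgroup.closure A = ⊤) :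
    ∃ α : G →* H, ∀ g, ∀ᵐ z ∂m, Θ (g • z) = Θ z * (α g)⁻¹ := by
  have h1 : ∀ g, ∃ h, ∀ᵐ z ∂m, Θ (g • z) = Θ z * h⁻¹ := fun g => by
    have hg : g ∈ Subgroup.closure A := htop ▸ Subgroup.mem_top g
    induction hg using Subgroup.closure_induction with
    | mem a ha => obtain ⟨h, hh⟩ := hA a ha; exact ⟨h⁻¹, by simpa using hh⟩
    | one => exact ⟨1, by simp⟩
    | mul a b _ _ iha ihb =>
      obtain ⟨h, hh⟩ := iha
      obtain ⟨k, hk⟩ := ihb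
      refine ⟨h * k, ?_⟩
      filter_upwards [C.ae_smul hh b, hk] with z h2 h3
      rw [mul_smul, h2, h3, mul_inv_rev, mul_assoc]
    | inv a _ ih =>
      obtain ⟨h, hh⟩ := ih
      refine ⟨h⁻¹, ?_⟩
      filter_upwards [C.ae_smul hh a⁻¹] with z h2
      rw [smul_inv_smul] at h2
      rw [h2]; simp
  choose α hα using h1
  refine ⟨MonoidHom.mk' α fun a b => ?_, hα⟩
  obtain ⟨z, h2, h3, h4⟩ := C.ae_ne ((hα (a * b)).and ((C.ae_smul (hα a) b).and (hα b)))
  rw [mul_smul, h3, h4, mul_assoc, mul_right_inj, ← mul_inv_rev, inv_inj] at h2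
  exact h2.symm

end Ergodic

theorem exists_mul_of_join {V : Type} {Γ : SimpleGraph V} {S : Set V} {x : RAAG Γ}
    (h : x ∈ standardSub Γ (S ∪ lk Γ S)) :
    ∃ y ∈ standardSub Γ S, ∃ z ∈ standardSub Γ (lk Γ S), x = y * z := by
  induction h using Subgroup.closure_induction with
  | mem x hx =>
    obtain ⟨v, hv | hv, rfl⟩ := hx
    exacts [⟨_, gen_mem hv, 1, one_mem _, by simp⟩, ⟨1, one_mem _, _, gen_mem hv, by simp⟩]
  | one => exact ⟨1, one_mem _, 1, one_mem _, by simp⟩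
  | mul x x' _ _ ih ih' =>
    obtain ⟨y, hy, z, hz, rfl⟩ := ih
    obtain ⟨y', hy', z', hz', rfl⟩ := ih'
    refine ⟨_, mul_mem hy hy', _, mul_mem hz hz', ?_⟩
    rw [mul_assoc, ← mul_assoc z, ← (commute_lk hy' hz).eq]
    group
  | inv x _ ih =>
    obtain ⟨y, hy, z, hz, rfl⟩ := ih
    exact ⟨_, inv_mem hy, _, inv_mem hz, by rw [mul_inv_rev, (commute_lk hy hz).inv_inv.eq]⟩

section Rigid
variable {G Z : Type} [MeasurableSpace Z] [Group G] [MulAction G Z] {W : Type} [Fintype W]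
  {Λ : SimpleGraph W} [MulAction (RAAG Λ) Z] {m : Measure Z} [Countable G]
  (C : Coupling G (RAAG Λ) m)
include C

theorem Coupling.propagate {Θ : Z → RAAG Λ} (hΘ : Eqv (RAAG Λ) Θ) {g g' : G} (hgg : Commute g g')
    (hg : Erg (RAAG Λ) {g} m) {h : RAAG Λ} (hh : ∀ᵐ z ∂m, Θ (g • z) = Θ z * h) :
    ∃ h', ∀ᵐ z ∂m, Θ (g' • z) = Θ z * h' := by
  set τ : Z → RAAG Λ := fun z => (Θ z)⁻¹ * Θ (g' • z) with hτ
  have hτm : MF τ := (hΘ.mf.pair (C.eqv_smul hΘ g').mf).comp fun q => q.1⁻¹ * q.2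
  have hτH : ∀ (h : RAAG Λ) z, τ (h • z) = τ z := fun h z => by
    simp only [hτ, C.comm, hΘ.mul]; group
  have hτg : ∀ᵐ z ∂m, τ (g • z) = h⁻¹ * τ z * h := by
    filter_upwards [hh, C.ae_smul hh g'] with z h1 h2
    simp only [hτ]
    rw [smul_smul, ← hgg.eq, mul_smul, h1, h2]; group
  have hτn : ∀ n : ℕ, ∀ᵐ z ∂m, τ (g ^ n • z) = (h ^ n)⁻¹ * τ z * h ^ n := fun n => by
    induction n with
    | zero => simp
    | succ n ih =>
      filter_upwards [ih, C.ae_smul hτg (g ^ n)] with z h1 h2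
      rw [pow_succ', mul_smul, h2, h1, pow_succ]; group
  obtain ⟨k, hk⟩ := C.exists_value τ
  obtain ⟨n, hn, hne⟩ := C.recurrence (hτm.eq k) (fun h z => by simp [hτH]) hk g
  obtain ⟨z, ⟨h1, h2⟩, h3⟩ := ((frequently_ae_mem_iff.2 hne).and_eventually (hτn n)).exists
  simp only [Set.mem_ofPred_eq] at h1 h2
  rw [h1, h2, mul_assoc, eq_inv_mul_iff_mul_eq] at h3
  have hkh : Commute k h := commute_of_pow hn (Eq.symm h3)
  have := (hg {z | τ z = k} (hτm.eq k) (fun h z => by simp [hτH]) fun a ha => by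
    rw [Set.mem_singleton_iff.1 ha]
    filter_upwards [hτg] with z hz
    simp only [Set.mem_ofPred_eq, hz]
    rw [mul_assoc, inv_mul_eq_iff_eq_mul, ← hkh.eq, mul_left_inj]).resolve_left hk
  refine ⟨k, ?_⟩
  have h4 : ∀ᵐ z ∂m, τ z = k := this
  filter_upwards [h4] with z hz
  rw [← hz]; simp [hτ]

theorem Coupling.exists_hom_of_connected {Θ : Z → RAAG Λ} (hΘ : Eqv (RAAG Λ) Θ) {V' : Type}
    {Δ : SimpleGraph V'} (hc : Δ.Connected) (e : RAAG Δ ≃* G)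
    (he : ∀ v, Erg (RAAG Λ) {e (gen Δ v)} m) {v₀ : V'} {h : RAAG Λ}
    (hh : ∀ᵐ z ∂m, Θ (e (gen Δ v₀) • z) = Θ z * h) :
    ∃ α : G →* RAAG Λ, ∀ g, ∀ᵐ z ∂m, Θ (g • z) = Θ z * (α g)⁻¹ := by
  have h1 : ∀ v, ∃ h, ∀ᵐ z ∂m, Θ (e (gen Δ v) • z) = Θ z * h := fun v => by
    obtain ⟨p⟩ := hc.preconnected v v₀
    induction p with
    | nil => exact ⟨h, hh⟩
    | cons hadj _ ih =>
      obtain ⟨k, hk⟩ := ih hh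
      exact C.propagate hΘ (Commute.map (gen_comm hadj.symm : Commute (gen Δ _) (gen Δ _)) e) (he _) hk
  refine C.exists_hom (A := e.toMonoidHom '' Set.range (gen Δ)) ?_ ?_
  · rintro _ ⟨_, ⟨v, rfl⟩, rfl⟩
    exact h1 v
  · rw [← MonoidHom.map_closure, raag_closure, ← MonoidHom.range_eq_map]
    exact MonoidHom.range_eq_top.2 e.surjective

/-- Two commuting elements with supports in a join. -/
theorem Coupling.untwist {b b' : G} (hbb : Commute b' b) (hb : Erg (RAAG Λ) {b} m)
    {S S' : Set W} {Θ Ψ : Z → RAAG Λ} (hS : Supp m (Subgroup.zpowers b : Set G) S Θ)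
    (hS' : Supp m (Subgroup.zpowers b' : Set G) S' Ψ) (hSS : S' ⊆ lk Λ S) :
    ∃ (Θ' : Z → RAAG Λ) (h : RAAG Λ), Eqv (RAAG Λ) Θ' ∧ ∀ᵐ z ∂m, Θ' (b' • z) = Θ' z * h := by
  set t : Z → RAAG Λ := fun z => (Θ z)⁻¹ * Θ (b' • z) with ht
  set σ : Z → RAAG Λ := fun z => ret S ((Θ z)⁻¹ * Ψ z) with hσ
  have hΘ := hS.1.1
  have htm : MF t := (hΘ.mf.pair (C.eqv_smul hΘ b').mf).comp fun q => q.1⁻¹ * q.2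
  have hσm : MF σ := (hΘ.mf.pair hS'.1.1.mf).comp fun q => ret S (q.1⁻¹ * q.2)
  have htH : ∀ (h : RAAG Λ) z, t (h • z) = t z := fun h z => by
    simp only [ht, C.comm, hΘ.mul]; group
  have hσH : ∀ (h : RAAG Λ) z, σ (h • z) = σ z := fun h z => by
    simp only [hσ, hΘ.mul, hS'.1.1.mul]; congr 1; group
  have hdis : Disjoint S (lk Λ S) := Set.disjoint_right.2 fun v hv => lk_disj hv
  have htl := C.commuting_mem hb.zpowers hS (p := b') fun a ha => commute_zpowers hbb ha
  have hs := hS.1.2 b (Subgroup.mem_zpowers b)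
  obtain ⟨h, hh⟩ := C.ae_const hb (htm.comp (ret (Γ := Λ) (lk Λ S))) (fun h z => by simp [htH])
    fun a ha => by
      rw [Set.mem_singleton_iff.1 ha]
      filter_upwards [hs, C.ae_smul hs b'] with z h1 h2
      have h3 : t (b • z) = ((Θ z)⁻¹ * Θ (b • z))⁻¹ * t z *
          ((Θ (b' • z))⁻¹ * Θ (b • b' • z)) := by
        simp only [ht]
        rw [smul_smul b' b, hbb.eq, mul_smul]; group
      rw [h3, map_mul, map_mul, map_inv, ret_of_mem_of_disjoint hdis.symm h1,
        ret_of_mem_of_disjoint hdis.symm h2]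
      simp
  refine ⟨fun z => Θ z * σ z, h, ⟨(hΘ.mf.pair hσm).comp fun q => q.1 * q.2, fun h z => ?_⟩, ?_⟩
  · simp [hΘ.mul, hσH, mul_assoc]
  filter_upwards [htl, hh, hS'.1.2 b' (Subgroup.mem_zpowers b')] with z h1 h2 h3
  obtain ⟨x, hx, y, hy, hxy⟩ : ∃ x ∈ standardSub Λ S, ∃ y ∈ standardSub Λ (lk Λ S), t z = x * y :=
    exists_mul_of_join h1
  have h4 : ret S (t z) = x := by
    rw [hxy, map_mul, ret_of_mem hx, ret_of_mem_of_disjoint hdis hy, mul_one]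
  have h5 : y = h := by
    rw [← h2, hxy, map_mul, ret_of_mem hy, ret_of_mem_of_disjoint hdis.symm hx, one_mul]
  have h6 : t z = (Θ z)⁻¹ * Ψ z * ((Ψ z)⁻¹ * Ψ (b' • z)) * ((Θ (b' • z))⁻¹ * Ψ (b' • z))⁻¹ := by
    simp only [ht]; group
  have h7 : x = σ z * (σ (b' • z))⁻¹ := by
    rw [← h4, h6, map_mul, map_mul, map_inv,
      ret_of_mem_of_disjoint hdis (standardSub_mono hSS h3), mul_one]
  have h8 : Commute (σ (b' • z)) y := (commute_lk (ret_mem S _) hy)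
  have h9 : Θ (b' • z) = Θ z * t z := by simp [ht]
  rw [h9, hxy, h7, ← h5, mul_assoc, mul_assoc, mul_assoc, mul_assoc, ← h8.eq]
  group

end Rigid

section Conj
variable {G H Z : Type} [MeasurableSpace Z] [Group G] [Group H] [MulAction G Z] [MulAction H Z]
  {m : Measure Z} [Countable G] [Countable H] (C : Coupling G H m)
include C

omit [Countable G] [Countable H] in
theorem Coupling.red_conj {A A' : Set G} {Q : Subgroup H} (h : Red A Q m) (k : G)
    (hA : ∀ a ∈ A', k * a * k⁻¹ ∈ A) : Red A' Q m := by
  obtain ⟨Θ, hΘ⟩ := h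
  refine ⟨fun z => Θ (k • z), C.eqv_smul hΘ.1 k, fun a ha => ?_⟩
  filter_upwards [C.ae_smul (hΘ.2 _ (hA a ha)) k] with z hz
  simpa [smul_smul] using hz

end Conj

theorem not_both {V : Type} {Γ : SimpleGraph V} {x x' β : RAAG Γ} (hne : ∀ l : RAAG Γ, ¬ ∀ g, Commute g x → Commute (l⁻¹ * g * l) x')
    (h : ∃ k, ∀ g, Commute g x ↔ Commute (k⁻¹ * g * k) β)
    (h' : ∃ k, ∀ g, Commute g x' ↔ Commute (k⁻¹ * g * k) β) : False := by
  obtain ⟨k, hk⟩ := h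
  obtain ⟨k', hk'⟩ := h'
  refine hne (k * k'⁻¹) fun g hg => (hk' _).2 ?_
  have := (hk g).1 hg
  have h2 : k'⁻¹ * ((k * k'⁻¹)⁻¹ * g * (k * k'⁻¹)) * k' = k⁻¹ * g * k := by group
  rwa [h2]

section CenConj
variable {V H Z : Type} [Finite V] {Γ : SimpleGraph V} [MeasurableSpace Z] [Group H]
  [MulAction (RAAG Γ) Z] [MulAction H Z] {m : Measure Z} [Countable H] (C : Coupling (RAAG Γ) H m)
include C

theorem Coupling.cen_conj {x : RAAG Γ} (hx : MaxElt x) {R : Subgroup H} {Q : Subgroup (RAAG Γ)}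
    (h₁ : Red (Subgroup.centralizer {x} : Set (RAAG Γ)) R m) (h₂ : Red (R : Set H) Q m)
    {β : RAAG Γ} (hβ : β ≠ 1) (hQ : ∀ q ∈ Q, Commute q β) :
    ∃ k, ∀ g, Commute g x ↔ Commute (k⁻¹ * g * k) β := by
  obtain ⟨k, hk⟩ := C.exists_pow_mem h₁ h₂
  have hconj : ∀ g, Commute g (k * β * k⁻¹) ↔ Commute (k⁻¹ * g * k) β := fun g => by
    rw [← Commute.conj_iff (a := k⁻¹ * g * k) (b := β) k]
    have : k * (k⁻¹ * g * k) * k⁻¹ = g := by group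
    rw [this]
  have h1 : ∀ p, Commute p x → Commute p (k * β * k⁻¹) := fun p hp => by
    obtain ⟨n, hn, h2⟩ := hk p (mem_cen.2 hp)
    have h3 := (hconj _).2 (hQ _ h2)
    exact (commute_of_pow hn h3.symm).symm
  refine ⟨k, fun g => ⟨fun h => (hconj g).1 (h1 g h), fun h => ?_⟩⟩
  exact hx _ (by simpa using hβ) h1 g ((hconj g).2 h)

end CenConj

section Main
variable {V W Z : Type} [Fintype V] [Fintype W] {Γ : SimpleGraph V} {Λ : SimpleGraph W}
  [MeasurableSpace Z] [MulAction (RAAG Γ) Z] [MulAction (RAAG Λ) Z] {m : Measure Z}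
  (C : Coupling (RAAG Γ) (RAAG Λ) m)
include C

/-- The support of a maximal element of `G`: the centralizer of the element corresponds to the
join subgroup determined by the support. -/
theorem Coupling.exists_clique_supp (hΓ : JoinCentral Γ) (hErg : ∀ w, Erg (RAAG Γ) {gen Λ w} m)
    {x : RAAG Γ} (hx : MaxElt x) (hx1 : x ≠ 1) (hxE : Erg (RAAG Λ) {x} m) {a c : RAAG Γ}
    (hac : Paradox a c) (ha : Commute a x) (hc : Commute c x) :
    ∃ S Θ, Supp m (Subgroup.zpowers x : Set (RAAG Γ)) S Θ ∧ S.Nonempty ∧ Clq Λ S ∧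
      RedBy (Subgroup.centralizer {x} : Set (RAAG Γ)) (standardSub Λ (S ∪ lk Λ S)) m Θ ∧
      Red (standardSub Λ (S ∪ lk Λ S) : Set (RAAG Λ)) (Subgroup.centralizer {x}) m ∧
      ∃ u ∈ S ∪ lk Λ S, ∃ v ∈ S ∪ lk Λ S, u ≠ v ∧ ¬ Λ.Adj u v := by
  obtain ⟨S, Θ, hS⟩ := C.exists_supp hxE.zpowers
  have hP : ∀ p ∈ (Subgroup.centralizer {x} : Set (RAAG Γ)), ∀ a ∈ Subgroup.zpowers x,
      Commute p a := fun p hp a ha => commute_zpowers (mem_cen.1 hp) ha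
  have hR := C.red_commuting hxE.zpowers hS hP
  have hSn : S.Nonempty := C.supp_nonempty hS (Subgroup.mem_zpowers x)
    fun n hn h => hx1 (torsion_free hn h)
  have hlk : (lk Λ S).Nonempty := C.lk_nonempty hxE.zpowers hS hac
    (fun y hy => commute_zpowers ha hy) fun y hy => commute_zpowers hc hy
  obtain ⟨u, hu, v, hv, huv, hadj⟩ : ∃ u ∈ S ∪ lk Λ S, ∃ v ∈ S ∪ lk Λ S, u ≠ v ∧ ¬ Λ.Adj u v := by
    by_contra! hcon
    exact C.not_clique hcon ⟨Θ, hR⟩ hac (mem_cen.2 ha) (mem_cen.2 hc)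
  obtain ⟨A, B, hAn, hAB, huB, hvB, hun⟩ : ∃ A B : Set W, A.Nonempty ∧
      (∀ s ∈ A, ∀ t ∈ B, Λ.Adj s t) ∧ u ∈ B ∧ v ∈ B ∧ S ∪ lk Λ S = A ∪ B := by
    rcases hu with hu | hu <;> rcases hv with hv | hv
    · exact ⟨lk Λ S, S, hlk, fun s hs t ht => hs t ht, hu, hv, Set.union_comm _ _⟩
    · exact absurd (hv u hu).symm hadj
    · exact absurd (hu v hv) hadj
    · exact ⟨S, lk Λ S, hSn, fun s hs t ht => (ht s hs).symm, hu, hv, rfl⟩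
  obtain ⟨w, hw⟩ := hAn
  have hAE : Erg (RAAG Γ) (standardSub Λ A : Set (RAAG Λ)) m :=
    (hErg w).mono (Set.singleton_subset_iff.2 (gen_mem hw))
  have hBA : ∀ b ∈ standardSub Λ B, ∀ a ∈ standardSub Λ A, Commute b a := fun b hb a ha =>
    (commute_of_adj hAB ha hb).symm
  obtain ⟨T, Ψ, hT⟩ := C.swap.exists_supp hAE
  have hTn : T.Nonempty := C.swap.supp_nonempty hT (gen_mem hw)
    fun n hn h => gen_ne_one w (torsion_free hn h)
  have hTlk : (lk Γ T).Nonempty := C.swap.lk_nonempty hAE hT (paradox_gen huv hadj)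
    (hBA _ (gen_mem huB)) (hBA _ (gen_mem hvB))
  have hMT : RedBy (standardSub Λ (S ∪ lk Λ S) : Set (RAAG Λ)) (standardSub Γ (T ∪ lk Γ T)) m Ψ := by
    have h1 := hT.1.mono le_rfl (standardSub_mono (Γ := Γ) (Set.subset_union_left (t := lk Γ T)))
    have h2 := C.swap.red_commuting hAE hT (P := standardSub Λ B) hBA
    refine C.swap.redBy_closure (A := gen Λ '' (S ∪ lk Λ S)) ⟨hT.1.1, ?_⟩
    rintro _ ⟨s, hs, rfl⟩
    rw [hun] at hs
    rcases hs with hs | hs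
    exacts [h1.2 _ (gen_mem hs), h2.2 _ (gen_mem hs)]
  obtain ⟨β, hβ, hβT⟩ := hΓ T hTn hTlk
  obtain ⟨k, hk⟩ := C.cen_conj hx ⟨Θ, hR⟩ ⟨Ψ, hMT⟩ hβ hβT
  have hMP : RedBy (standardSub Λ (S ∪ lk Λ S) : Set (RAAG Λ)) (Subgroup.centralizer {x}) m
      fun z => Ψ z * k⁻¹ := hMT.conj k⁻¹ fun q hq => mem_cen.2 ((hk _).2 (by
        have : k⁻¹ * (k⁻¹⁻¹ * q * k⁻¹) * k = q := by group
        rw [this]; exact hβT q hq))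
  refine ⟨S, Θ, hS, hSn, ?_, hR, ⟨_, hMP⟩, u, hu, v, hv, huv, hadj⟩
  exact C.clique_of_red hxE.zpowers hS hP (fun s hs => gen_mem (Or.inl hs)) hMP

/-- A vertex `w` of a clique `S`: the support of the corresponding generator. -/
theorem Coupling.exists_supp_of_vertex (hErg : ∀ w, Erg (RAAG Γ) {gen Λ w} m) {S : Set W} {w : W}
    (hw : ∀ s ∈ S, s ∈ star Λ w) {u v : W} (hu : u ∈ S) (hv : v ∈ S) (huv : u ≠ v)
    (hadj : ¬ Λ.Adj u v) :
    ∃ T Ψ, Supp m (Subgroup.zpowers (gen Λ w) : Set (RAAG Λ)) T Ψ ∧ T.Nonempty ∧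
      (lk Γ T).Nonempty ∧ ∀ R : Set (RAAG Λ), (∀ p ∈ R, Commute p (gen Λ w)) →
        RedBy R (standardSub Γ (T ∪ lk Γ T)) m Ψ := by
  obtain ⟨T, Ψ, hT⟩ := C.swap.exists_supp (hErg w).zpowers
  have hcw : ∀ s ∈ S, ∀ a ∈ Subgroup.zpowers (gen Λ w), Commute (gen Λ s) a := fun s hs a ha =>
    commute_zpowers (centralizer_gen.2 (gen_mem (hw s hs))) ha
  refine ⟨T, Ψ, hT, C.swap.supp_nonempty hT (Subgroup.mem_zpowers _)
    fun n hn h => gen_ne_one w (torsion_free hn h), C.swap.lk_nonempty (hErg w).zpowers hT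
      (paradox_gen huv hadj) (hcw u hu) (hcw v hv), fun R hR => ?_⟩
  exact C.swap.red_commuting (hErg w).zpowers hT fun p hp a ha => commute_zpowers (hR p hp) ha

theorem Coupling.exists_clique_supp_of_vertex (hΓ : JoinCentral Γ)
    (hErg : ∀ w, Erg (RAAG Γ) {gen Λ w} m) {x : RAAG Γ} (hx : MaxElt x) {M : Set W}
    (h₁ : Red (Subgroup.centralizer {x} : Set (RAAG Γ)) (standardSub Λ M) m)
    {w : W} (hw : ∀ s ∈ M, s ∈ star Λ w) {u v : W} (hu : u ∈ M) (hv : v ∈ M) (huv : u ≠ v)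
    (hadj : ¬ Λ.Adj u v) :
    ∃ T Ψ, Supp m (Subgroup.zpowers (gen Λ w) : Set (RAAG Λ)) T Ψ ∧ Clq Γ T ∧
      RedBy (standardSub Λ M : Set (RAAG Λ)) (standardSub Γ (T ∪ lk Γ T)) m Ψ ∧
      ∀ t ∈ T, ∃ k, ∀ g, Commute g x ↔ Commute (k⁻¹ * g * k) (gen Γ t) := by
  obtain ⟨T, Ψ, hT, hTn, hTlk, hR⟩ := C.exists_supp_of_vertex hErg hw hu hv huv hadj
  have hMw : ∀ p ∈ standardSub Λ M, Commute p (gen Λ w) := fun p hp =>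
    centralizer_gen.2 (standardSub_mono hw hp)
  have hMT := hR _ hMw
  obtain ⟨β, hβ, hβT⟩ := hΓ T hTn hTlk
  obtain ⟨k, hk⟩ := C.cen_conj hx h₁ ⟨Ψ, hMT⟩ hβ hβT
  have hred : Red (standardSub Γ (T ∪ lk Γ T) : Set (RAAG Γ)) (standardSub Λ M) m :=
    C.red_conj h₁ k fun q hq => mem_cen.2 ((hk _).2 (by
      have : k⁻¹ * (k * q * k⁻¹) * k = q := by group
      rw [this]; exact hβT q hq))
  obtain ⟨Φ, hΦ⟩ := hred
  have hclq : Clq Γ T := C.swap.clique_of_red (hErg w).zpowers hT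
    (fun p hp a ha => commute_zpowers (hMw p hp) ha) (fun s hs => gen_mem (Or.inl hs)) hΦ
  refine ⟨T, Ψ, hT, hclq, hMT, fun t ht => C.cen_conj hx h₁ ⟨Ψ, hMT⟩ (gen_ne_one t) fun q hq => ?_⟩
  refine centralizer_gen.2 (standardSub_mono ?_ hq)
  rintro s (hs | hs)
  · by_cases h : s = t
    exacts [Or.inl h, Or.inr (hclq _ ht _ hs (Ne.symm h))]
  · exact Or.inr ((hs t ht).symm)

theorem Coupling.exists_constant (hΓ : JoinCentral Γ) (hErg : ∀ w, Erg (RAAG Γ) {gen Λ w} m)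
    {x x' : RAAG Γ} (hx : MaxElt x) (hx' : MaxElt x') (hx1 : x ≠ 1) (hx1' : x' ≠ 1)
    (hxx : Commute x' x) (hne : ∀ l : RAAG Γ, ¬ ∀ g, Commute g x → Commute (l⁻¹ * g * l) x')
    (hxE : Erg (RAAG Λ) {x} m) (hxE' : Erg (RAAG Λ) {x'} m) {a c a' c' : RAAG Γ}
    (hac : Paradox a c) (ha : Commute a x) (hc : Commute c x)
    (hac' : Paradox a' c') (ha' : Commute a' x') (hc' : Commute c' x') :
    (∃ (Θ : Z → RAAG Λ) (h : RAAG Λ), Eqv (RAAG Λ) Θ ∧ ∀ᵐ z ∂m, Θ (x' • z) = Θ z * h) ∧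
    ∃ (w : W) (Ψ : Z → RAAG Γ) (g : RAAG Γ), Eqv (RAAG Γ) Ψ ∧
      ∀ᵐ z ∂m, Ψ (gen Λ w • z) = Ψ z * g := by
  obtain ⟨S, Θ, hS, hSn, hScl, hPM, hMP, u, hu, v, hv, huv, hadj⟩ :=
    C.exists_clique_supp hΓ hErg hx hx1 hxE hac ha hc
  obtain ⟨S', Θ', hS', hSn', hScl', hPM', hMP', u', hu', v', hv', huv', hadj'⟩ :=
    C.exists_clique_supp hΓ hErg hx' hx1' hxE' hac' ha' hc'
  have hstar : ∀ {S : Set W}, Clq Λ S → ∀ s ∈ S, ∀ t ∈ S ∪ lk Λ S, t ∈ star Λ s := by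
    rintro S hS s hs t (ht | ht)
    · by_cases h : t = s
      exacts [Or.inl h, Or.inr (hS _ hs _ ht (Ne.symm h))]
    · exact Or.inr ((ht s hs).symm)
  have hdis : ∀ s ∈ S, s ∉ S' := fun s hs hs' => by
    obtain ⟨T, Ψ, hT, hTn, hTlk, hR⟩ :=
      C.exists_supp_of_vertex hErg (hstar hScl s hs) hu hv huv hadj
    obtain ⟨β, hβ, hβT⟩ := hΓ T hTn hTlk
    have h1 : ∀ {M : Set W}, (∀ t ∈ M, t ∈ star Λ s) →
        Red (standardSub Λ M : Set (RAAG Λ)) (standardSub Γ (T ∪ lk Γ T)) m := fun hM =>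
      ⟨Ψ, hR _ fun p hp => centralizer_gen.2 (standardSub_mono hM hp)⟩
    exact not_both hne (C.cen_conj hx ⟨Θ, hPM⟩ (h1 (hstar hScl s hs)) hβ hβT)
      (C.cen_conj hx' ⟨Θ', hPM'⟩ (h1 (hstar hScl' s hs')) hβ hβT)
  have hsub : S' ⊆ lk Λ S := fun s hs => by
    have h1 := hS'.2 (S ∪ lk Λ S) ⟨Θ, hPM.mono (fun y hy => ?_) le_rfl⟩
    · exact (h1 hs).resolve_left fun h => hdis s h hs
    · exact mem_cen.2 (commute_zpowers hxx.symm hy).symm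
  refine ⟨C.untwist hxx hxE hS hS' hsub, ?_⟩
  obtain ⟨w, hw⟩ := hSn
  obtain ⟨w', hw'⟩ := hSn'
  obtain ⟨T, Ψ, hT, hTcl, hMT, hTx⟩ := C.exists_clique_supp_of_vertex hΓ hErg hx ⟨Θ, hPM⟩
    (hstar hScl w hw) hu hv huv hadj
  obtain ⟨T', Ψ', hT', hTcl', hMT', hTx'⟩ := C.exists_clique_supp_of_vertex hΓ hErg hx' ⟨Θ', hPM'⟩
    (hstar hScl' w' hw') hu' hv' huv' hadj'
  have hTsub : T' ⊆ lk Γ T := fun t ht => by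
    have h1 := hT'.2 (T ∪ lk Γ T) ⟨Ψ, hMT.mono (fun y hy => ?_) le_rfl⟩
    · exact (h1 ht).resolve_left fun h => not_both hne (hTx t h) (hTx' t ht)
    · have h2 : gen Λ w' ∈ standardSub Λ (S ∪ lk Λ S) := gen_mem (Or.inr (hsub hw'))
      exact Subgroup.zpowers_le.2 h2 hy
  have hww : Commute (gen Λ w') (gen Λ w) := gen_comm (hsub hw' w hw)
  exact ⟨w', C.swap.untwist hww (hErg w) hT hT' hTsub⟩

end Main

section Homs

theorem MaxElt.map {G G' : Type} [Group G] [Group G'] {x : G} (hx : MaxElt x) (e : G ≃* G') :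
    MaxElt (e x) := by
  have h1 : ∀ (g : G') (y : G), Commute g (e y) ↔ Commute (e.symm g) y := fun g y => by
    have := (commute_map_iff e.injective : Commute (e (e.symm g)) (e y) ↔ _)
    rwa [e.apply_symm_apply] at this
  intro y hy h g hg
  obtain ⟨y, rfl⟩ := e.surjective y
  rw [h1] at hg ⊢
  refine hx y (by simpa using hy) (fun p hp => ?_) _ hg
  have := (h1 _ _).1 (h (e p) (hp.map e))
  simpa using this

variable {V V' W Z : Type} [Fintype V] [Finite V'] [Fintype W] {Γ : SimpleGraph V}
  {Δ : SimpleGraph V'} {Λ : SimpleGraph W}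
  [MeasurableSpace Z] [MulAction (RAAG Γ) Z] [MulAction (RAAG Λ) Z] {m : Measure Z}

theorem Coupling.exists_homs (C : Coupling (RAAG Γ) (RAAG Λ) m) (hΓ : JoinCentral Γ)
    (hΔ : Δ.Connected) (hΔs : ∀ v, star Δ v ≠ Set.univ) (hΛ : Λ.Connected) (e : RAAG Δ ≃* RAAG Γ)
    (he : ∀ v, Erg (RAAG Λ) {e (gen Δ v)} m) (hErg : ∀ w, Erg (RAAG Γ) {gen Λ w} m) :
    (∃ (Θ : Z → RAAG Λ) (α : RAAG Γ →* RAAG Λ), Eqv (RAAG Λ) Θ ∧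
      ∀ g, ∀ᵐ z ∂m, Θ (g • z) = Θ z * (α g)⁻¹) ∧
    ∃ (Ψ : Z → RAAG Γ) (β : RAAG Λ →* RAAG Γ), Eqv (RAAG Γ) Ψ ∧
      ∀ h, ∀ᵐ z ∂m, Ψ (h • z) = Ψ z * (β h)⁻¹ := by
  obtain ⟨b, b', hadj, hb, hb', hne, hcl, hcl'⟩ := exists_pair hΔ hΔs
  have hpar : ∀ {b : V'}, ¬ Clq Δ (Δ.neighborSet b) → ∃ a c : RAAG Γ, Paradox a c ∧
      Commute a (e (gen Δ b)) ∧ Commute c (e (gen Δ b)) := fun {b} h => by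
    unfold Clq at h
    push Not at h
    obtain ⟨u, hu, v, hv, huv, huv'⟩ := h
    have h1 : Commute (gen Δ u) (gen Δ b) := gen_comm (SimpleGraph.Adj.symm hu)
    have h2 : Commute (gen Δ v) (gen Δ b) := gen_comm (SimpleGraph.Adj.symm hv)
    exact ⟨_, _, (paradox_gen huv huv').map e, h1.map e, h2.map e⟩
  obtain ⟨a, c, hac, ha, hc⟩ := hpar hcl
  obtain ⟨a', c', hac', ha', hc'⟩ := hpar hcl'
  have hbb : Commute (gen Δ b') (gen Δ b) := gen_comm hadj.symm
  have hone : ∀ v, e (gen Δ v) ≠ 1 := fun v h => gen_ne_one v (by simpa using h)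
  have hstar : ∀ l : RAAG Γ, ¬ ∀ g, Commute g (e (gen Δ b)) → Commute (l⁻¹ * g * l) (e (gen Δ b')) := fun l hl => by
    have h1 : star Δ b ⊆ star Δ b' := star_subset_of_conj (k := e.symm l) fun p hp => by
      have h2 := (hl (e p) (hp.map e)).map e.symm
      simpa using h2
    exact hne (Set.Subset.antisymm h1 (hb _ h1))
  obtain ⟨⟨Θ, h, hΘ, hh⟩, w, Ψ, g, hΨ, hg⟩ := C.exists_constant hΓ hErg (hb.maxElt.map e)
    (hb'.maxElt.map e) (hone b) (hone b') (hbb.map e) hstar (he b) (he b')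
    hac ha hc hac' ha' hc'
  obtain ⟨α, hα⟩ := C.exists_hom_of_connected hΘ hΔ e he hh
  obtain ⟨β, hβ⟩ := C.swap.exists_hom_of_connected hΨ hΛ (MulEquiv.refl _) hErg hg
  exact ⟨⟨Θ, α, hΘ, hα⟩, Ψ, β, hΨ, hβ⟩

end Homs

section Domains
variable {G H Z : Type} [MeasurableSpace Z] [Group G] [Group H] [MulAction G Z] [MulAction H Z]
  {m : Measure Z} [Countable G] [Countable H] (C : Coupling G H m)
include C

theorem Coupling.hom_injective (hG : ∀ g : G, g ≠ 1 → ∀ n : ℕ, 0 < n → g ^ n ≠ 1) {Θ : Z → H}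
    (hΘ : Eqv H Θ) {α : G →* H} (hα : ∀ g, ∀ᵐ z ∂m, Θ (g • z) = Θ z * (α g)⁻¹) :
    Function.Injective α := by
  refine (injective_iff_map_eq_one α).2 fun g hg => ?_
  by_contra h
  exact C.not_fixed (hG g h) hΘ (by simpa [hg] using hα g)

omit [Countable H] in
theorem Coupling.measure_range {Θ : Z → H} (hΘ : Eqv H Θ) {α : G →* H}
    (hinj : Function.Injective α) (hα : ∀ g, ∀ᵐ z ∂m, Θ (g • z) = Θ z * (α g)⁻¹)
    {E : Set Z} (hE : MeasurableSet E) (hinv : ∀ (g : G) z, g • z ∈ E ↔ z ∈ E) :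
    m (E ∩ {z | Θ z = 1}) = m (E ∩ {z | C.rG z = 1} ∩ {z | Θ z ∈ Set.range α}) := by
  have h1 : ∀ g, m (E ∩ {z | Θ z = 1} ∩ {z | C.rG z = g}) =
      m (E ∩ {z | C.rG z = 1} ∩ {z | Θ z = α g}) := fun g => by
    rw [← measure_translate C.mpG ((hE.inter (hΘ.mf.eq 1)).inter (C.eqvG.mf.eq g)) g]
    refine measure_congr ?_
    filter_upwards [hα g] with z hz
    refine propext ?_
    change ((g • z ∈ E ∧ Θ (g • z) = 1) ∧ C.rG (g • z) = g) ↔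
      ((z ∈ E ∧ C.rG z = 1) ∧ Θ z = α g)
    rw [hinv, hz, C.eqvG.mul, mul_inv_eq_one, mul_eq_left]
    tauto
  rw [measure_eq_tsum C.eqvG.mf (hE.inter (hΘ.mf.eq 1))]
  simp only [h1]
  rw [← measure_iUnion]
  · congr 1
    ext z
    simp [eq_comm]
  · intro g g' hne
    refine Set.disjoint_left.2 ?_
    rintro z ⟨-, h2⟩ ⟨-, h3⟩
    exact hne (hinj (h2.symm.trans h3))
  · exact fun g => (hE.inter (C.eqvG.mf.eq 1)).inter (hΘ.mf.eq _)

theorem Coupling.exists_iso (hG : ∀ g : G, g ≠ 1 → ∀ n : ℕ, 0 < n → g ^ n ≠ 1)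
    (hH : ∀ h : H, h ≠ 1 → ∀ n : ℕ, 0 < n → h ^ n ≠ 1) {Θ : Z → H} (hΘ : Eqv H Θ) {α : G →* H}
    (hα : ∀ g, ∀ᵐ z ∂m, Θ (g • z) = Θ z * (α g)⁻¹) {Ψ : Z → G} (hΨ : Eqv G Ψ) {β : H →* G}
    (hβ : ∀ h, ∀ᵐ z ∂m, Ψ (h • z) = Ψ z * (β h)⁻¹) :
    ∃ α : G ≃* H, (∀ g, ∀ᵐ z ∂m, Θ (g • z) = Θ z * (α g)⁻¹) ∧
      ∀ E, MeasurableSet E → (∀ (g : G) z, g • z ∈ E ↔ z ∈ E) →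
        m (E ∩ {z | Θ z = 1}) = m (E ∩ {z | C.rG z = 1}) := by
  have hinj := C.hom_injective hG hΘ hα
  have hle : m {z | C.rG z = 1} ≤ m {z | Θ z = 1} := by
    have h1 := C.swap.measure_range hΨ (C.swap.hom_injective hH hΨ hβ) hβ MeasurableSet.univ
      (by simp)
    rw [Set.univ_inter, Set.univ_inter] at h1
    have h2 : m {z | Ψ z = 1} = m {z | C.rG z = 1} := C.swap.dom_eq hΨ
    rw [C.dom_eq hΘ, ← h2, h1]
    exact measure_mono Set.inter_subset_left
  have h0 : m ({z | C.rG z = 1} ∩ {z | Θ z ∉ Set.range α}) = 0 := by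
    have h1 := C.measure_range hΘ hinj hα MeasurableSet.univ (by simp)
    rw [Set.univ_inter, Set.univ_inter] at h1
    rw [h1] at hle
    have h2 := measure_inter_add_sdiff (μ := m) {z | C.rG z = 1} (hΘ.mf.mem (Set.range α))
    have h3 := h2.trans_le (hle.trans (add_zero _).ge)
    exact nonpos_iff_eq_zero.1 ((ENNReal.add_le_add_iff_left
      ((measure_mono Set.inter_subset_left).trans_lt C.finG).ne).1 h3)
  have hsurj : Function.Surjective α := fun h => by
    by_contra hh
    have h1 : m {z | Θ z = h} ≠ 0 := by
      rw [← measure_translate C.mpH (hΘ.mf.eq h) h]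
      simpa [hΘ.mul] using C.dom_ne_zero hΘ
    apply h1
    rw [measure_eq_tsum C.eqvG.mf (hΘ.mf.eq h), ENNReal.tsum_eq_zero]
    intro g
    rw [← measure_translate C.mpG ((hΘ.mf.eq h).inter (C.eqvG.mf.eq g)) g]
    refine measure_mono_null_ae (s := {z | g • z ∈ {z | Θ z = h} ∩ {z | C.rG z = g}}) ?_ h0
    filter_upwards [hα g] with z hz
    rintro ⟨h2, h3⟩
    simp only [Set.mem_ofPred_eq, hz, C.eqvG.mul, mul_eq_left] at h2 h3
    refine ⟨h3, fun ⟨g', hg'⟩ => hh ⟨g' * g⁻¹, ?_⟩⟩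
    rw [map_mul, hg', ← h2, map_inv]
  refine ⟨MulEquiv.ofBijective α ⟨hinj, hsurj⟩, hα, fun E hE hinv => ?_⟩
  rw [C.measure_range hΘ hinj hα hE hinv, hsurj.range_eq]
  simp

end Domains

section Transfer
variable {V V' W H Z : Type} [Fintype V] [Finite V'] [Fintype W] {Γ : SimpleGraph V}
  {Δ : SimpleGraph V'} {Λ : SimpleGraph W} [Group H]
  [MeasurableSpace Z] [MulAction (RAAG Γ) Z] [MulAction H Z] {m : Measure Z}

theorem Coupling.exists_iso_of_raag (C : Coupling (RAAG Γ) H m) (hΓ : JoinCentral Γ)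
    (hΔ : Δ.Connected) (hΔs : ∀ v, star Δ v ≠ Set.univ) (hΛ : Λ.Connected) (e : RAAG Δ ≃* RAAG Γ)
    (e' : RAAG Λ ≃* H) (he : ∀ v, Erg H {e (gen Δ v)} m)
    (hErg : ∀ w, Erg (RAAG Γ) {e' (gen Λ w)} m) :
    ∃ (Θ : Z → H) (α : RAAG Γ ≃* H), Eqv H Θ ∧ (∀ g, ∀ᵐ z ∂m, Θ (g • z) = Θ z * (α g)⁻¹) ∧
      ∀ E, MeasurableSet E → (∀ (g : RAAG Γ) z, g • z ∈ E ↔ z ∈ E) →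
        m (E ∩ {z | Θ z = 1}) = m (E ∩ {z | C.rG z = 1}) := by
  letI : MulAction (RAAG Λ) Z := MulAction.compHom Z e'.toMonoidHom
  have hs : ∀ (k : RAAG Λ) (z : Z), k • z = e' k • z := fun _ _ => rfl
  let C' : Coupling (RAAG Γ) (RAAG Λ) m :=
    { rG := C.rG
      rH := fun z => e'.symm (C.rH z)
      comm := fun g h z => C.comm g (e' h) z
      mpG := C.mpG
      mpH := fun h => C.mpH (e' h)
      eqvG := C.eqvG
      eqvH := ⟨C.eqvH.mf.comp _, fun h z => by simp [hs, C.eqvH.mul]⟩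
      finG := C.finG
      finH := by simpa using C.finH
      ne_zero := C.ne_zero }
  have htf : ∀ {U : Type} {Ξ : SimpleGraph U} (g : RAAG Ξ), g ≠ 1 → ∀ n : ℕ, 0 < n → g ^ n ≠ 1 :=
    fun g hg n hn h => hg (torsion_free hn h)
  obtain ⟨⟨Θ, α, hΘ, hα⟩, Ψ, β, hΨ, hβ⟩ := C'.exists_homs hΓ hΔ hΔs hΛ e (fun v E hE hinv ha =>
    he v E hE (fun h z => by simpa [hs] using hinv (e'.symm h) z) ha) fun w E hE hinv ha =>
    hErg w E hE hinv (by simpa [hs] using ha)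
  obtain ⟨α, hα, hdom⟩ := C'.exists_iso htf htf hΘ hα hΨ hβ
  refine ⟨fun z => e' (Θ z), α.trans e', ⟨hΘ.mf.comp _, fun h z => ?_⟩, fun g => ?_, ?_⟩
  · have := hΘ.mul (e'.symm h) z
    rw [hs, e'.apply_symm_apply] at this
    simp [this]
  · filter_upwards [hα g] with z hz
    simp [hz]
  · simpa using hdom

end Transfer

section Base
variable {G H X Y Z : Type} [MeasurableSpace Z] [StandardBorelSpace Z] [Group G] [Group H]
  [MulAction G Z] [MulAction H Z] [MeasurableSpace X] [StandardBorelSpace X] [MulAction G X]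
  [MeasurableSpace Y] [StandardBorelSpace Y] [MulAction H Y]
  {m : Measure Z} {μ : Measure X} {ν : Measure Y} {c : ℝ≥0∞}

/-- `π` presents `(X, c μ)` as the quotient of `(Z, m)` by `H`, with fundamental domain the fibre
of `r` over `1`. -/
structure Base (H : Type) [Group H] [MulAction H Z] (r : Z → H) (m : Measure Z) (π : Z → X)
    (μ : Measure X) (c : ℝ≥0∞) : Prop where
  meas : Measurable π
  smul : ∀ (h : H) z, π (h • z) = π z
  inj : Set.InjOn π {z | r z = 1}
  mass : ∀ B, MeasurableSet B → m (π ⁻¹' B ∩ {z | r z = 1}) = c * μ B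
  ne_zero : c ≠ 0

variable {r : Z → H} {π : Z → X}

omit [StandardBorelSpace Z] [StandardBorelSpace X] in
theorem Base.exists_smul (b : Base H r m π μ c) (hr : Eqv H r) {z z' : Z} (h : π z = π z') :
    ∃ h : H, z' = h • z := by
  have h1 : (r z)⁻¹ • z = (r z')⁻¹ • z' := b.inj (by simp [hr.mul]) (by simp [hr.mul])
    (by rw [b.smul, b.smul, h])
  exact ⟨r z' * (r z)⁻¹, by rw [mul_smul, h1, smul_inv_smul]⟩

theorem Base.exists_preimage (b : Base H r m π μ c) (hr : Eqv H r) {E : Set Z}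
    (hE : MeasurableSet E) (hinv : ∀ (h : H) z, h • z ∈ E ↔ z ∈ E) :
    ∃ B, MeasurableSet B ∧ E = π ⁻¹' B := by
  refine ⟨π '' (E ∩ {z | r z = 1}), (hE.inter (hr.mf.eq 1)).image_of_measurable_injOn b.meas
    (b.inj.mono Set.inter_subset_right), ?_⟩
  ext z
  constructor
  · exact fun hz => ⟨(r z)⁻¹ • z, ⟨(hinv _ _).2 hz, by simp [hr.mul]⟩, b.smul _ _⟩
  · rintro ⟨d, ⟨hd, -⟩, hdz⟩
    obtain ⟨h, rfl⟩ := b.exists_smul hr hdz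
    exact (hinv _ _).2 hd

omit [StandardBorelSpace Z] [StandardBorelSpace X] in
theorem Base.null_iff [Countable H] (b : Base H r m π μ c) (hr : Eqv H r)
    (hm : ∀ h : H, MeasurePreserving (fun z : Z => h • z) m m) {B : Set X} (hB : MeasurableSet B) :
    m (π ⁻¹' B) = 0 ↔ μ B = 0 := by
  have h1 := b.mass B hB
  constructor
  · intro h
    rw [measure_mono_null Set.inter_subset_left h] at h1
    exact (mul_eq_zero.1 h1.symm).resolve_left b.ne_zero
  · intro h
    rw [h, mul_zero] at h1
    exact null_of_domain hm hr (b.meas hB) (fun h z => by simp [b.smul]) h1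

theorem Base.ae_fiber [Countable H] (b : Base H r m π μ c) (hr : Eqv H r)
    (hm : ∀ h : H, MeasurePreserving (fun z : Z => h • z) m m) {E : Set Z}
    (hE : MeasurableSet E) (hinv : ∀ (h : H) z, h • z ∈ E ↔ z ∈ E) (h0 : m Eᶜ = 0) :
    ∀ᵐ x ∂μ, ∀ z, π z = x → z ∈ E := by
  obtain ⟨B, hB, rfl⟩ := b.exists_preimage hr hE hinv
  rw [← Set.preimage_compl, b.null_iff hr hm hB.compl] at h0
  filter_upwards [compl_mem_ae_iff.2 h0] with x hx z hz
  subst hz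
  exact not_not.1 hx

theorem Base.erg [Countable H] (b : Base H r m π μ c) (hr : Eqv H r)
    (hm : ∀ h : H, MeasurePreserving (fun z : Z => h • z) m m) {g : G}
    (hπ : ∀ z, π (g • z) = g • π z) (hg : Ergodic (fun x : X => g • x) μ) : Erg H {g} m := by
  intro E hE hinv ha
  obtain ⟨B, hB, rfl⟩ := b.exists_preimage hr hE hinv
  have h1 : m (π ⁻¹' (((fun x => g • x) ⁻¹' B) ∆ B)) = 0 := by
    refine measure_mono_null ?_ (ae_iff.1 (ha g rfl))
    intro z hz
    simp only [Set.mem_preimage, Set.mem_symmDiff] at hz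
    simp only [Set.mem_ofPred_eq, Set.mem_preimage, hπ]
    tauto
  have hgB := hg.measurable hB
  rw [b.null_iff hr hm (hgB.symmDiff hB), measure_symmDiff_eq_zero_iff] at h1
  rcases hg.quasiErgodic.ae_empty_or_univ₀ hB.nullMeasurableSet h1 with h | h
  · exact Or.inl ((b.null_iff hr hm hB).2 (ae_eq_empty.1 h))
  · exact Or.inr ((b.null_iff hr hm hB.compl).2 (ae_eq_univ.1 h))

end Base

section Conjugacy
variable {G H X Y Z : Type} [MeasurableSpace Z] [StandardBorelSpace Z] [Group G] [Group H]
  [MulAction G Z] [MulAction H Z] [MeasurableSpace X] [StandardBorelSpace X] [MulAction G X]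
  [MeasurableSpace Y] [StandardBorelSpace Y] [MulAction H Y] [Countable G] [Countable H]
  {m : Measure Z} {μ : Measure X} {ν : Measure Y} {c c' : ℝ≥0∞} (C : Coupling G H m)
  {Θ : Z → H} (hΘ : Eqv H Θ) {α : G ≃* H} (hα : ∀ g, ∀ᵐ z ∂m, Θ (g • z) = Θ z * (α g)⁻¹)
  {π : Z → X} {π' : Z → Y} (b : Base H C.rH m π μ c) (b' : Base G C.rG m π' ν c')

/-- The set where `Θ` is exactly equivariant. -/
def strict (Θ : Z → H) (α : G ≃* H) : Set Z := {z | ∀ g : G, Θ (g • z) = Θ z * (α g)⁻¹}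

include C hΘ

omit [StandardBorelSpace Z] in
theorem Coupling.strict_meas : MeasurableSet (strict Θ α) := by
  rw [strict, Set.ofPred_forall]
  exact MeasurableSet.iInter fun g =>
    ((hΘ.mf.comp_measurable (C.mpG g).measurable).pair hΘ.mf) {p | p.1 = p.2 * (α g)⁻¹}

omit C [StandardBorelSpace Z] [MeasurableSpace Z] [Countable G] [Countable H] hΘ in
theorem strict_smul (g : G) (z : Z) : g • z ∈ strict Θ α ↔ z ∈ strict Θ α := by
  have h1 : ∀ (g : G) z, z ∈ strict Θ α → g • z ∈ strict Θ α := fun g z hz g' => by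
    rw [← mul_smul, hz, hz, map_mul, mul_inv_rev, mul_assoc]
  exact ⟨fun h => by simpa using h1 g⁻¹ _ h, h1 g z⟩

omit [StandardBorelSpace Z] [Countable G] [Countable H] in
theorem Coupling.strict_smul' (h : H) (z : Z) : h • z ∈ strict Θ α ↔ z ∈ strict Θ α := by
  refine forall_congr' fun g => ?_
  rw [C.comm, hΘ.mul, hΘ.mul, mul_assoc, mul_right_inj]

include hα

omit [StandardBorelSpace Z] [Countable H] C hΘ in
theorem strict_conull : m (strict Θ α)ᶜ = 0 := ae_iff.1 (ae_all_iff.2 hα)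

include b

theorem Coupling.cohomologous {k : G → X → H} {j : X → Z} (hj : Measurable j)
    (hjX : ∀ᵐ x ∂μ, π (j x) = x) (hk : ∀ g, ∀ᵐ x ∂μ, j (g • x) = k g x • g • j x) :
    Cohomologous G X H μ k fun g _ => α g := by
  refine ⟨fun x => (Θ (j x))⁻¹, fun h => hj (hΘ.mf.comp (·⁻¹) {h}), fun g => ?_⟩
  filter_upwards [hjX, hk g, b.ae_fiber C.eqvH C.mpH (C.strict_meas hΘ) (C.strict_smul' hΘ)
    (strict_conull hα)] with x hx hkx hs
  rw [hkx, hΘ.mul, hs _ hx g]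
  group

include b'

theorem Coupling.conjugateVia (hπ : ∀ (g : G) z, π (g • z) = g • π z)
    (hπ' : ∀ (h : H) z, π' (h • z) = h • π' z) (hcc : c = c') (hc : c ≠ ⊤)
    (hdom : ∀ E, MeasurableSet E → (∀ (g : G) z, g • z ∈ E ↔ z ∈ E) →
      m (E ∩ {z | Θ z = 1}) = m (E ∩ {z | C.rG z = 1})) :
    ConjugateVia G X H Y μ ν α := by
  subst hcc
  have hst := C.strict_meas (α := α) hΘ
  have h0 := strict_conull hα
  have hD : MeasurableSet ({z | Θ z = 1} ∩ strict Θ α) := (hΘ.mf.eq 1).inter hst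
  set D := {z | Θ z = 1} ∩ strict Θ α with hDdef
  have hinj : Set.InjOn π D := by
    rintro z ⟨hz, -⟩ z' ⟨hz', -⟩ h
    obtain ⟨k, rfl⟩ := b.exists_smul C.eqvH h
    simp only [Set.mem_ofPred_eq, hΘ.mul] at hz hz'
    rw [hz, mul_one] at hz'
    rw [hz', one_smul]
  have hinj' : Set.InjOn π' D := by
    rintro z ⟨hz, hs⟩ z' ⟨hz', -⟩ h
    obtain ⟨k, rfl⟩ := b'.exists_smul C.eqvG h
    simp only [Set.mem_ofPred_eq] at hz hz'
    rw [hs k, hz, one_mul, inv_eq_one, map_eq_one_iff α α.injective] at hz'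
    rw [hz', one_smul]
  have hD0 : ∀ E : Set Z, m (E ∩ {z | Θ z = 1}) = m (E ∩ D) := fun E => by
    refine le_antisymm ?_ (measure_mono (Set.inter_subset_inter_right _ Set.inter_subset_left))
    refine (measure_mono (t := (E ∩ D) ∪ (strict Θ α)ᶜ) ?_).trans
      ((measure_union_le _ _).trans_eq (by rw [h0, add_zero]))
    rintro z ⟨h1, h2⟩
    by_cases h : z ∈ strict Θ α
    exacts [Or.inl ⟨h1, h2, h⟩, Or.inr h]
  have hmass : ∀ B, MeasurableSet B → m (π ⁻¹' B ∩ D) = c * μ B := fun B hB => by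
    rw [← hD0, exchange C.mpH hΘ C.eqvH (b.meas hB) fun h z => by simp [b.smul], b.mass B hB]
  have hmass' : ∀ B, MeasurableSet B → m (π' ⁻¹' B ∩ D) = c * ν B := fun B hB => by
    rw [← hD0, hdom _ (b'.meas hB) fun h z => by simp [b'.smul], b'.mass B hB]
  have hne : ∀ {a : ℝ≥0∞}, c * a = 0 → a = 0 := fun h =>
    (mul_eq_zero.1 h).resolve_left b.ne_zero
  have hfull : ∀ᵐ x ∂μ, x ∈ π '' D := by
    have h1 := hD.image_of_measurable_injOn b.meas hinj
    refine hne ((hmass _ h1.compl).symm.trans ?_)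
    convert measure_empty (μ := m)
    rw [Set.eq_empty_iff_forall_notMem]
    exact fun z hz => hz.1 ⟨z, hz.2, rfl⟩
  have hfull' : ∀ᵐ y ∂ν, y ∈ π' '' D := by
    have h1 := hD.image_of_measurable_injOn b'.meas hinj'
    refine hne ((hmass' _ h1.compl).symm.trans ?_)
    convert measure_empty (μ := m)
    rw [Set.eq_empty_iff_forall_notMem]
    exact fun z hz => hz.1 ⟨z, hz.2, rfl⟩
  have hneZ : Nonempty Z := by
    by_contra h
    have := not_nonempty_iff.1 h
    exact C.ne_zero (Measure.eq_zero_of_isEmpty m)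
  have : StandardBorelSpace D := hD.standardBorel
  have e1 : MeasurableEmbedding fun z : D => π z := (b.meas.comp measurable_subtype_coe).measurableEmbedding
    hinj.injective
  have e2 : MeasurableEmbedding fun z : D => π' z := (b'.meas.comp measurable_subtype_coe).measurableEmbedding
    hinj'.injective
  obtain ⟨F, hF, hFπ⟩ := e1.exists_measurable_extend (b'.meas.comp measurable_subtype_coe)
    fun _ => hneZ.map π'
  obtain ⟨F', hF', hFπ'⟩ := e2.exists_measurable_extend (b.meas.comp measurable_subtype_coe)
    fun _ => hneZ.map π
  have hFz : ∀ z ∈ D, F (π z) = π' z := fun z hz => congr_fun hFπ ⟨z, hz⟩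
  have hFz' : ∀ z ∈ D, F' (π' z) = π z := fun z hz => congr_fun hFπ' ⟨z, hz⟩
  refine ⟨F, ⟨hF, ⟨hF, Measure.ext fun B hB => ?_⟩, F', hF', ?_, ?_⟩, fun g => ?_⟩
  · rw [Measure.map_apply hF hB]
    refine (ENNReal.mul_right_inj b.ne_zero hc).1 ?_
    rw [← hmass _ (hF hB), ← hmass' _ hB]
    congr 1
    ext z
    simp only [Set.mem_inter_iff, Set.mem_preimage, and_congr_left_iff]
    intro hz
    rw [hFz z hz]
  · filter_upwards [hfull] with x hx
    obtain ⟨z, hz, rfl⟩ := hx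
    rw [hFz z hz, hFz' z hz]
  · filter_upwards [hfull'] with x hx
    obtain ⟨z, hz, rfl⟩ := hx
    rw [hFz' z hz, hFz z hz]
  · filter_upwards [hfull] with x hx
    obtain ⟨z, hz, rfl⟩ := hx
    have h1 : α g • g • z ∈ D := by
      refine ⟨?_, (C.strict_smul' hΘ _ _).2 ((strict_smul _ _).2 hz.2)⟩
      change Θ _ = 1
      rw [hΘ.mul, hz.2 g, show Θ z = 1 from hz.1, one_mul, mul_inv_cancel]
    rw [← hπ, ← b.smul (α g), hFz _ h1, hFz z hz, hπ', b'.smul]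

end Conjugacy

section Selection
variable {G X Y : Type} [Group G] [Countable G] [MeasurableSpace X] [MulAction G X]
  [MeasurableSpace Y] {μ : Measure X}

theorem exists_inv_set (hm : ∀ g : G, MeasurePreserving (fun x : X => g • x) μ μ) {φ : X → Prop}
    (h : ∀ᵐ x ∂μ, φ x) : ∃ S : Set X, MeasurableSet S ∧ (∀ (g : G) x, g • x ∈ S ↔ x ∈ S) ∧
      (∀ᵐ x ∂μ, x ∈ S) ∧ ∀ x ∈ S, φ x := by
  obtain ⟨T, hT, hTm, hT0⟩ := exists_measurable_superset_of_null (ae_iff.1 h)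
  refine ⟨⋂ g : G, {x | g • x ∈ Tᶜ}, MeasurableSet.iInter fun g => (hm g).measurable hTm.compl,
    fun g x => ?_, ?_, fun x hx => ?_⟩
  · simp only [Set.mem_iInter, Set.mem_ofPred_eq, ← mul_smul]
    exact ⟨fun h k => by simpa using h (k * g⁻¹), fun h k => h (k * g)⟩
  · filter_upwards [ae_forall_smul hm (compl_mem_ae_iff.2 hT0 : ∀ᵐ x ∂μ, x ∈ Tᶜ)] with x hx
    exact Set.mem_iInter.2 hx
  · by_contra hn
    have := Set.mem_iInter.1 hx 1
    simp only [one_smul, Set.mem_ofPred_eq] at this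
    exact this (hT hn)

theorem exists_hit (hm : ∀ g : G, Measurable fun x : X => g • x) {U : Set X}
    (hU : MeasurableSet U) : ∃ σ : X → G, MF σ ∧ ∀ x, (∃ g : G, g • x ∈ U) → σ x • x ∈ U := by
  classical
  obtain ⟨e, he⟩ := exists_surjective_nat G
  have hE : MeasurableSet {x : X | ∃ g : G, g • x ∈ U} := by
    rw [Set.ofPred_exists]
    exact MeasurableSet.iUnion fun g => hm g hU
  have hp : ∀ x : X, ∃ n, e n • x ∈ U ∨ ¬ ∃ g : G, g • x ∈ U := fun x => by
    by_cases h : ∃ g : G, g • x ∈ U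
    · obtain ⟨g, hg⟩ := h
      obtain ⟨n, rfl⟩ := he g
      exact ⟨n, Or.inl hg⟩
    · exact ⟨0, Or.inr h⟩
  have hmeas := measurable_find hp fun k => (hm (e k) hU).union hE.compl
  refine ⟨fun x => e (Nat.find (hp x)), fun s => hmeas (MeasurableSet.of_discrete (s := e ⁻¹' s)),
    fun x hx => ?_⟩
  exact (Nat.find_spec (hp x)).resolve_right (not_not.2 hx)

omit [Group G] [MulAction G X] in
theorem measurable_select {σ : X → G} (hσ : MF σ) {F : G → X → Y} (hF : ∀ g, Measurable (F g)) :
    Measurable fun x => F (σ x) x := fun s hs => by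
  have : (fun x => F (σ x) x) ⁻¹' s = ⋃ g : G, σ ⁻¹' {g} ∩ F g ⁻¹' s := by
    ext x; simp
  rw [this]
  exact MeasurableSet.iUnion fun g => (hσ _).inter (hF g hs)

theorem ae_hit [IsProbabilityMeasure μ] (hm : ∀ g : G, Measurable fun x : X => g • x) {U : Set X}
    (hU : MeasurableSet U) (h0 : 0 < μ U) {g₀ : G} (hg : Ergodic (fun x : X => g₀ • x) μ) :
    ∀ᵐ x ∂μ, ∃ g : G, g • x ∈ U := by
  have hE : MeasurableSet {x : X | ∃ g : G, g • x ∈ U} := by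
    rw [Set.ofPred_exists]
    exact MeasurableSet.iUnion fun g => hm g hU
  have hinv : (fun x : X => g₀ • x) ⁻¹' {x : X | ∃ g : G, g • x ∈ U} =
      {x : X | ∃ g : G, g • x ∈ U} := by
    ext x
    simp only [Set.mem_preimage, Set.mem_ofPred_eq, ← mul_smul]
    exact ⟨fun ⟨g, h⟩ => ⟨_, h⟩, fun ⟨g, h⟩ => ⟨g * g₀⁻¹, by simpa using h⟩⟩
  rcases hg.toPreErgodic.ae_empty_or_univ hE hinv with h | h
  · refine absurd (measure_mono_null (fun x hx => ?_) (ae_eq_empty.1 h)) h0.ne'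
    exact ⟨1, by simpa using hx⟩
  · exact ae_eq_univ.1 h

omit [Group G] [MulAction G X] in
theorem tsum_measure_of_unique {S : G → Set X} {A : Set X} (hS : ∀ g, MeasurableSet (S g))
    (hA : ∀ᵐ x ∂μ, (∃ g, x ∈ S g) ↔ x ∈ A)
    (hu : ∀ᵐ x ∂μ, ∀ g g', x ∈ S g → x ∈ S g' → g = g') : ∑' g, μ (S g) = μ A := by
  rw [← measure_iUnion₀]
  · refine measure_congr ?_
    filter_upwards [hA] with x hx
    exact propext (Set.mem_iUnion.trans hx)
  · intro g g' hne
    refine measure_mono_null (fun x hx => ?_) (ae_iff.1 hu)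
    exact fun h => hne (h g g' hx.1 hx.2)
  · exact fun g => (hS g).nullMeasurableSet

end Selection

section Frame
variable {G X H Y : Type} [Group G] [MeasurableSpace X] [MulAction G X] [Group H]
  [MeasurableSpace Y] [MulAction H Y] {μ : Measure X} {ν : Measure Y}

/-- Points at which the stable orbit equivalence `f` and the two actions behave as expected. -/
structure StableOE.Good (f : StableOE G X H Y μ ν) (x : X) : Prop where
  hit : ∃ g : G, g • x ∈ f.U
  free : ∀ g : G, g ≠ 1 → g • x ≠ x
  free' : x ∈ f.U → ∀ h : H, h ≠ 1 → h • f.toFun x ≠ f.toFun x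
  orb : x ∈ f.U → f.toFun '' (MulAction.orbit G x ∩ f.U) = MulAction.orbit H (f.toFun x) ∩ f.V

/-- A conull invariant set of good points, and measurable choices of ways into `U` and `V`. -/
structure Frame (f : StableOE G X H Y μ ν) where
  S : Set X
  meas : MeasurableSet S
  inv : ∀ (g : G) x, g • x ∈ S ↔ x ∈ S
  conull : ∀ᵐ x ∂μ, x ∈ S
  good : ∀ x ∈ S, f.Good x
  σ : X → G
  mfσ : MF σ
  hitσ : ∀ x, (∃ g : G, g • x ∈ f.U) → σ x • x ∈ f.U
  τ : Y → H
  mfτ : MF τ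
  hitτ : ∀ y, (∃ h : H, h • y ∈ f.V) → τ y • y ∈ f.V
  mpG : ∀ g : G, MeasurePreserving (fun x : X => g • x) μ μ
  mpH : ∀ h : H, MeasurePreserving (fun y : Y => h • y) ν ν

theorem exists_frame [Countable G] [Countable H] [IsProbabilityMeasure μ]
    (hG : PmpAction G X μ) (hGf : FreeAction G X μ) (hH : PmpAction H Y ν)
    (hHf : FreeAction H Y ν) (f : StableOE G X H Y μ ν) {g₀ : G}
    (hg : Ergodic (fun x : X => g₀ • x) μ) : Nonempty (Frame f) := by
  have h1 : ∀ᵐ x ∂μ, ∀ g : G, g ≠ 1 → g • x ≠ x := ae_all_iff.2 fun g => by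
    by_cases h : g = 1
    · simp [h]
    · simpa [h, ae_iff] using hGf g h
  have h2 : ∀ᵐ y ∂ν, ∀ h : H, h ≠ 1 → h • y ≠ y := ae_all_iff.2 fun g => by
    by_cases h : g = 1
    · simp [h]
    · simpa [h, ae_iff] using hHf g h
  have h3 : ∀ᵐ x ∂μ, x ∈ f.U → ∀ h : H, h ≠ 1 → h • f.toFun x ≠ f.toFun x := by
    obtain ⟨T, hT, hTm, hT0⟩ := exists_measurable_superset_of_null (ae_iff.1 h2)
    have h4 := f.pushforward (T ∩ f.V) Set.inter_subset_right (hTm.inter f.measV)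
    rw [measure_mono_null Set.inter_subset_left hT0, mul_zero, mul_eq_zero,
      or_iff_right (by simp)] at h4
    refine measure_mono_null (fun x hx => ?_) h4
    simp only [Set.mem_compl_iff, Set.mem_ofPred_eq, Classical.not_imp] at hx
    exact ⟨hx.1, hT hx.2, f.maps hx.1⟩
  obtain ⟨S, hS, hinv, hS0, hgood⟩ := exists_inv_set hG (φ := f.Good) (by
    filter_upwards [h1, h3, f.orbit_eq, ae_hit (fun g => (hG g).measurable) f.measU f.posU hg]
      with x a b c d using ⟨d, a, b, c⟩)
  obtain ⟨σ, hσ, hσ'⟩ := exists_hit (fun g => (hG g).measurable) f.measU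
  obtain ⟨τ, hτ, hτ'⟩ := exists_hit (fun g => (hH g).measurable) f.measV
  exact ⟨⟨S, hS, hinv, hS0, hgood, σ, hσ, hσ', τ, hτ, hτ', hG, hH⟩⟩

namespace Frame
variable {f : StableOE G X H Y μ ν} (F : Frame f)

/-- The point of `V` associated with `x`. -/
def s (x : X) : Y := f.toFun (F.σ x • x)

/-- The point of `U` associated with `y`. -/
def t (y : Y) : X := f.invFun (F.τ y • y)

theorem hit {x : X} (hx : x ∈ F.S) : F.σ x • x ∈ f.U := F.hitσ x (F.good x hx).hit

theorem smul_inj {x : X} (hx : x ∈ F.S) {g g' : G} (h : g • x = g' • x) : g = g' := by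
  by_contra hne
  exact (F.good x hx).free (g'⁻¹ * g) (fun h => hne (inv_mul_eq_one.1 h).symm)
    (by rw [mul_smul, h, inv_smul_smul])

theorem s_inj {x : X} (hx : x ∈ F.S) {h h' : H} (e : h • F.s x = h' • F.s x) : h = h' := by
  by_contra hne
  exact (F.good _ ((F.inv _ _).2 hx)).free' (F.hit hx) (h'⁻¹ * h)
    (fun k => hne (inv_mul_eq_one.1 k).symm) (by
      change _ • F.s x = F.s x
      rw [mul_smul, e, inv_smul_smul])

theorem exists_smul {x : X} (hx : x ∈ F.S) {g : G} (hu : g • x ∈ f.U) :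
    ∃ h : H, f.toFun (g • x) = h • F.s x := by
  have h1 := (F.good _ ((F.inv (F.σ x) _).2 hx)).orb (F.hit hx)
  have h2 : f.toFun (g • x) ∈ f.toFun '' (MulAction.orbit G (F.σ x • x) ∩ f.U) :=
    ⟨_, ⟨⟨g * (F.σ x)⁻¹, by simp [mul_smul]⟩, hu⟩, rfl⟩
  rw [h1] at h2
  obtain ⟨⟨h, hh⟩, -⟩ := h2
  exact ⟨h, hh.symm⟩

theorem exists_s {x : X} (hx : x ∈ F.S) (g : G) : ∃ h : H, F.s (g • x) = h • F.s x := by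
  have h1 := F.hit ((F.inv g x).2 hx)
  rw [← mul_smul] at h1
  obtain ⟨h, hh⟩ := F.exists_smul hx h1
  exact ⟨h, by rw [← hh, s, mul_smul]⟩

theorem exists_t {x : X} (hx : x ∈ F.S) (h : H) : ∃ g : G, x = g • F.t (h • F.s x) := by
  have h1 := (F.good _ ((F.inv (F.σ x) _).2 hx)).orb (F.hit hx)
  have h2 : F.τ (h • F.s x) • h • F.s x ∈ f.V :=
    F.hitτ _ ⟨h⁻¹, by rw [inv_smul_smul]; exact f.maps (F.hit hx)⟩
  have h3 : F.τ (h • F.s x) • h • F.s x ∈ MulAction.orbit H (f.toFun (F.σ x • x)) ∩ f.V :=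
    ⟨⟨F.τ (h • F.s x) * h, mul_smul _ _ _⟩, h2⟩
  rw [← h1] at h3
  obtain ⟨u, ⟨⟨g, hg⟩, hu⟩, hfu⟩ := h3
  refine ⟨(g * F.σ x)⁻¹, ?_⟩
  rw [t, ← hfu, f.left_inv u hu, ← hg]
  simp [← mul_smul]

/-- The coupling space: pairs of points in matched orbits. -/
def Ω : Set (X × Y) := {p | p.1 ∈ F.S ∧ ∃ h : H, p.2 = h • F.s p.1}

instance : MulAction G F.Ω where
  smul g z := ⟨(g • z.1.1, z.1.2), (F.inv _ _).2 z.2.1, by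
    obtain ⟨h, hh⟩ := z.2.2
    obtain ⟨k, hk⟩ := F.exists_s z.2.1 g
    exact ⟨h * k⁻¹, by rw [hh, hk, mul_smul, inv_smul_smul]⟩⟩
  one_smul z := Subtype.ext (Prod.ext (one_smul _ _) rfl)
  mul_smul g g' z := Subtype.ext (Prod.ext (mul_smul _ _ _) rfl)

instance : MulAction H F.Ω where
  smul h z := ⟨(z.1.1, h • z.1.2), z.2.1, by
    obtain ⟨k, hk⟩ := z.2.2
    exact ⟨h * k, by rw [hk, mul_smul]⟩⟩
  one_smul z := Subtype.ext (Prod.ext rfl (one_smul _ _))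
  mul_smul g g' z := Subtype.ext (Prod.ext rfl (mul_smul _ _ _))

theorem smul_fst (g : G) (z : F.Ω) : (g • z).1 = (g • z.1.1, z.1.2) := rfl

theorem smul_snd (h : H) (z : F.Ω) : (h • z).1 = (z.1.1, h • z.1.2) := rfl

noncomputable def rH (z : F.Ω) : H := z.2.2.choose

theorem rH_eq_iff {z : F.Ω} {h : H} : F.rH z = h ↔ z.1.2 = h • F.s z.1.1 := by
  have h1 : z.1.2 = F.rH z • F.s z.1.1 := z.2.2.choose_spec
  exact ⟨fun e => e ▸ h1, fun e => F.s_inj z.2.1 (h1.symm.trans e)⟩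

theorem exists_rG (z : F.Ω) : ∃ g : G, z.1.1 = g • F.t z.1.2 := by
  obtain ⟨h, hh⟩ := z.2.2
  rw [hh]
  exact F.exists_t z.2.1 h

noncomputable def rG (z : F.Ω) : G := (F.exists_rG z).choose

theorem rG_eq_iff {z : F.Ω} {g : G} : F.rG z = g ↔ z.1.1 = g • F.t z.1.2 := by
  have h1 : z.1.1 = F.rG z • F.t z.1.2 := (F.exists_rG z).choose_spec
  refine ⟨fun e => e ▸ h1, fun e => F.smul_inj (x := F.t z.1.2) ?_ (h1.symm.trans e)⟩
  have := z.2.1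
  rwa [h1, F.inv] at this

section Measurability
variable [Countable G] [Countable H] [StandardBorelSpace X] [StandardBorelSpace Y]

omit [Countable H] [StandardBorelSpace X] [StandardBorelSpace Y] in
theorem s_meas : Measurable F.s :=
  measurable_select F.mfσ (F := fun g x => f.toFun (g • x)) fun g =>
    f.meas_toFun.comp (F.mpG g).measurable

omit [Countable G] [StandardBorelSpace X] [StandardBorelSpace Y] in
theorem t_meas : Measurable F.t :=
  measurable_select F.mfτ (F := fun g x => f.invFun (g • x)) fun g =>
    f.meas_invFun.comp (F.mpH g).measurable

omit [Countable H] [StandardBorelSpace X] in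
theorem meas_eq_s (h : H) : MeasurableSet {p : X × Y | p.2 = h • F.s p.1} :=
  measurableSet_eq_fun measurable_snd ((F.mpH h).measurable.comp (F.s_meas.comp measurable_fst))

omit [Countable G] [StandardBorelSpace Y] in
theorem meas_eq_t (g : G) : MeasurableSet {p : X × Y | p.1 = g • F.t p.2} :=
  measurableSet_eq_fun measurable_fst ((F.mpG g).measurable.comp (F.t_meas.comp measurable_snd))

omit [StandardBorelSpace X] in
theorem measΩ : MeasurableSet F.Ω := by
  have : F.Ω = (Prod.fst ⁻¹' F.S) ∩ ⋃ h : H, {p : X × Y | p.2 = h • F.s p.1} := by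
    ext p; simp [Ω]
  rw [this]
  exact (measurable_fst F.meas).inter (MeasurableSet.iUnion F.meas_eq_s)

omit [StandardBorelSpace X] in
theorem eqvH : Eqv H F.rH := by
  refine ⟨MF.of_fibers fun h => ?_, fun h z => ?_⟩
  · have : F.rH ⁻¹' {h} = Subtype.val ⁻¹' {p : X × Y | p.2 = h • F.s p.1} := by
      ext z; exact F.rH_eq_iff
    rw [this]
    exact measurable_subtype_coe (F.meas_eq_s h)
  · rw [F.rH_eq_iff, smul_snd, smul_eq_mul, mul_smul, ← F.rH_eq_iff.1 rfl]

omit [StandardBorelSpace Y] in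
theorem eqvG : Eqv G F.rG := by
  refine ⟨MF.of_fibers fun h => ?_, fun h z => ?_⟩
  · have : F.rG ⁻¹' {h} = Subtype.val ⁻¹' {p : X × Y | p.1 = h • F.t p.2} := by
      ext z; exact F.rG_eq_iff
    rw [this]
    exact measurable_subtype_coe (F.meas_eq_t h)
  · rw [F.rG_eq_iff, smul_fst, smul_eq_mul, mul_smul, ← F.rG_eq_iff.1 rfl]

end Measurability
end Frame
end Frame

namespace Frame
variable {G X H Y : Type} [Group G] [MeasurableSpace X] [MulAction G X] [Group H]
  [MeasurableSpace Y] [MulAction H Y] {μ : Measure X} {ν : Measure Y}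
  {f : StableOE G X H Y μ ν} (F : Frame f)

/-- The measure on `X × Y` supported on pairs of points in matched orbits. -/
noncomputable def M : Measure (X × Y) :=
  Measure.sum fun h : H => μ.map fun x => (x, h • F.s x)

/-- The coupling measure. -/
noncomputable def mΩ : Measure F.Ω := F.M.comap Subtype.val

variable [Countable G] [Countable H] [StandardBorelSpace X] [StandardBorelSpace Y]

omit [Countable H] [StandardBorelSpace X] [StandardBorelSpace Y] in
theorem meas_graph (h : H) : Measurable fun x => (x, h • F.s x) :=
  measurable_id.prodMk ((F.mpH h).measurable.comp F.s_meas)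

omit [Countable H] [StandardBorelSpace X] [StandardBorelSpace Y] in
theorem M_apply {B : Set (X × Y)} (hB : MeasurableSet B) :
    F.M B = ∑' h : H, μ {x | (x, h • F.s x) ∈ B} := by
  rw [M, Measure.sum_apply _ hB]
  exact tsum_congr fun h => Measure.map_apply (F.meas_graph h) hB

omit [StandardBorelSpace X] in
theorem M_compl : F.M F.Ωᶜ = 0 := by
  rw [F.M_apply F.measΩ.compl, ENNReal.tsum_eq_zero]
  intro h
  refine measure_mono_null ?_ (ae_iff.1 F.conull)
  exact fun x hx hxS => hx ⟨hxS, h, rfl⟩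

omit [StandardBorelSpace X] in
theorem mΩ_apply (B : Set (X × Y)) : F.mΩ (Subtype.val ⁻¹' B) = F.M B := by
  rw [mΩ, comap_subtype_coe_apply F.measΩ, Subtype.image_preimage_coe]
  refine le_antisymm (measure_mono Set.inter_subset_right) ?_
  refine (measure_mono (t := (F.Ω ∩ B) ∪ F.Ωᶜ) fun p hp => ?_).trans
    ((measure_union_le _ _).trans_eq (by rw [F.M_compl, add_zero]))
  by_cases h : p ∈ F.Ω
  exacts [Or.inl ⟨h, hp⟩, Or.inr h]

omit [StandardBorelSpace X] in
theorem mpHΩ (h : H) : MeasurePreserving (fun z : F.Ω => h • z) F.mΩ F.mΩ := by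
  have h1 : Measurable fun p : X × Y => (p.1, h • p.2) :=
    measurable_fst.prodMk ((F.mpH h).measurable.comp measurable_snd)
  have h2 : Measurable fun z : F.Ω => h • z := (h1.comp measurable_subtype_coe).subtype_mk
  refine ⟨h2, Measure.ext fun E hE => ?_⟩
  rw [Measure.map_apply h2 hE]
  obtain ⟨B, hB, rfl⟩ := hE
  rw [show (fun z : F.Ω => h • z) ⁻¹' (Subtype.val ⁻¹' B) =
    Subtype.val ⁻¹' ((fun p : X × Y => (p.1, h • p.2)) ⁻¹' B) from rfl, F.mΩ_apply, F.mΩ_apply,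
    F.M_apply hB, F.M_apply (h1 hB), 
    ← (Equiv.mulLeft h).tsum_eq fun k => μ {x | (x, k • F.s x) ∈ B}]
  simp [mul_smul]

omit [StandardBorelSpace X] in
theorem mpGΩ (g : G) : MeasurePreserving (fun z : F.Ω => g • z) F.mΩ F.mΩ := by
  have h1 : Measurable fun p : X × Y => (g • p.1, p.2) :=
    ((F.mpG g).measurable.comp measurable_fst).prodMk measurable_snd
  have h2 : Measurable fun z : F.Ω => g • z := (h1.comp measurable_subtype_coe).subtype_mk
  refine ⟨h2, Measure.ext fun E hE => ?_⟩
  rw [Measure.map_apply h2 hE]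
  obtain ⟨B, hB, rfl⟩ := hE
  have hS1 : ∀ h : H, MeasurableSet {x | (g • x, h • F.s x) ∈ B} := fun h =>
    F.meas_graph h (h1 hB)
  have hS2 : ∀ h : H, MeasurableSet {x | (g • x, h • F.s (g • x)) ∈ B} := fun h =>
    (F.mpG g).measurable (F.meas_graph h hB)
  have hint : ∀ {S : H → Set X}, (∀ h, MeasurableSet (S h)) →
      ∑' h, μ (S h) = ∫⁻ x, ∑' h, (S h).indicator 1 x ∂μ := fun {S} hS => by
    rw [lintegral_tsum fun h => (measurable_one.indicator (hS h)).aemeasurable]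
    exact tsum_congr fun h => (lintegral_indicator_one (hS h)).symm
  rw [show (fun z : F.Ω => g • z) ⁻¹' (Subtype.val ⁻¹' B) =
    Subtype.val ⁻¹' ((fun p : X × Y => (g • p.1, p.2)) ⁻¹' B) from rfl, F.mΩ_apply, F.mΩ_apply,
    F.M_apply hB, F.M_apply (h1 hB)]
  have h3 : ∀ h : H, μ {x | (x, h • F.s x) ∈ B} = μ {x | (g • x, h • F.s (g • x)) ∈ B} :=
    fun h => (measure_translate F.mpG (F.meas_graph h hB) g).symm
  simp only [h3]
  change ∑' h : H, μ {x | (g • x, h • F.s x) ∈ B} = _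
  rw [hint hS1, hint hS2]
  refine lintegral_congr_ae ?_
  filter_upwards [F.conull] with x hx
  obtain ⟨k, hk⟩ := F.exists_s hx g
  rw [← (Equiv.mulRight k).tsum_eq fun h => Set.indicator {x | (g • x, h • F.s x) ∈ B} 1 x]
  refine tsum_congr fun h => ?_
  classical
  rw [Set.indicator_apply, Set.indicator_apply]
  simp only [Set.mem_ofPred_eq, Equiv.coe_mulRight, hk, mul_smul]

omit [StandardBorelSpace X] in
theorem mass_fst {B : Set X} (hB : MeasurableSet B) :
    F.mΩ ((fun z : F.Ω => z.1.1) ⁻¹' B ∩ {z | F.rH z = 1}) = μ B := by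
  have h1 : (fun z : F.Ω => z.1.1) ⁻¹' B ∩ {z | F.rH z = 1} =
      Subtype.val ⁻¹' (Prod.fst ⁻¹' B ∩ {p : X × Y | p.2 = (1 : H) • F.s p.1}) := by
    ext z
    exact and_congr_right' F.rH_eq_iff
  have h2 := (measurable_fst hB).inter (F.meas_eq_s 1)
  rw [h1, F.mΩ_apply, F.M_apply h2]
  refine tsum_measure_of_unique (fun h => F.meas_graph h h2) ?_ ?_
  · refine Filter.Eventually.of_forall fun x => ⟨fun ⟨h, hh⟩ => hh.1, fun hx => ⟨1, hx, rfl⟩⟩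
  · filter_upwards [F.conull] with x hx h h' e e'
    exact F.s_inj hx (Eq.trans e.2 (Eq.symm e'.2))

omit [StandardBorelSpace Y] in
theorem mass_graph {B : Set Y} (hB : MeasurableSet B) [StandardBorelSpace Y] (hBV : B ⊆ f.V) :
    F.M {p | p.2 ∈ B ∧ p.1 = f.invFun p.2} = μ (f.U ∩ f.toFun ⁻¹' B) := by
  have h2 : MeasurableSet {p : X × Y | p.2 ∈ B ∧ p.1 = f.invFun p.2} :=
    (measurable_snd hB).inter
      (measurableSet_eq_fun measurable_fst (f.meas_invFun.comp measurable_snd))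
  rw [F.M_apply h2]
  refine tsum_measure_of_unique (fun h => F.meas_graph h h2) ?_ ?_
  · filter_upwards [F.conull] with x hx
    constructor
    · rintro ⟨h, hh, e⟩
      change h • F.s x ∈ B at hh
      change x = f.invFun (h • F.s x) at e
      rw [e]
      exact ⟨f.maps_inv (hBV hh), by rwa [Set.mem_preimage, f.right_inv _ (hBV hh)]⟩
    · rintro ⟨hU, hxB⟩
      obtain ⟨h, hh⟩ := F.exists_smul (g := 1) hx (by simpa using hU)
      rw [one_smul] at hh
      refine ⟨h, ?_, ?_⟩
      · change h • F.s x ∈ B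
        rwa [← hh]
      · change x = f.invFun (h • F.s x)
        rw [← hh, f.left_inv x hU]
  · filter_upwards [F.conull] with x hx h h' e e'
    refine F.s_inj hx ?_
    have h3 := f.right_inv _ (hBV e.1)
    have h4 := f.right_inv _ (hBV e'.1)
    have h5 : f.invFun (h • F.s x) = f.invFun (h' • F.s x) := Eq.trans (Eq.symm e.2) e'.2
    exact h3.symm.trans ((congrArg _ h5).trans h4)

theorem mass_snd [IsProbabilityMeasure μ] [IsProbabilityMeasure ν]
    (hhit : ∀ᵐ y ∂ν, ∃ h : H, h • y ∈ f.V) {B : Set Y} (hB : MeasurableSet B) :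
    F.mΩ ((fun z : F.Ω => z.1.2) ⁻¹' B ∩ {z | F.rG z = 1}) = f.kappa⁻¹ * ν B := by
  have hτm : Measurable fun y => F.τ y • y :=
    measurable_select F.mfτ (F := fun h y => h • y) fun h => (F.mpH h).measurable
  have h1 : MeasurableSet ((fun z : F.Ω => z.1.2) ⁻¹' B ∩ {z | F.rG z = 1}) :=
    (measurable_snd.comp measurable_subtype_coe hB).inter (F.eqvG.mf.eq 1)
  have h2 : MF fun z : F.Ω => F.τ z.1.2 := fun s =>
    measurable_snd.comp measurable_subtype_coe (F.mfτ s)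
  let B' : H → Set Y := fun k => {y | k⁻¹ • y ∈ B ∧ F.τ (k⁻¹ • y) = k} ∩ f.V
  have hB' : ∀ k, MeasurableSet (B' k) := fun k =>
    ((F.mpH k⁻¹).measurable (hB.inter (F.mfτ.eq k))).inter f.measV
  have h3 : ∀ k : H, F.mΩ ((fun z : F.Ω => z.1.2) ⁻¹' B ∩ {z | F.rG z = 1} ∩ {z | F.τ z.1.2 = k}) =
      f.kappa⁻¹ * ν {y | k • y ∈ B' k} := fun k => by
    rw [← measure_translate F.mpHΩ (h1.inter (h2.eq k)) k⁻¹]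
    have h4 : {z : F.Ω | k⁻¹ • z ∈ (fun z : F.Ω => z.1.2) ⁻¹' B ∩ {z | F.rG z = 1} ∩
        {z | F.τ z.1.2 = k}} = Subtype.val ⁻¹' {p | p.2 ∈ B' k ∧ p.1 = f.invFun p.2} := by
      ext z
      change ((k⁻¹ • z.1.2 ∈ B ∧ F.rG (k⁻¹ • z) = 1) ∧ F.τ (k⁻¹ • z.1.2) = k) ↔
        (((k⁻¹ • z.1.2 ∈ B ∧ F.τ (k⁻¹ • z.1.2) = k) ∧ z.1.2 ∈ f.V) ∧ z.1.1 = f.invFun z.1.2)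
      rw [F.rG_eq_iff, smul_snd, one_smul, t]
      constructor
      · rintro ⟨⟨a, b⟩, c⟩
        rw [c, smul_inv_smul] at b
        refine ⟨⟨⟨a, c⟩, ?_⟩, b⟩
        have h5 := F.hitτ (k⁻¹ • z.1.2) ?_
        · rwa [c, smul_inv_smul] at h5
        · obtain ⟨h, hh⟩ := z.2.2
          refine ⟨h⁻¹ * k, ?_⟩
          rw [mul_smul, smul_inv_smul, hh, inv_smul_smul]
          exact f.maps (F.hit z.2.1)
      · rintro ⟨⟨⟨a, c⟩, d⟩, b⟩
        refine ⟨⟨a, ?_⟩, c⟩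
        rw [c, smul_inv_smul, ← b]
    rw [h4, F.mΩ_apply, F.mass_graph (hB' k) Set.inter_subset_right,
      measure_translate F.mpH (hB' k) k]
    have h5 := f.pushforward (B' k) Set.inter_subset_right (hB' k)
    rw [StableOE.kappa, ENNReal.inv_div (Or.inl (measure_ne_top _ _)) (Or.inl f.posU.ne'),
      div_eq_mul_inv, mul_assoc, ← h5, ← mul_assoc, ENNReal.mul_inv_cancel f.posU.ne'
      (measure_ne_top _ _), one_mul]
  rw [measure_eq_tsum h2 h1]
  simp only [h3]
  rw [ENNReal.tsum_mul_left]
  congr 1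
  refine tsum_measure_of_unique (fun k => (F.mpH k).measurable (hB' k)) ?_ ?_
  · filter_upwards [hhit] with y hy
    have h6 := F.hitτ y hy
    constructor
    · rintro ⟨k, ⟨hk, -⟩, -⟩
      simpa using hk
    · exact fun h => ⟨F.τ y, by simpa [B'] using ⟨h, h6⟩⟩
  · refine Filter.Eventually.of_forall fun y k k' e e' => ?_
    have h7 := e.1.2
    have h8 := e'.1.2
    simp only [inv_smul_smul] at h7 h8
    exact h7.symm.trans h8

end Frame

theorem StableOE.kappa_ne {G X H Y : Type} [Group G] [MeasurableSpace X]
    [MulAction G X] [Group H] [MeasurableSpace Y] [MulAction H Y] {μ : Measure X} {ν : Measure Y}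
    [IsProbabilityMeasure μ] [IsProbabilityMeasure ν] (f : StableOE G X H Y μ ν) :
    f.kappa ≠ 0 ∧ f.kappa ≠ ⊤ :=
  ⟨(ENNReal.div_pos f.posV.ne' (measure_ne_top _ _)).ne',
    ENNReal.div_ne_top (measure_ne_top _ _) f.posU.ne'⟩

namespace Frame
variable {G X H Y : Type} [Group G] [MeasurableSpace X] [MulAction G X] [Group H]
  [MeasurableSpace Y] [MulAction H Y] {μ : Measure X} {ν : Measure Y}
  {f : StableOE G X H Y μ ν} (F : Frame f)
  [Countable G] [Countable H] [StandardBorelSpace X] [StandardBorelSpace Y]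

omit [StandardBorelSpace X] in
theorem base_fst : Base H F.rH F.mΩ (fun z : F.Ω => z.1.1) μ 1 where
  meas := measurable_fst.comp measurable_subtype_coe
  smul _ _ := rfl
  inj z hz z' hz' h := by
    have h1 := F.rH_eq_iff.1 hz
    have h2 := F.rH_eq_iff.1 hz'
    simp only at h
    rw [← h] at h2
    exact Subtype.ext (Prod.ext h (h1.trans h2.symm))
  mass B hB := by rw [one_mul, F.mass_fst hB]
  ne_zero := one_ne_zero

variable [IsProbabilityMeasure μ] [IsProbabilityMeasure ν]
  (hhit : ∀ᵐ y ∂ν, ∃ h : H, h • y ∈ f.V)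

include hhit

theorem base_snd : Base G F.rG F.mΩ (fun z : F.Ω => z.1.2) ν f.kappa⁻¹ where
  meas := measurable_snd.comp measurable_subtype_coe
  smul _ _ := rfl
  inj z hz z' hz' h := by
    have h1 := F.rG_eq_iff.1 hz
    have h2 := F.rG_eq_iff.1 hz'
    simp only at h
    rw [← h] at h2
    exact Subtype.ext (Prod.ext (h1.trans h2.symm) h)
  mass B hB := F.mass_snd hhit hB
  ne_zero := ENNReal.inv_ne_zero.2 f.kappa_ne.2

/-- The coupling attached to a stable orbit equivalence. -/
noncomputable def coupling : Coupling G H F.mΩ where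
  rG := F.rG
  rH := F.rH
  comm _ _ _ := rfl
  mpG := F.mpGΩ
  mpH := F.mpHΩ
  eqvG := F.eqvG
  eqvH := F.eqvH
  finG := by
    have h := (F.base_snd hhit).mass Set.univ MeasurableSet.univ
    rw [Set.preimage_univ, Set.univ_inter, measure_univ, mul_one] at h
    rw [h]
    exact (ENNReal.inv_ne_top.2 f.kappa_ne.1).lt_top
  finH := by
    have h := F.base_fst.mass Set.univ MeasurableSet.univ
    rw [Set.preimage_univ, Set.univ_inter, measure_univ, mul_one] at h
    rw [h]
    exact ENNReal.one_lt_top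
  ne_zero h0 := by
    have h := F.base_fst.mass Set.univ MeasurableSet.univ
    simp [h0] at h

omit hhit in
/-- Sections of the coupling given by representatives of orbits in `U`. -/
theorem exists_section {p : X → X} (hp : Measurable p)
    (h : ∀ᵐ x ∂μ, p x ∈ f.U ∧ p x ∈ MulAction.orbit G x) :
    ∃ j : X → F.Ω, Measurable j ∧ ∀ᵐ x ∂μ, (j x).1 = (x, f.toFun (p x)) := by
  classical
  have hm : Measurable fun x => (x, f.toFun (p x)) :=
    measurable_id.prodMk (f.meas_toFun.comp hp)
  have hae : ∀ᵐ x ∂μ, (x, f.toFun (p x)) ∈ F.Ω := by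
    filter_upwards [h, F.conull] with x hx hS
    obtain ⟨hU, g, hg⟩ := hx
    simp only at hg
    rw [← hg] at hU ⊢
    exact ⟨hS, F.exists_smul hS hU⟩
  obtain ⟨x₀, hx₀⟩ := hae.exists
  have hj : ∀ x, (if (x, f.toFun (p x)) ∈ F.Ω then (x, f.toFun (p x))
      else (x₀, f.toFun (p x₀))) ∈ F.Ω := fun x => by
    split_ifs with h1
    exacts [h1, hx₀]
  refine ⟨fun x => ⟨_, hj x⟩,
    (Measurable.ite (hm F.measΩ) hm measurable_const).subtype_mk, ?_⟩
  filter_upwards [hae] with x hx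
  exact if_pos hx

theorem rigid {Θ : F.Ω → H} {α : G ≃* H} (hΘ : Eqv H Θ)
    (hα : ∀ g, ∀ᵐ z ∂F.mΩ, Θ (g • z) = Θ z * (α g)⁻¹)
    (hdom : ∀ E, MeasurableSet E → (∀ (g : G) (z : F.Ω), g • z ∈ E ↔ z ∈ E) →
      F.mΩ (E ∩ {z | Θ z = 1}) = F.mΩ (E ∩ {z | F.rG z = 1})) :
    f.kappa = 1 ∧ (∀ c : G → X → H, f.IsSOECocycle c →
      Cohomologous G X H μ c fun g _ => α g) ∧ ConjugateVia G X H Y μ ν α := by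
  have : StandardBorelSpace F.Ω := F.measΩ.standardBorel
  have hκ : (1 : ℝ≥0∞) = f.kappa⁻¹ := by
    have h1 := F.base_fst.mass Set.univ MeasurableSet.univ
    have h2 := (F.base_snd hhit).mass Set.univ MeasurableSet.univ
    have h3 := hdom Set.univ MeasurableSet.univ (by simp)
    have h4 := (F.coupling hhit).dom_eq hΘ
    simp only [Set.preimage_univ, Set.univ_inter, measure_univ, mul_one] at h1 h2 h3
    rw [← h1, ← h2, ← h3]
    exact h4.symm
  refine ⟨(ENNReal.inv_eq_one.1 hκ.symm), fun c hc => ?_,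
    (F.coupling hhit).conjugateVia hΘ hα F.base_fst (F.base_snd hhit) (fun _ _ => rfl)
      (fun _ _ => rfl) hκ ENNReal.one_ne_top hdom⟩
  obtain ⟨-, p, hp, hpU, hpc⟩ := hc
  obtain ⟨j, hj, hjp⟩ := F.exists_section hp hpU
  refine (F.coupling hhit).cohomologous hΘ hα F.base_fst hj ?_ fun g => ?_
  · filter_upwards [hjp] with x hx
    rw [hx]
  · filter_upwards [hjp, (F.mpG g).quasiMeasurePreserving.ae hjp, hpc g] with x h1 h2 h3
    refine Subtype.ext ?_
    rw [h2, smul_snd, smul_fst, h1, h3]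

end Frame

theorem star_ne_univ {V : Type} {Γ : SimpleGraph V} (h : ∀ v : V, ∃ u : V, u ≠ v ∧ ¬ Γ.Adj v u) (v : V) :
    star Γ v ≠ Set.univ := fun hv => by
  obtain ⟨u, hu, huv⟩ := h v
  rcases (hv ▸ Set.mem_univ u : u ∈ star Γ v) with h | h
  exacts [hu h, huv h]

/-- Rigidity of stable orbit equivalences when every maximal join parabolic
subgroup of `G` has nontrivial center. -/
theorem stmt2
    {V W : Type} [Fintype V] [Fintype W]
    (Γ : SimpleGraph V) (Λ : SimpleGraph W)
    (hΓconn : Γ.Connected) (hΓcard : 2 ≤ Fintype.card V)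
    (hΓcenterless : ∀ v : V, ∃ u : V, u ≠ v ∧ ¬ Γ.Adj v u)
    (hΛconn : Λ.Connected) (hΛcard : 2 ≤ Fintype.card W)
    (hΛcenterless : ∀ w : W, ∃ u : W, u ≠ w ∧ ¬ Λ.Adj w u)
    (hmax : ∀ P : Subgroup (RAAG Γ), IsMaxJoinParabolic Γ P → ∃ x ∈ subCenter P, x ≠ 1)
    (X Y : Type) [MeasurableSpace X] [MeasurableSpace Y]
    [StandardBorelSpace X] [StandardBorelSpace Y]
    (μ : Measure X) (ν : Measure Y) [IsProbabilityMeasure μ] [IsProbabilityMeasure ν]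
    [MulAction (RAAG Γ) X] [MulAction (RAAG Λ) Y]
    (hXpmp : PmpAction (RAAG Γ) X μ) (hXfree : FreeAction (RAAG Γ) X μ)
    (hXirr : IrreducibleAction (RAAG Γ) X μ)
    (hYpmp : PmpAction (RAAG Λ) Y ν) (hYfree : FreeAction (RAAG Λ) Y ν)
    (hYirr : IrreducibleAction (RAAG Λ) Y ν)
    (f : StableOE (RAAG Γ) X (RAAG Λ) Y μ ν) :
    f.kappa = 1 ∧
    (∀ c : RAAG Γ → X → RAAG Λ, f.IsSOECocycle c →
      ∃ α : RAAG Γ ≃* RAAG Λ, Cohomologous (RAAG Γ) X (RAAG Λ) μ c fun g _ => α g) ∧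
    ∃ α : RAAG Γ ≃* RAAG Λ, ConjugateVia (RAAG Γ) X (RAAG Λ) Y μ ν α := by
  obtain ⟨n, Δ, e, he⟩ := hXirr
  obtain ⟨n', Δ', e', he'⟩ := hYirr
  have : Nontrivial V := Fintype.one_lt_card_iff_nontrivial.1 hΓcard
  have : Nontrivial W := Fintype.one_lt_card_iff_nontrivial.1 hΛcard
  have hΔ := connected_of_equiv hΓconn e
  have hΔ' := connected_of_equiv hΛconn e'
  have hΔs := star_ne_univ_of_equiv (star_ne_univ hΓcenterless) e
  obtain ⟨v₀⟩ := hΔ.nonempty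
  obtain ⟨w₀⟩ := hΔ'.nonempty
  obtain ⟨F⟩ := exists_frame hXpmp hXfree hYpmp hYfree f (he v₀)
  have hhit := ae_hit (fun h => (hYpmp h).measurable) f.measV f.posV (he' w₀)
  have : StandardBorelSpace F.Ω := F.measΩ.standardBorel
  obtain ⟨Θ, α, hΘ, hα, hdom⟩ := (F.coupling hhit).exists_iso_of_raag (joinCentral_of_max hmax)
    hΔ hΔs hΔ' e e' (fun v => F.base_fst.erg F.eqvH F.mpHΩ (fun _ => rfl) (he v))
    fun w => (F.base_snd hhit).erg F.eqvG F.mpGΩ (fun _ => rfl) (he' w)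
  obtain ⟨h1, h2, h3⟩ := F.rigid hhit hΘ hα hdom
  exact ⟨h1, fun c hc => ⟨α, h2 c hc⟩, α, h3⟩

end OEPaper
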